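/- Let F = {f_j} be a family of meromorphic functions on a domain D ⊂ ℂ. Let φ_j(z) be a sequence of holomorphic functions on D with φ_j → φ locally uniformly on D, where φ is a holomorphic function on D with φ(z) ≠ 0 (nowhere vanishing). Let k, m, n be positive integers such that (k+2)/n + 1/m + k/(mn) < 1. If for each j every zero of (f_j^n)^{(k)} − φ_j(z) has multiplicity at least m, then F is normal in D. -/

import Mathlib

open Complex Topology Filter Set MeasureTheory
open scoped ENNReal NNReal Classical

noncomputable section


/-- The chordal (spherical) distance on the Riemann sphere `ℂ ∪ {∞}`. -/
def sphDist (a b : OnePoint ℂ) : ℝ :=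
  Option.elim a (Option.elim b 0 fun w => 1 / Real.sqrt (1 + ‖w‖ ^ 2))
    fun z => Option.elim b (1 / Real.sqrt (1 + ‖z‖ ^ 2))
      fun w => ‖z - w‖ / (Real.sqrt (1 + ‖z‖ ^ 2) * Real.sqrt (1 + ‖w‖ ^ 2))

/-- The natural Riemann-sphere-valued version of a meromorphic function:
at points where the function blows up (poles) the value is `∞`. -/
def toSphere (f : ℂ → ℂ) : ℂ → OnePoint ℂ := fun z =>
  if Tendsto (fun w => ‖f w‖) (𝓝[≠] z) atTop then OnePoint.infty else (f z : OnePoint ℂ)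

/-- A meromorphic function given by an honest representative: at each point of `D` it is
either continuous (analytic points) or blows up (a pole). -/
def MeromorphicNiceOn (f : ℂ → ℂ) (D : Set ℂ) : Prop :=
  MeromorphicOn f D ∧ ∀ z ∈ D, ContinuousAt f z ∨ Tendsto (fun w => ‖f w‖) (𝓝[≠] z) atTop

/-- The order (multiplicity) of a meromorphic function at a point: positive for a zero of that
multiplicity, negative of the multiplicity for a pole, `⊤` if the function vanishes identically
near the point, and junk value `0` when not defined. -/
def merOrder (f : ℂ → ℂ) (z : ℂ) : WithTop ℤ :=
  if ∀ᶠ w in 𝓝[≠] z, f w = 0 then ⊤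
  else if h : ∃ n : ℤ, ∃ g : ℂ → ℂ, AnalyticAt ℂ g z ∧ g z ≠ 0 ∧
      ∀ᶠ w in 𝓝[≠] z, f w = (w - z) ^ n * g w
    then (h.choose : WithTop ℤ) else 0

/-- `F j → g` spherically uniformly on compact subsets of `D`. -/
def ConvSphLocUnif (F : ℕ → ℂ → ℂ) (g : ℂ → ℂ) (D : Set ℂ) : Prop :=
  ∀ K ⊆ D, IsCompact K → ∀ ε > 0, ∀ᶠ j in atTop, ∀ z ∈ K,
    sphDist (toSphere (F j) z) (toSphere g z) < ε

/-- `F j → ∞` spherically uniformly on compact subsets of `D`. -/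
def ConvInftyLocUnif (F : ℕ → ℂ → ℂ) (D : Set ℂ) : Prop :=
  ∀ K ⊆ D, IsCompact K → ∀ ε > 0, ∀ᶠ j in atTop, ∀ z ∈ K,
    sphDist (toSphere (F j) z) OnePoint.infty < ε

/-- A family of meromorphic functions is normal in `D` if every sequence from the family has a
subsequence converging spherically uniformly on compact subsets of `D` to a meromorphic
function or to `∞`. -/
def NormalFamilyOn (𝓕 : Set (ℂ → ℂ)) (D : Set ℂ) : Prop :=
  ∀ f : ℕ → ℂ → ℂ, (∀ j, f j ∈ 𝓕) → ∃ φ : ℕ → ℕ, StrictMono φ ∧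
    ((∃ g : ℂ → ℂ, MeromorphicNiceOn g D ∧ ConvSphLocUnif (fun j => f (φ j)) g D) ∨
      ConvInftyLocUnif (fun j => f (φ j)) D)

/-- A sequence of meromorphic functions is normal in `D` if every subsequence has a further
subsequence converging spherically uniformly on compact subsets of `D` to a meromorphic
function or to `∞`. -/
def NormalSeqOn (f : ℕ → ℂ → ℂ) (D : Set ℂ) : Prop :=
  ∀ φ : ℕ → ℕ, StrictMono φ → ∃ σ : ℕ → ℕ, StrictMono σ ∧
    ((∃ g : ℂ → ℂ, MeromorphicNiceOn g D ∧ ConvSphLocUnif (fun j => f (φ (σ j))) g D) ∨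
      ConvInftyLocUnif (fun j => f (φ (σ j))) D)

open InnerProductSpace in
/-- An analytic function whose norm is constant on a ball has vanishing derivative there. -/
lemma deriv_eq_zero_of_norm_eq_one {f : ℂ → ℂ} {r : ℝ} (hf : AnalyticOnNhd ℂ f (Metric.ball 0 r))
    (h1 : ∀ z ∈ Metric.ball (0 : ℂ) r, ‖f z‖ = 1) {w : ℂ} (hw : w ∈ Metric.ball (0 : ℂ) r) :
    deriv f w = 0 := by
  have hmax : IsMaxOn (norm ∘ f) (Metric.ball 0 r) w := by
    intro z hz
    simp [h1 z hz, h1 w hw]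
  have := Complex.eqOn_of_isPreconnected_of_isMaxOn_norm (convex_ball (0:ℂ) r).isPreconnected
    Metric.isOpen_ball (fun z hz => (hf z hz).differentiableWithinAt) hw hmax
  have h2 : f =ᶠ[𝓝 w] fun _ => f w := by
    filter_upwards [Metric.isOpen_ball.mem_nhds hw] with z hz using this hz
  rw [h2.deriv_eq]; simp

open InnerProductSpace in
lemma logDeriv_eq_circleAverage {g : ℂ → ℂ} {ρ : ℝ}
    (hg : AnalyticOnNhd ℂ g (Metric.closedBall 0 ρ))
    (hg0 : ∀ z ∈ Metric.closedBall (0 : ℂ) ρ, g z ≠ 0)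
    {w : ℂ} (hw : w ∈ Metric.ball (0 : ℂ) ρ) :
    deriv g w / g w = Real.circleAverage
      (fun ζ ↦ (2 * ζ / (ζ - w) ^ 2) • ((Real.log ‖g ζ‖ : ℝ) : ℂ)) 0 ρ := by
  have hρ : 0 < ρ := Metric.pos_of_mem_ball hw
  have hci : CircleIntegrable (fun ζ => Real.log ‖g ζ‖) 0 ρ := by
    apply ContinuousOn.circleIntegrable hρ.le
    apply ContinuousOn.log
    · exact (hg.continuousOn.mono Metric.sphere_subset_closedBall).norm
    · intro z hz
      exact norm_ne_zero_iff.2 (hg0 z (Metric.sphere_subset_closedBall hz))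
  have hci' : CircleIntegrable (fun ζ => ((Real.log ‖g ζ‖ : ℝ) : ℂ)) 0 ρ := by
    simp only [CircleIntegrable, intervalIntegrable_iff] at hci ⊢
    exact Complex.ofRealCLM.integrable_comp hci
  have hharm : HarmonicOnNhd (fun ζ => Real.log ‖g ζ‖) (Metric.closedBall 0 ρ) := by
    intro z hz
    exact (hg z hz).harmonicAt_log_norm (hg0 z hz)
  set H : ℂ → ℂ := fun w ↦ Real.circleAverage
    (fun ζ ↦ herglotzRieszKernel 0 w ζ • ((Real.log ‖g ζ‖ : ℝ) : ℂ)) 0 ρ with hH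
  have hHd : ∀ w ∈ Metric.ball (0:ℂ) ρ, HasDerivAt H (Real.circleAverage
      (fun ζ ↦ (2 * ζ / (ζ - w) ^ 2) • ((Real.log ‖g ζ‖ : ℝ) : ℂ)) 0 ρ) w := fun w hw =>
    hasDerivAt_circleAverage_herglotzRieszKernel_smul hci' hw
  have hHre : ∀ w ∈ Metric.ball (0:ℂ) ρ, (H w).re = Real.log ‖g w‖ := by
    intro w hw
    rw [hH]
    simp only
    rw [re_circleAverage_herglotzRieszKernel_smul hci hw]
    exact hharm.circleAverage_re_herglotzRieszKernel_smul hw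
  have hHan : AnalyticOnNhd ℂ H (Metric.ball 0 ρ) := by
    apply DifferentiableOn.analyticOnNhd _ Metric.isOpen_ball
    intro w hw
    exact (hHd w hw).differentiableAt.differentiableWithinAt
  have hq : AnalyticOnNhd ℂ (fun z => Complex.exp (H z) / g z) (Metric.ball 0 ρ) := by
    intro z hz
    exact (hHan z hz).cexp.div (hg z (Metric.ball_subset_closedBall hz))
      (hg0 z (Metric.ball_subset_closedBall hz))
  have hd := deriv_eq_zero_of_norm_eq_one hq (by
    intro z hz
    have h0 := hg0 z (Metric.ball_subset_closedBall hz)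
    rw [norm_div, Complex.norm_exp, hHre z hz, Real.exp_log (norm_pos_iff.2 h0), div_self]
    exact norm_ne_zero_iff.2 h0) hw
  have hgw := hg0 w (Metric.ball_subset_closedBall hw)
  have hgd := (hg w (Metric.ball_subset_closedBall hw)).differentiableAt.hasDerivAt
  have := ((hHd w hw).cexp.fun_div hgd hgw).deriv
  rw [this] at hd
  rw [div_eq_zero_iff] at hd
  rcases hd with hd | hd
  · have he := Complex.exp_ne_zero (H w)
    rw [div_eq_iff hgw]
    apply mul_left_cancel₀ he
    linear_combination -hd
  · exact absurd hd (pow_ne_zero _ hgw)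

lemma norm_logDeriv_le_circleAverage {g : ℂ → ℂ} {ρ : ℝ}
    (hg : AnalyticOnNhd ℂ g (Metric.closedBall 0 ρ))
    (hg0 : ∀ z ∈ Metric.closedBall (0 : ℂ) ρ, g z ≠ 0)
    {w : ℂ} (hw : w ∈ Metric.ball (0 : ℂ) ρ) :
    ‖deriv g w / g w‖ ≤ 2 * ρ / (ρ - ‖w‖) ^ 2 *
      Real.circleAverage (fun ζ ↦ |Real.log ‖g ζ‖|) 0 ρ := by
  have hρ : 0 < ρ := Metric.pos_of_mem_ball hw
  have hw' : ‖w‖ < ρ := by simpa using hw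
  rw [logDeriv_eq_circleAverage hg hg0 hw]
  have hci : ContinuousOn (fun ζ => |Real.log ‖g ζ‖|) (Metric.sphere 0 ρ) := by
    apply ContinuousOn.abs
    apply ContinuousOn.log
    · exact (hg.continuousOn.mono Metric.sphere_subset_closedBall).norm
    · intro z hz
      exact norm_ne_zero_iff.2 (hg0 z (Metric.sphere_subset_closedBall hz))
  have hI : CircleIntegrable (fun ζ => |Real.log ‖g ζ‖|) 0 ρ := hci.circleIntegrable hρ.le
  have key : 2 * ρ / (ρ - ‖w‖) ^ 2 * Real.circleAverage (fun ζ ↦ |Real.log ‖g ζ‖|) 0 ρ =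
      Real.circleAverage (fun ζ ↦ 2 * ρ / (ρ - ‖w‖) ^ 2 * |Real.log ‖g ζ‖|) 0 ρ := by
    rw [← smul_eq_mul, ← Real.circleAverage_fun_smul]
    rfl
  rw [key]
  unfold Real.circleAverage
  rw [norm_smul, smul_eq_mul, Real.norm_of_nonneg (by positivity)]
  apply mul_le_mul_of_nonneg_left _ (by positivity)
  apply intervalIntegral.norm_integral_le_of_norm_le (by positivity)
  · filter_upwards with θ _
    have hn : ‖circleMap 0 ρ θ‖ = ρ := by simp [abs_of_pos hρ]
    rw [norm_smul, norm_div, norm_mul, norm_pow, Complex.norm_real, Complex.norm_ofNat, hn,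
      Real.norm_eq_abs]
    apply mul_le_mul_of_nonneg_right _ (abs_nonneg _)
    apply div_le_div_of_nonneg_left (by positivity) (by have := sub_pos.2 hw'; positivity)
    apply pow_le_pow_left₀ (sub_pos.2 hw').le
    calc ρ - ‖w‖ = ‖circleMap 0 ρ θ‖ - ‖w‖ := by rw [hn]
      _ ≤ _ := norm_sub_norm_le _ _
  · have := hI.const_smul (a := 2 * ρ / (ρ - ‖w‖) ^ 2)
    exact this

lemma norm_logDeriv_le_circleAverage_sub {g : ℂ → ℂ} {ρ : ℝ}
    (hg : AnalyticOnNhd ℂ g (Metric.closedBall 0 ρ))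
    (hg0 : ∀ z ∈ Metric.closedBall (0 : ℂ) ρ, g z ≠ 0)
    {w : ℂ} (hw : w ∈ Metric.ball (0 : ℂ) ρ) (c : ℝ) :
    ‖deriv g w / g w‖ ≤ 2 * ρ / (ρ - ‖w‖) ^ 2 *
      Real.circleAverage (fun ζ ↦ |Real.log ‖g ζ‖ + c|) 0 ρ := by
  have hρ : 0 < ρ := Metric.pos_of_mem_ball hw
  have h := norm_logDeriv_le_circleAverage (g := fun z => Complex.exp c * g z)
    (fun z hz => analyticAt_const.mul (hg z hz))
    (fun z hz => mul_ne_zero (Complex.exp_ne_zero _) (hg0 z hz)) hw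
  have hd : deriv (fun z => Complex.exp c * g z) w = Complex.exp c * deriv g w :=
    deriv_const_mul _ (hg w (Metric.ball_subset_closedBall hw)).differentiableAt
  rw [hd, mul_div_mul_left _ _ (Complex.exp_ne_zero _)] at h
  refine h.trans_eq ?_
  congr 1
  apply Real.circleAverage_congr_sphere
  intro z hz
  rw [abs_of_pos hρ] at hz
  have h0 := hg0 z (Metric.sphere_subset_closedBall hz)
  simp only [norm_mul, Complex.norm_exp, Complex.ofReal_re]
  rw [Real.log_mul (Real.exp_ne_zero _) (norm_ne_zero_iff.2 h0), Real.log_exp, add_comm]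

lemma mul_abs_div_pi_le_norm {r s t : ℝ} (hr : 0 ≤ r) (hs : 0 ≤ s) (ht : |t| ≤ Real.pi) :
    r * (|t| / Real.pi) ≤ ‖(r : ℂ) * Complex.exp (t * I) - s‖ := by
  have hpi := Real.pi_pos
  apply le_of_sq_le_sq _ (norm_nonneg _)
  have h1 : ‖(r : ℂ) * Complex.exp (t * I) - s‖ ^ 2 = r ^ 2 + s ^ 2 - 2 * r * s * Real.cos t := by
    rw [← Complex.normSq_eq_norm_sq, Complex.normSq_apply, Complex.exp_mul_I, ← Complex.ofReal_cos,
      ← Complex.ofReal_sin]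
    simp only [sub_re, mul_re, ofReal_re, add_re, I_re, I_im, ofReal_im, sub_im, mul_im, add_im]
    have := Real.sin_sq_add_cos_sq t
    linear_combination r ^ 2 * this
  have h2 := Real.cos_le_one_sub_mul_cos_sq ht
  set δ := t ^ 2 / Real.pi ^ 2 with hδ
  have hδ0 : 0 ≤ δ := by positivity
  have hδ1 : δ ≤ 1 := by
    rw [hδ, div_le_one (by positivity), ← sq_abs]
    exact pow_le_pow_left₀ (abs_nonneg _) ht 2
  have h3 : (r * (|t| / Real.pi)) ^ 2 = r ^ 2 * δ := by
    rw [mul_pow, div_pow, sq_abs]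
  have h4 : Real.cos t ≤ 1 - 2 * δ := by
    convert h2 using 2
    rw [hδ]; ring
  rw [h1, h3]
  have h5 : 2 * r * s * Real.cos t ≤ 2 * r * s * (1 - 2 * δ) :=
    mul_le_mul_of_nonneg_left h4 (by positivity)
  have hrs : 0 ≤ r * s := by positivity
  nlinarith [sq_nonneg (r - s), sq_nonneg (r * (1 - 2 * δ) - s), mul_nonneg (sq_nonneg r) hδ0,
    mul_nonneg hrs hδ0, mul_nonneg (sq_nonneg s) hδ0, mul_nonneg (sq_nonneg r) (sub_nonneg.2 hδ1)]

lemma exists_circleAverage_inv_sqrt_le : ∃ K : ℝ, 0 ≤ K ∧ ∀ (r : ℝ) (u : ℂ), 0 < r →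
    CircleIntegrable (fun z => (Real.sqrt ‖z - u‖)⁻¹) 0 r ∧
    Real.circleAverage (fun z => (Real.sqrt ‖z - u‖)⁻¹) 0 r ≤ K / Real.sqrt r := by
  set b : ℝ → ℝ := fun t => Real.sqrt Real.pi
      * (t ^ (-(1/2) : ℝ) + (2 * Real.pi - t) ^ (-(1/2) : ℝ))
    with hb
  have hpi := Real.pi_pos
  have hbi : IntervalIntegrable b volume 0 (2 * Real.pi) := by
    apply IntervalIntegrable.const_mul
    apply IntervalIntegrable.add
    · exact intervalIntegral.intervalIntegrable_rpow' (by norm_num)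
    · have := (intervalIntegral.intervalIntegrable_rpow' (a := 0) (b := 2 * Real.pi)
        (r := -(1/2)) (by norm_num)).comp_sub_left (2 * Real.pi)
      simpa using this.symm
  have hb0 : ∀ t ∈ Icc 0 (2 * Real.pi), 0 ≤ b t := by
    intro t ht
    have := Real.rpow_nonneg ht.1 (-(1/2) : ℝ)
    have := Real.rpow_nonneg (sub_nonneg.2 ht.2) (-(1/2) : ℝ)
    rw [hb]; positivity
  refine ⟨(2 * Real.pi)⁻¹ * ∫ t in 0..2 * Real.pi, b t, ?_, ?_⟩
  · apply mul_nonneg (by positivity)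
    apply intervalIntegral.integral_nonneg (by positivity)
    exact hb0
  intro r u hr
  set f : ℂ → ℝ := fun z => (Real.sqrt ‖z - u‖)⁻¹ with hf
  have hmeas : Measurable f := by
    rw [hf]; fun_prop
  have hmeas' : Measurable fun θ => f (circleMap 0 r (θ + u.arg)) := by
    apply hmeas.comp; unfold circleMap; fun_prop
  have hle1 : ∀ x : ℝ, 0 < x → x ≤ Real.pi → ∀ y : ℝ, r * (x / Real.pi) ≤ y →
      (Real.sqrt y)⁻¹ ≤ (Real.sqrt r)⁻¹ * (Real.sqrt Real.pi * x ^ (-(1/2) : ℝ)) := by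
    intro x hx hx' y hy
    have : (Real.sqrt r)⁻¹ * (Real.sqrt Real.pi * x ^ (-(1/2) : ℝ)) =
        (Real.sqrt (r * (x / Real.pi)))⁻¹ := by
      rw [Real.rpow_neg hx.le, ← Real.sqrt_eq_rpow, Real.sqrt_mul hr.le, Real.sqrt_div hx.le]
      have := Real.sqrt_pos.2 hr
      have := Real.sqrt_pos.2 hx
      have := Real.sqrt_pos.2 hpi
      field_simp
    rw [this]
    apply inv_anti₀ (Real.sqrt_pos.2 (by positivity))
    exact Real.sqrt_le_sqrt hy
  have hbound : ∀ θ ∈ Ioo 0 (2 * Real.pi), f (circleMap 0 r (θ + u.arg)) ≤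
      (Real.sqrt r)⁻¹ * b θ := by
    intro θ hθ
    have hnorm : ∀ t : ℝ, Complex.exp (t * I) = Complex.exp (θ * I) →
        ‖circleMap 0 r (θ + u.arg) - u‖ = ‖(r : ℂ) * Complex.exp (t * I) - ‖u‖‖ := by
      intro t ht
      have hu := Complex.norm_mul_exp_arg_mul_I u
      have h1 : circleMap 0 r (θ + u.arg) - u =
          Complex.exp (u.arg * I) * ((r : ℂ) * Complex.exp (t * I) - ‖u‖) := by
        rw [ht]
        simp only [circleMap, zero_add]
        push_cast
        rw [add_mul, Complex.exp_add]
        linear_combination hu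
      rw [h1, norm_mul, Complex.norm_exp_ofReal_mul_I, one_mul]
    have h1 := Real.rpow_nonneg hθ.1.le (-(1/2) : ℝ)
    have h2 := Real.rpow_nonneg (sub_nonneg.2 hθ.2.le) (-(1/2) : ℝ)
    have h3 := Real.sqrt_nonneg Real.pi
    have h4 : 0 ≤ (Real.sqrt r)⁻¹ := inv_nonneg.2 (Real.sqrt_nonneg r)
    rcases le_total θ Real.pi with h | h
    · have hk := mul_abs_div_pi_le_norm hr.le (norm_nonneg u) (t := θ) (by rwa [abs_of_pos hθ.1])
      rw [abs_of_pos hθ.1] at hk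
      rw [hf]; simp only
      rw [hnorm θ rfl]
      refine (hle1 θ hθ.1 h _ hk).trans ?_
      apply mul_le_mul_of_nonneg_left _ h4
      exact mul_le_mul_of_nonneg_left (by linarith) h3
    · have habs : |θ - 2 * Real.pi| = 2 * Real.pi - θ := by
        rw [abs_sub_comm, abs_of_pos (by linarith [hθ.2])]
      have hk := mul_abs_div_pi_le_norm hr.le (norm_nonneg u) (t := θ - 2 * Real.pi)
        (by rw [habs]; linarith)
      rw [habs] at hk
      rw [hf]; simp only
      rw [hnorm (θ - 2 * Real.pi) (by
        push_cast; rw [sub_mul, Complex.exp_sub, Complex.exp_two_pi_mul_I, div_one])]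
      refine (hle1 _ (by linarith [hθ.2]) (by linarith) _ hk).trans ?_
      apply mul_le_mul_of_nonneg_left _ h4
      exact mul_le_mul_of_nonneg_left (by linarith) h3
  have hf0 : ∀ z, 0 ≤ f z := fun z => inv_nonneg.2 (Real.sqrt_nonneg _)
  have hae : ∀ᵐ θ ∂volume, θ ∈ Ioc 0 (2 * Real.pi) →
      f (circleMap 0 r (θ + u.arg)) ≤ (Real.sqrt r)⁻¹ * b θ := by
    have : ∀ᵐ θ : ℝ ∂volume, θ ≠ 2 * Real.pi := by simp [ae_iff, measure_singleton]
    filter_upwards [this] with θ hne hθ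
    exact hbound θ ⟨hθ.1, lt_of_le_of_ne hθ.2 hne⟩
  have hshift : IntervalIntegrable (fun θ => f (circleMap 0 r (θ + u.arg))) volume 0
      (2 * Real.pi) := by
    apply (hbi.const_mul (Real.sqrt r)⁻¹).mono_fun hmeas'.aestronglyMeasurable
    rw [uIoc_of_le (by positivity)]
    refine (ae_restrict_iff' measurableSet_Ioc).2 ?_
    filter_upwards [hae] with θ h hθ
    rw [Real.norm_of_nonneg (hf0 _)]
    exact (h hθ).trans (le_abs_self _)
  refine ⟨?_, ?_⟩
  · have hper : Function.Periodic (fun θ => f (circleMap 0 r θ)) (2 * Real.pi) :=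
      fun x => by simp [periodic_circleMap 0 r x]
    have h2 := hshift.comp_sub_right u.arg
    simp only [sub_add_cancel, zero_add] at h2
    rw [add_comm] at h2
    exact hper.intervalIntegrable (by positivity) h2 _ _
  · rw [Real.circleAverage_eq_integral_add u.arg, smul_eq_mul, mul_div_assoc]
    apply mul_le_mul_of_nonneg_left _ (by positivity)
    rw [div_eq_inv_mul, ← intervalIntegral.integral_const_mul]
    apply intervalIntegral.integral_mono_ae_restrict (by positivity) hshift
      (hbi.const_mul _)
    rw [← restrict_Ioc_eq_restrict_Icc]
    exact (ae_restrict_iff' measurableSet_Ioc).2 hae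

open Function.locallyFinsuppWithin in
lemma sum_le_logCounting {E : Function.locallyFinsupp ℂ ℤ} (hE : 0 ≤ E) {ρ R : ℝ} (hρ : 1 ≤ ρ)
    (hR : ρ < R) (S : Finset ℂ) (hS : ∀ u ∈ S, ‖u‖ ≤ ρ) :
    ∑ u ∈ S, (E u : ℝ) ≤ R / (R - ρ) * logCounting E R := by
  have hE0 : ∀ u, 0 ≤ E u := fun u => hE u
  have hle : ∑ u ∈ S, single u (E u) ≤ E := by
    intro z
    have : (∑ u ∈ S, single u (E u) : Function.locallyFinsupp ℂ ℤ) z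
        = ∑ u ∈ S, (single u (E u) : Function.locallyFinsupp ℂ ℤ) z := by
      rw [coe_sum]; simp
    rw [this]
    simp only [single_apply]
    rw [Finset.sum_ite_eq]
    split_ifs with h
    · exact le_rfl
    · exact hE0 z
  have h1 := logCounting_le hle (hρ.trans hR.le)
  rw [map_sum, Finset.sum_apply] at h1
  have hRpos : 0 < R := by linarith
  have hd : 0 < R - ρ := sub_pos.2 hR
  have h2 : ∑ u ∈ S, ((R - ρ) / R) * (E u : ℝ) ≤ ∑ u ∈ S, logCounting (single u (E u)) R := by
    apply Finset.sum_le_sum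
    intro u hu
    rw [logCounting_single_eq_log_sub_const ((hS u hu).trans hR.le), mul_comm]
    apply mul_le_mul_of_nonneg_left _ (by exact_mod_cast hE0 u)
    have h3 : Real.log ‖u‖ ≤ Real.log ρ := by
      rcases eq_or_ne u 0 with rfl | h0
      · simpa using Real.log_nonneg hρ
      · exact Real.log_le_log (norm_pos_iff.2 h0) (hS u hu)
    have h4 : Real.log (ρ / R) ≤ ρ / R - 1 := Real.log_le_sub_one_of_pos (by positivity)
    rw [Real.log_div (by positivity) (by positivity)] at h4
    have : (R - ρ) / R = 1 - ρ / R := by field_simp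
    linarith
  rw [← Finset.mul_sum] at h2
  have h3 := h2.trans h1
  calc ∑ u ∈ S, (E u : ℝ) = R / (R - ρ) * ((R - ρ) / R * ∑ u ∈ S, (E u : ℝ)) := by field_simp
    _ ≤ _ := mul_le_mul_of_nonneg_left h3 (by positivity)

open Real in
lemma abs_log_eq_posLog_add (x : ℝ) : |Real.log x| = log⁺ x + log⁺ x⁻¹ := by
  rw [posLog, posLog, Real.log_inv]
  rcases le_total 0 (Real.log x) with h | h
  · rw [abs_of_nonneg h, max_eq_right h, max_eq_left (by linarith), add_zero]
  · rw [abs_of_nonpos h, max_eq_left h, max_eq_right (by linarith), zero_add]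

lemma circleAverage_abs_log_norm_sub_le {ρ : ℝ} (hρ1 : 1 ≤ ρ) {u : ℂ} (hu : ‖u‖ ≤ ρ) :
    CircleIntegrable (fun z => |Real.log ‖z - u‖ - Real.log ρ|) 0 ρ ∧
    Real.circleAverage (fun z => |Real.log ‖z - u‖ - Real.log ρ|) 0 ρ ≤ 2 * Real.log 2 := by
  have hρ : 0 < ρ := by linarith
  have hi : CircleIntegrable (fun z => Real.log ‖z - u‖) 0 ρ := circleIntegrable_log_norm_sub_const
      ρ
  have hi2 : CircleIntegrable (fun z => Real.log ‖z - u‖ - Real.log ρ) 0 ρ :=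
    hi.sub (circleIntegrable_const _ _ _)
  have hi3 : CircleIntegrable (fun z => |Real.log ‖z - u‖ - Real.log ρ|) 0 ρ := hi2.abs
  refine ⟨hi3, ?_⟩
  have hi4 : CircleIntegrable (fun z => 2 * Real.log 2 - (Real.log ‖z - u‖ - Real.log ρ)) 0 ρ :=
    (circleIntegrable_const _ _ _).sub hi2
  have hav : Real.circleAverage (fun z => 2 * Real.log 2 - (Real.log ‖z - u‖ - Real.log ρ)) 0 ρ
      = 2 * Real.log 2 := by
    rw [Real.circleAverage_fun_sub (circleIntegrable_const _ _ _) hi2,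
      Real.circleAverage_fun_sub hi (circleIntegrable_const _ _ _), Real.circleAverage_const,
      Real.circleAverage_const, circleAverage_log_norm_sub_const_of_mem_closedBall]
    · ring
    · simpa [abs_of_pos hρ] using hu
  rw [← hav]
  apply Real.circleAverage_mono hi3 hi4
  intro z hz
  have hz' : ‖z‖ = ρ := by simpa [abs_of_pos hρ] using hz
  have h2 := Real.log_nonneg (one_le_two (α := ℝ))
  rcases eq_or_ne (z - u) 0 with h0 | h0
  · have h1ρ := Real.log_nonneg hρ1
    rw [h0, norm_zero, Real.log_zero]
    rcases le_total 0 (0 - Real.log ρ) with h | h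
    · rw [abs_of_nonneg h]; linarith
    · rw [abs_of_nonpos h]; linarith
  · have h3 : Real.log ‖z - u‖ ≤ Real.log (2 * ρ) := by
      apply Real.log_le_log (norm_pos_iff.2 h0)
      calc ‖z - u‖ ≤ ‖z‖ + ‖u‖ := norm_sub_le _ _
        _ ≤ 2 * ρ := by linarith
    rw [Real.log_mul two_ne_zero hρ.ne'] at h3
    rcases le_total 0 (Real.log ‖z - u‖ - Real.log ρ) with h | h
    · rw [abs_of_nonneg h]; linarith
    · rw [abs_of_nonpos h]; linarith

section
open ValueDistribution MeromorphicOn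

lemma circleAverage_abs_log_norm_eq {F : ℂ → ℂ} (hF : Meromorphic F) (ρ : ℝ) :
    CircleIntegrable (fun z => |Real.log ‖F z‖|) 0 ρ ∧
    Real.circleAverage (fun z => |Real.log ‖F z‖|) 0 ρ = proximity F ⊤ ρ + proximity F⁻¹ ⊤ ρ := by
  have h1 : CircleIntegrable (fun z => Real.posLog ‖F z‖) 0 ρ :=
    MeromorphicOn.circleIntegrable_posLog_norm (fun z _ => hF z)
  have h2 : CircleIntegrable (fun z => Real.posLog ‖F z‖⁻¹) 0 ρ := by
    have := MeromorphicOn.circleIntegrable_posLog_norm (c := 0) (R := ρ) (f := F⁻¹)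
        (fun z _ => (hF z).inv)
    simpa using this
  have : (fun z => |Real.log ‖F z‖|) = fun z => Real.posLog ‖F z‖ + Real.posLog ‖F z‖⁻¹ := by
    ext z; exact abs_log_eq_posLog_add _
  rw [this]
  refine ⟨h1.add h2, ?_⟩
  rw [Real.circleAverage_fun_add h1 h2, proximity_top, proximity_top]
  simp

/-- Constant in the first main theorem for the inverse. -/
lemma characteristic_inv_le {F : ℂ → ℂ} (hF : Meromorphic F) {R : ℝ} (hR : R ≠ 0) :
    characteristic F⁻¹ ⊤ R ≤
        characteristic F ⊤ R + |Real.log ‖meromorphicTrailingCoeffAt F 0‖| := by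
  have h := characteristic_sub_characteristic_inv_of_ne_zero hF hR
  have := neg_abs_le (Real.log ‖meromorphicTrailingCoeffAt F 0‖)
  linarith

/-- Bounds, in terms of the characteristic, on the number of zeros and poles and on the mean of
`|log |F||`. -/
lemma meromorphic_counts_le {F : ℂ → ℂ} (hF : Meromorphic F) {ρ R : ℝ} (hρ : 1 ≤ ρ) (hR : ρ < R)
    (S : Finset ℂ) (hS : ∀ u ∈ S, ‖u‖ ≤ ρ) :
    Real.circleAverage (fun z => |Real.log ‖F z‖|) 0 ρ ≤
      2 * characteristic F ⊤ R + |Real.log ‖meromorphicTrailingCoeffAt F 0‖| ∧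
    ∑ u ∈ S, |(divisor F univ u : ℝ)| ≤ R / (R - ρ) *
      (2 * characteristic F ⊤ R + |Real.log ‖meromorphicTrailingCoeffAt F 0‖|) := by
  have hρ0 : ρ ≠ 0 := by linarith
  have hR1 : 1 ≤ R := by linarith
  have hmono : characteristic F ⊤ ρ ≤ characteristic F ⊤ R :=
    characteristic_monotoneOn hF (show (0:ℝ) < ρ by linarith) (show (0:ℝ) < R by linarith) hR.le
  constructor
  · rw [(circleAverage_abs_log_norm_eq hF ρ).2]
    have h1 : proximity F ⊤ ρ ≤ characteristic F ⊤ ρ := by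
      have : 0 ≤ logCounting F ⊤ ρ := logCounting_nonneg hρ
      simp only [characteristic, Pi.add_apply]; linarith
    have h2 : proximity F⁻¹ ⊤ ρ ≤ characteristic F⁻¹ ⊤ ρ := by
      have : 0 ≤ logCounting F⁻¹ ⊤ ρ := logCounting_nonneg hρ
      simp only [characteristic, Pi.add_apply]; linarith
    have h3 := characteristic_inv_le hF hρ0
    linarith
  · have h1 : logCounting F ⊤ R ≤ characteristic F ⊤ R := by
      have : 0 ≤ proximity F ⊤ R := proximity_nonneg R
      simp only [characteristic, Pi.add_apply]; linarith
    have h2 : logCounting F 0 R ≤ characteristic F⁻¹ ⊤ R := by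
      have : 0 ≤ proximity F⁻¹ ⊤ R := proximity_nonneg R
      have h3 : logCounting F⁻¹ ⊤ = logCounting F 0 := logCounting_inv
      simp only [characteristic, Pi.add_apply, h3]; linarith
    have h3 := characteristic_inv_le hF (show R ≠ 0 by linarith)
    have h4 : ∑ u ∈ S, |(divisor F univ u : ℝ)| ≤ R / (R - ρ) *
        Function.locallyFinsuppWithin.logCounting ((divisor F univ)⁺ + (divisor F univ)⁻) R := by
      refine le_trans (Finset.sum_le_sum ?_)
          (sum_le_logCounting (E := (divisor F univ)⁺ + (divisor F univ)⁻) (by positivity)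
            hρ hR S hS)
      intro u _
      apply le_of_eq
      rw [← Int.cast_abs, ← posPart_add_negPart]
      rfl
    refine h4.trans ?_
    apply mul_le_mul_of_nonneg_left _ (by have := sub_pos.2 hR; positivity)
    rw [map_add, ← logCounting_zero, ← logCounting_top, Pi.add_apply]
    linarith


lemma sqrt_add_le' {x y : ℝ} (hx : 0 ≤ x) (hy : 0 ≤ y) :
    Real.sqrt (x + y) ≤ Real.sqrt x + Real.sqrt y := by
  rw [Real.sqrt_le_iff]
  have h1 := Real.sqrt_nonneg x
  have h2 := Real.sqrt_nonneg y
  exact ⟨by positivity, by nlinarith [Real.sq_sqrt hx, Real.sq_sqrt hy]⟩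

lemma sum_sqrt_aux {ι : Type*} (S : Finset ι) (a : ι → ℂ) (b : ℂ) :
    Real.sqrt ‖∑ i ∈ S, a i + b‖ ≤ ∑ i ∈ S, Real.sqrt ‖a i‖ + Real.sqrt ‖b‖ := by
  have hadd : ∀ x y : ℂ, Real.sqrt ‖x + y‖ ≤ Real.sqrt ‖x‖ + Real.sqrt ‖y‖ := fun x y =>
    (Real.sqrt_le_sqrt (norm_add_le x y)).trans (sqrt_add_le' (norm_nonneg _) (norm_nonneg _))
  refine (hadd _ _).trans (add_le_add_left ?_ _)
  induction S using Finset.induction_on with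
  | empty => simp
  | insert i S hi ih =>
    rw [Finset.sum_insert hi, Finset.sum_insert hi]
    exact (hadd _ _).trans (add_le_add_right ih _)

lemma posLog_le_tangent {X M : ℝ} (hX : 0 ≤ X) (hM : 0 ≤ M) :
    Real.posLog X ≤ 2 * (Real.log (1 + M) + ((1 + Real.sqrt X) / (1 + M) - 1)) := by
  have hs := Real.sqrt_nonneg X
  have h1 : Real.posLog X ≤ 2 * Real.log (1 + Real.sqrt X) := by
    rw [Real.posLog]
    apply max_le
    · have := Real.log_nonneg (show (1:ℝ) ≤ 1 + Real.sqrt X by linarith)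
      linarith
    · rcases hX.eq_or_lt with rfl | h0
      · simp
      · rw [show (2:ℝ) * Real.log (1 + Real.sqrt X) = Real.log ((1 + Real.sqrt X) ^ 2) by
          rw [Real.log_pow]; norm_num]
        apply Real.log_le_log h0
        nlinarith [Real.sq_sqrt hX]
  have h2 : Real.log ((1 + Real.sqrt X) / (1 + M)) ≤ (1 + Real.sqrt X) / (1 + M) - 1 :=
    Real.log_le_sub_one_of_pos (by positivity)
  rw [Real.log_div (by positivity) (by positivity)] at h2
  linarith

/-- Local decomposition of a meromorphic function on a disc. -/
lemma exists_decomposition {F : ℂ → ℂ} (hF : Meromorphic F) (hord : ∀ z, meromorphicOrderAt F z ≠ ⊤)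
    (ρ : ℝ) : ∃ (S : Finset ℂ) (g : ℂ → ℂ), (∀ u ∈ S, ‖u‖ ≤ ρ) ∧
      AnalyticOnNhd ℂ g (Metric.closedBall 0 ρ) ∧ (∀ z ∈ Metric.closedBall (0:ℂ) ρ, g z ≠ 0) ∧
      ((fun z => Real.log ‖F z‖) =ᶠ[codiscreteWithin (Metric.closedBall 0 ρ)]
        fun z => ∑ u ∈ S, (divisor F univ u : ℝ) * Real.log ‖z - u‖ + Real.log ‖g z‖) ∧
      ((fun z => deriv F z / F z) =ᶠ[codiscreteWithin (Metric.closedBall 0 ρ)]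
        fun z => ∑ u ∈ S, (divisor F univ u : ℂ) / (z - u) + deriv g z / g z) := by
  set U := Metric.closedBall (0:ℂ) ρ with hU
  set D := divisor F U with hD
  have hFU : MeromorphicOn F U := fun z _ => hF z
  have hfin : D.support.Finite := D.finiteSupport (isCompact_closedBall 0 ρ)
  obtain ⟨g, hg, hg0, heq⟩ := hFU.extract_zeros_poles (fun u => hord u) hfin
  have hDF : ∀ u ∈ U, D u = divisor F univ u := by
    intro u hu
    rw [hD, divisor_apply hFU hu, divisor_apply (fun z _ => hF z) (mem_univ u)]
  have hsub : ∀ u ∈ hfin.toFinset, u ∈ U := fun u hu =>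
    D.supportWithinDomain (hfin.mem_toFinset.1 hu)
  refine ⟨hfin.toFinset, g, fun u hu => by simpa [hU] using hsub u hu, hg,
    fun z hz => hg0 ⟨z, hz⟩, ?_, ?_⟩
  · have h1 := extract_zeros_poles_log hg0 heq
    filter_upwards [h1] with z hz
    rw [hz]
    simp only [Pi.add_apply]
    congr 1
    rw [finsum_eq_sum_of_support_subset (s := hfin.toFinset)]
    · rw [Finset.sum_apply]
      apply Finset.sum_congr rfl
      intro u hu
      rw [← hDF u (hsub u hu)]
    · intro u hu
      simp only [Function.mem_support] at hu
      simp only [Finite.coe_toFinset, Function.mem_support]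
      intro h0
      apply hu
      rw [hD] at h0
      ext; simp [h0]
  · have hlin : ∀ u : ℂ, MeromorphicOn (fun z : ℂ => z - u) U := fun u z _ => by fun_prop
    have hlin' : ∀ u : ℂ, ∀ z ∈ U, meromorphicOrderAt (fun z : ℂ => z - u) z ≠ ⊤ := by
      intro u z _ htop
      rw [meromorphicOrderAt_eq_top_iff] at htop
      have h2 : ∀ᶠ w in 𝓝[≠] z, w ≠ u := by
        rcases eq_or_ne z u with rfl | hne
        · exact self_mem_nhdsWithin
        · exact (isOpen_ne.mem_nhds hne |> mem_nhdsWithin_of_mem_nhds)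
      obtain ⟨w, hw1, hw2⟩ := (htop.and h2).exists
      exact hw2 (sub_eq_zero.1 hw1)
    have h1 := MeromorphicOn.logDeriv_finprod_zpow_eventuallyEq (d := fun u => D u) hfin hlin hlin'
    have hPm : MeromorphicOn (∏ᶠ u, (fun z : ℂ => z - u) ^ D u) U :=
      (Function.FactorizedRational.meromorphicNFOn (fun u => D u) U).meromorphicOn
    have h2 := MeromorphicOn.logDeriv_mul_eventuallyEq hPm hg.meromorphicOn
      (fun x _ => Function.FactorizedRational.meromorphicOrderAt_ne_top (fun u => D u))
          (fun x hx => by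
        rw [(hg x hx).meromorphicNFAt.meromorphicOrderAt_eq_zero_iff.2 (hg0 ⟨x, hx⟩)]
        simp)
    have h3 := hFU.deriv_eventuallyEq_codiscreteWithin (hPm.smul hg.meromorphicOn) heq
    filter_upwards [h1, h2, h3, heq] with z h1z h2z h3z h4z
    rw [h3z, h4z]
    have h5 : deriv ((∏ᶠ u, (fun z : ℂ => z - u) ^ D u) • g) z
        / ((∏ᶠ u, (fun z : ℂ => z - u) ^ D u) • g) z
      = logDeriv ((∏ᶠ u, (fun z : ℂ => z - u) ^ D u) * g) z := by
      rw [logDeriv_apply, smul_eq_mul]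
    refine h5.trans ?_
    rw [h2z, Pi.add_apply, h1z, logDeriv_apply]
    congr 1
    rw [finsum_eq_sum_of_support_subset (s := hfin.toFinset)]
    · apply Finset.sum_congr rfl
      intro u hu
      rw [← hDF u (hsub u hu), logDeriv_apply]
      simp [div_eq_mul_inv]
    · intro u hu
      simp only [Function.mem_support] at hu
      simp only [Finite.coe_toFinset, Function.mem_support]
      intro h0
      apply hu
      simp [h0]


lemma circleAverage_posLog_le {E : ℂ → ℂ} {Y : ℂ → ℝ} {r M : ℝ} (hM : 0 ≤ M)
    (hE : CircleIntegrable (fun z => Real.posLog ‖E z‖) 0 r) (hY : CircleIntegrable Y 0 r)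
    (hYM : Real.circleAverage Y 0 r ≤ M)
    (hEY : ∀ z ∈ Metric.sphere (0:ℂ) |r|, Real.sqrt ‖E z‖ ≤ Y z) :
    Real.circleAverage (fun z => Real.posLog ‖E z‖) 0 r ≤ 2 * Real.log (1 + M) := by
  set a := 2 / (1 + M) with ha
  set b := 2 * (Real.log (1 + M) + 1 / (1 + M) - 1) with hb
  have ha0 : 0 ≤ a := by positivity
  have hi : CircleIntegrable (fun z => a * Y z) 0 r := by
    have := hY.const_smul (a := a)
    exact this
  have hi2 : CircleIntegrable (fun z => a * Y z + b) 0 r := hi.add (circleIntegrable_const _ _ _)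
  have h1 : Real.circleAverage (fun z => Real.posLog ‖E z‖) 0 r ≤
      Real.circleAverage (fun z => a * Y z + b) 0 r := by
    apply Real.circleAverage_mono hE hi2
    intro z hz
    refine (posLog_le_tangent (norm_nonneg _) hM).trans ?_
    have h2 : a * Real.sqrt ‖E z‖ ≤ a * Y z := mul_le_mul_of_nonneg_left (hEY z hz) ha0
    refine le_trans (le_of_eq ?_) (add_le_add_left h2 b)
    rw [ha, hb]; field_simp; ring
  refine h1.trans ?_
  have h3 : Real.circleAverage (fun z => a * Y z) 0 r = a * Real.circleAverage Y 0 r := by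
    rw [← smul_eq_mul, ← Real.circleAverage_fun_smul]; rfl
  rw [Real.circleAverage_fun_add hi (circleIntegrable_const _ _ _), Real.circleAverage_const, h3]
  have h4 := mul_le_mul_of_nonneg_left hYM ha0
  have h5 : a * M + b = 2 * Real.log (1 + M) := by
    rw [ha, hb]; field_simp; ring
  linarith

lemma circleIntegrable_finsetSum {ι : Type*} (S : Finset ι) (f : ι → ℂ → ℝ) (r : ℝ)
    (h : ∀ i ∈ S, CircleIntegrable (f i) 0 r) : CircleIntegrable (fun z => ∑ i ∈ S, f i z) 0 r := by
  have := CircleIntegrable.sum S h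
  convert this using 1
  ext z; simp

lemma circleAverage_const_mul (a : ℝ) (f : ℂ → ℝ) (r : ℝ) :
    Real.circleAverage (fun z => a * f z) 0 r = a * Real.circleAverage f 0 r := by
  rw [← smul_eq_mul, ← Real.circleAverage_fun_smul]; rfl

lemma circleIntegrable_const_mul' (a : ℝ) {f : ℂ → ℝ} {r : ℝ} (hf : CircleIntegrable f 0 r) :
    CircleIntegrable (fun z => a * f z) 0 r := by
  have := hf.const_smul (a := a)
  exact this

/-- Lemma on the logarithmic derivative. -/
theorem proximity_logDeriv_le {F : ℂ → ℂ} (hF : Meromorphic F)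
    (hord : ∀ z, meromorphicOrderAt F z ≠ ⊤) :
    ∃ K : ℝ, 0 ≤ K ∧ ∀ r R : ℝ, 1 ≤ r → r < R →
      proximity (fun z => deriv F z / F z) ⊤ r ≤
        2 * Real.log (1 + K * (characteristic F ⊤ R + 1) * (R / (R - r)) ^ 3 / Real.sqrt r) := by
  obtain ⟨K₀, hK₀, hK⟩ := exists_circleAverage_inv_sqrt_le
  set C₁ : ℝ := 2 + |Real.log ‖meromorphicTrailingCoeffAt F 0‖| with hC₁
  have hC₁0 : 2 ≤ C₁ :=
      by rw [hC₁]; linarith [abs_nonneg (Real.log ‖meromorphicTrailingCoeffAt F 0‖)]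
  refine ⟨2 * C₁ * K₀ + 1 + 40 * C₁, by positivity, ?_⟩
  intro r R hr hrR
  set T := characteristic F ⊤ R with hT
  have hT0 : 0 ≤ T := characteristic_nonneg (hr.trans hrR.le)
  set q := R / (R - r) with hq
  have hd : 0 < R - r := sub_pos.2 hrR
  have hR0 : 0 < R := by linarith
  have hq1 : 1 ≤ q := by rw [hq, one_le_div hd]; linarith
  set ρ := (r + R) / 2 with hρ
  have hrρ : r < ρ := by rw [hρ]; linarith
  have hρR : ρ < R := by rw [hρ]; linarith
  have hρ1 : 1 ≤ ρ := hr.trans hrρ.le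
  have hρ0 : 0 < ρ := by linarith
  obtain ⟨S, g, hS, hg, hg0, hlog, hder⟩ := exists_decomposition hF hord ρ
  obtain ⟨hm, hn⟩ := meromorphic_counts_le hF hρ1 hρR S hS
  set N := ∑ u ∈ S, |(divisor F univ u : ℝ)| with hN
  have hN0 : 0 ≤ N := Finset.sum_nonneg fun _ _ => abs_nonneg _
  have hTC : 2 * T + |Real.log ‖meromorphicTrailingCoeffAt F 0‖| ≤ C₁ * (T + 1) := by
    rw [hC₁]; nlinarith [abs_nonneg (Real.log ‖meromorphicTrailingCoeffAt F 0‖)]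
  have hRρ : R / (R - ρ) = 2 * q := by
    rw [hq, hρ]
    have : R - (r + R) / 2 = (R - r) / 2 := by ring
    rw [this]; field_simp
  have hm' := hm.trans hTC
  have hn' : N ≤ 2 * q * (C₁ * (T + 1)) := by
    rw [← hRρ]
    refine hn.trans (mul_le_mul_of_nonneg_left hTC ?_)
    rw [hRρ]; positivity
  set c := (∑ u ∈ S, (divisor F univ u : ℝ)) * Real.log ρ with hc
  -- bound for the mean of the logarithm of the zero free part
  have hA : Real.circleAverage (fun ζ ↦ |Real.log ‖g ζ‖ + c|) 0 ρ ≤ 5 * q * (C₁ * (T + 1)) := by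
    have hsph : Metric.sphere (0:ℂ) |ρ| ⊆ Metric.closedBall 0 ρ := by
      rw [abs_of_pos hρ0]; exact Metric.sphere_subset_closedBall
    have hlog' := hlog.filter_mono (codiscreteWithin_mono hsph)
    have he : (fun ζ ↦ |Real.log ‖g ζ‖ + c|) =ᶠ[codiscreteWithin (Metric.sphere (0:ℂ) |ρ|)]
        fun ζ => |Real.log ‖F ζ‖ - ∑ u ∈ S, (divisor F univ u : ℝ)
            * (Real.log ‖ζ - u‖ - Real.log ρ)| := by
      filter_upwards [hlog'] with z hz
      rw [hz, hc]
      congr 1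
      simp only [mul_sub, Finset.sum_sub_distrib, ← Finset.sum_mul]
      ring
    rw [Real.circleAverage_congr_codiscreteWithin he hρ0.ne']
    obtain ⟨hF1, hF2⟩ := circleAverage_abs_log_norm_eq hF ρ
    have hgi : CircleIntegrable (fun ζ ↦ |Real.log ‖g ζ‖ + c|) 0 ρ := by
      apply ContinuousOn.circleIntegrable hρ0.le
      apply ContinuousOn.abs
      apply ContinuousOn.add _ continuousOn_const
      apply ContinuousOn.log
      · exact (hg.continuousOn.mono Metric.sphere_subset_closedBall).norm
      · intro z hz
        exact norm_ne_zero_iff.2 (hg0 z (Metric.sphere_subset_closedBall hz))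
    have hti : ∀ u ∈ S, CircleIntegrable
        (fun ζ => |(divisor F univ u : ℝ)| * |Real.log ‖ζ - u‖ - Real.log ρ|) 0 ρ := fun u hu =>
      circleIntegrable_const_mul' _ (circleAverage_abs_log_norm_sub_le hρ1 (hS u hu)).1
    have hsi := circleIntegrable_finsetSum S _ ρ hti
    refine (Real.circleAverage_mono (hgi.congr_codiscreteWithin he) (hF1.add hsi) ?_).trans ?_
    · intro z _
      refine (abs_sub _ _).trans ?_
      refine add_le_add_right ?_ _
      refine (Finset.abs_sum_le_sum_abs _ _).trans (le_of_eq ?_)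
      simp_rw [abs_mul]
    · rw [Real.circleAverage_add hF1 hsi, Real.circleAverage_fun_sum hti]
      have : ∑ u ∈ S, Real.circleAverage
          (fun ζ => |(divisor F univ u : ℝ)| * |Real.log ‖ζ - u‖ - Real.log ρ|) 0 ρ ≤ N * 2 := by
        rw [hN, Finset.sum_mul]
        apply Finset.sum_le_sum
        intro u hu
        rw [circleAverage_const_mul]
        apply mul_le_mul_of_nonneg_left _ (abs_nonneg _)
        refine (circleAverage_abs_log_norm_sub_le hρ1 (hS u hu)).2.trans ?_
        have := Real.log_two_lt_d9
        linarith
      have h0 : 0 ≤ C₁ * (T + 1) := by positivity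
      nlinarith
  have hX0 : 0 ≤ C₁ * (T + 1) * q ^ 3 := by positivity
  have hB : ∀ w ∈ Metric.sphere (0:ℂ) |r|, ‖deriv g w / g w‖ ≤ 40 * (C₁ * (T + 1) * q ^ 3) / R := by
    intro w hw
    have hw' : ‖w‖ = r := by simpa [abs_of_pos (show 0 < r by linarith)] using hw
    have h := norm_logDeriv_le_circleAverage_sub hg hg0 (w := w) (by simpa [hw'] using hrρ) c
    refine h.trans ?_
    rw [hw']
    have h1 : 2 * ρ / (ρ - r) ^ 2 ≤ 8 * q ^ 2 / R := by
      have : ρ - r = (R - r) / 2 := by rw [hρ]; ring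
      rw [this, hq, div_pow, div_pow]
      have : 8 * (R ^ 2 / (R - r) ^ 2) / R = 2 * R / ((R - r) ^ 2 / 2 ^ 2) := by field_simp; ring
      rw [this]
      gcongr
    calc _ ≤ 8 * q ^ 2 / R * (5 * q * (C₁ * (T + 1))) :=
          mul_le_mul h1 hA (Real.circleAverage_nonneg_of_nonneg fun _ _ => abs_nonneg _)
              (by positivity)
      _ = _ := by ring
  set B := 40 * (C₁ * (T + 1) * q ^ 3) / R with hBdef
  have hsr : 0 < Real.sqrt r := Real.sqrt_pos.2 (by linarith)
  have hsB : Real.sqrt B ≤ (1 + 40 * C₁) * (T + 1) * q ^ 3 / Real.sqrt r := by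
    rw [hBdef, Real.sqrt_div' _ hR0.le]
    have hq3 : 1 ≤ q ^ 3 := one_le_pow₀ hq1
    apply div_le_div₀ (by positivity) _ hsr (Real.sqrt_le_sqrt hrR.le)
    rw [Real.sqrt_le_iff]
    refine ⟨by positivity, ?_⟩
    have h1 : 1 ≤ (T + 1) * q ^ 3 := by nlinarith
    set y := (T + 1) * q ^ 3 with hy
    have e1 : 40 * (C₁ * (T + 1) * q ^ 3) = 40 * C₁ * y := by rw [hy]; ring
    have e2 : ((1 + 40 * C₁) * (T + 1) * q ^ 3) = (1 + 40 * C₁) * y := by rw [hy]; ring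
    rw [e1, e2]
    have h2 : 0 ≤ 40 * C₁ * y := by positivity
    nlinarith
  set Y : ℂ → ℝ := fun z => ∑ u ∈ S, |(divisor F univ u : ℝ)| * (Real.sqrt ‖z - u‖)⁻¹ + Real.sqrt B
    with hY
  have hr0 : 0 < r := by linarith
  have hti : ∀ u ∈ S, CircleIntegrable
      (fun z => |(divisor F univ u : ℝ)| * (Real.sqrt ‖z - u‖)⁻¹) 0 r := fun u _ =>
    circleIntegrable_const_mul' _ (hK r u hr0).1
  have hsi := circleIntegrable_finsetSum S _ r hti
  have hsub : Metric.sphere (0:ℂ) |r| ⊆ Metric.closedBall 0 ρ := by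
    rw [abs_of_pos hr0]
    exact Metric.sphere_subset_closedBall.trans (Metric.closedBall_subset_closedBall hrρ.le)
  have hder' := hder.filter_mono (codiscreteWithin_mono hsub)
  have hder2 : (fun z => Real.posLog ‖deriv F z / F z‖)
      =ᶠ[codiscreteWithin (Metric.sphere (0:ℂ) |r|)]
      fun z => Real.posLog ‖∑ u ∈ S, (divisor F univ u : ℂ) / (z - u) + deriv g z / g z‖ := by
    filter_upwards [hder'] with z hz
    rw [hz]
  rw [proximity_top, Real.circleAverage_congr_codiscreteWithin hder2 hr0.ne']
  have hmer : MeromorphicOn (fun z => deriv F z / F z) (Metric.sphere 0 |r|) := fun z _ =>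
    (hF z).deriv.div (hF z)
  apply circleAverage_posLog_le (Y := Y)
  · have : 0 < R - r := hd
    positivity
  · exact (MeromorphicOn.circleIntegrable_posLog_norm hmer).congr_codiscreteWithin hder2
  · exact hsi.add (circleIntegrable_const _ _ _)
  · rw [hY, Real.circleAverage_fun_add hsi (circleIntegrable_const _ _ _), Real.circleAverage_const,
      Real.circleAverage_fun_sum hti]
    have h1 : ∑ u ∈ S, Real.circleAverage
        (fun z => |(divisor F univ u : ℝ)| * (Real.sqrt ‖z - u‖)⁻¹) 0 r ≤
            N * (K₀ / Real.sqrt r) := by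
      rw [hN, Finset.sum_mul]
      apply Finset.sum_le_sum
      intro u _
      rw [circleAverage_const_mul]
      exact mul_le_mul_of_nonneg_left (hK r u hr0).2 (abs_nonneg _)
    have h2 : N * (K₀ / Real.sqrt r) ≤ (2 * q ^ 3 * (C₁ * (T + 1))) * (K₀ / Real.sqrt r) := by
      apply mul_le_mul_of_nonneg_right _ (by positivity)
      refine hn'.trans ?_
      apply mul_le_mul_of_nonneg_right _ (by positivity)
      have : q ≤ q ^ 3 := le_self_pow₀ hq1 (by norm_num)
      linarith
    refine (add_le_add (h1.trans h2) hsB).trans (le_of_eq ?_)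
    ring
  · intro z hz
    refine (sum_sqrt_aux _ _ _).trans ?_
    rw [hY]
    apply add_le_add _ (Real.sqrt_le_sqrt (hB z hz))
    apply Finset.sum_le_sum
    intro u _
    rw [norm_div, Real.sqrt_div (norm_nonneg _), div_eq_mul_inv]
    apply mul_le_mul_of_nonneg_right _ (inv_nonneg.2 (Real.sqrt_nonneg _))
    rw [Complex.norm_intCast, Real.sqrt_le_iff]
    refine ⟨abs_nonneg _, ?_⟩
    rw [← Int.cast_abs]
    have h1 : |divisor F univ u| ≤ |divisor F univ u| ^ 2 := by
      rcases (abs_nonneg (divisor F univ u)).eq_or_lt with h0 | h0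
      · rw [← h0]; norm_num
      · exact le_self_pow₀ (by omega) two_ne_zero
    exact_mod_cast h1

end

/-- Functions of the radius that are logarithmically small with respect to `T`. -/
def LogSmall (T u : ℝ → ℝ) : Prop :=
  ∃ C : ℝ, 0 ≤ C ∧ ∃ a : ℕ, ∀ r R : ℝ, 1 ≤ r → r < R →
    u r ≤ C * Real.log (1 + C * (T R + 1) * (R / (R - r)) ^ a / Real.sqrt r)

lemma logSmall_bound_mono {t q s C D : ℝ} {a b : ℕ} (ht : 0 ≤ t) (hq : 1 ≤ q) (hC : 0 ≤ C)
    (hCD : C ≤ D) (hab : a ≤ b) :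
    C * Real.log (1 + C * (t + 1) * q ^ a / Real.sqrt s) ≤
      D * Real.log (1 + D * (t + 1) * q ^ b / Real.sqrt s) := by
  have hs := Real.sqrt_nonneg s
  have hD := hC.trans hCD
  have h1 : C * (t + 1) * q ^ a / Real.sqrt s ≤ D * (t + 1) * q ^ b / Real.sqrt s := by
    gcongr
  have h2 : 0 ≤ C * (t + 1) * q ^ a / Real.sqrt s := by positivity
  apply mul_le_mul hCD _ (Real.log_nonneg (by linarith)) hD
  exact Real.log_le_log (by linarith) (by linarith)

lemma one_le_div_sub {r R : ℝ} (hr : 1 ≤ r) (hR : r < R) : 1 ≤ R / (R - r) := by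
  rw [one_le_div (sub_pos.2 hR)]; linarith

lemma LogSmall.add {T u v : ℝ → ℝ} (hT : ∀ r, 1 ≤ r → 0 ≤ T r) (hu : LogSmall T u)
    (hv : LogSmall T v) : LogSmall T (fun r => u r + v r) := by
  obtain ⟨C, hC, a, h1⟩ := hu
  obtain ⟨D, hD, b, h2⟩ := hv
  refine ⟨2 * (C + D), by positivity, max a b, fun r R hr hR => ?_⟩
  have ht := hT R (hr.trans hR.le)
  have hq := one_le_div_sub hr hR
  have e1 := (h1 r R hr hR).trans
    (logSmall_bound_mono (s := r) (D := C + D) (b := max a b) ht hq hC (by linarith)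
        (le_max_left _ _))
  have e2 := (h2 r R hr hR).trans
    (logSmall_bound_mono (s := r) (D := C + D) (b := max a b) ht hq hD (by linarith)
        (le_max_right _ _))
  have hl : Real.log (1 + (C + D) * (T R + 1) * (R / (R - r)) ^ max a b / Real.sqrt r) ≤
     Real.log (1 + 2 * (C + D) * (T R + 1) * (R / (R - r)) ^ max a b / Real.sqrt r) := by
    have hs := Real.sqrt_nonneg r
    apply Real.log_le_log (by positivity)
    have : 0 ≤ (C + D) := by linarith
    gcongr
    linarith
  have := mul_le_mul_of_nonneg_left hl (show 0 ≤ C + D by linarith)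
  nlinarith

lemma LogSmall.const_mul {T u : ℝ → ℝ} (hT : ∀ r, 1 ≤ r → 0 ≤ T r) (hu : LogSmall T u) {c : ℝ}
    (hc : 0 ≤ c) : LogSmall T (fun r => c * u r) := by
  obtain ⟨C, hC, a, h1⟩ := hu
  refine ⟨(c + 1) * C, by positivity, a, fun r R hr hR => ?_⟩
  have ht := hT R (hr.trans hR.le)
  have hq := one_le_div_sub hr hR
  have e1 := mul_le_mul_of_nonneg_left (h1 r R hr hR) hc
  refine e1.trans ?_
  have hs := Real.sqrt_nonneg r
  have hX : 0 ≤ C * (T R + 1) * (R / (R - r)) ^ a / Real.sqrt r := by positivity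
  have hl : Real.log (1 + C * (T R + 1) * (R / (R - r)) ^ a / Real.sqrt r) ≤
     Real.log (1 + (c + 1) * C * (T R + 1) * (R / (R - r)) ^ a / Real.sqrt r) := by
    apply Real.log_le_log (by linarith)
    have : C ≤ (c + 1) * C := by nlinarith
    gcongr
  have hl0 : 0 ≤ Real.log (1 + C * (T R + 1) * (R / (R - r)) ^ a / Real.sqrt r) :=
    Real.log_nonneg (by linarith)
  calc c * (C * Real.log (1 + C * (T R + 1) * (R / (R - r)) ^ a / Real.sqrt r))
      = (c * C) * Real.log (1 + C * (T R + 1) * (R / (R - r)) ^ a / Real.sqrt r) := by ring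
    _ ≤ ((c + 1) * C) * Real.log (1 + (c + 1) * C * (T R + 1) * (R / (R - r)) ^ a / Real.sqrt r) :=
        by
        apply mul_le_mul _ hl hl0 (by positivity)
        nlinarith

/-- A form of Borel's growth lemma. -/
lemma exists_slow_growth {T : ℝ → ℝ} (hT : ∀ r, 1 ≤ r → 0 ≤ T r) (hmono : MonotoneOn T (Ici 1))
    (r₀ : ℝ) (hr₀ : 1 ≤ r₀) : ∃ r, r₀ ≤ r ∧ T (r + 1 / (T r + 1)) + 1 ≤ 2 * (T r + 1) := by
  by_contra! hcon
  set ρ : ℕ → ℝ := fun i => (fun r => r + 1 / (T r + 1))^[i] r₀ with hρ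
  have hsucc : ∀ i, ρ (i + 1) = ρ i + 1 / (T (ρ i) + 1) := fun i => by
    rw [hρ]; simp only [Function.iterate_succ_apply']
  have h0 : ρ 0 = r₀ := rfl
  have hge : ∀ i, r₀ ≤ ρ i ∧ (2:ℝ) ^ i ≤ T (ρ i) + 1 ∧ ρ i ≤ r₀ + 2 - 2 * (1 / 2) ^ i := by
    intro i
    induction i with
    | zero => rw [h0]; refine ⟨le_rfl, ?_, by norm_num⟩; have := hT r₀ hr₀; simp; linarith
    | succ i ih =>
      obtain ⟨h1, h2, h3⟩ := ih
      have h4 := hcon _ h1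
      have h5 := hT _ (hr₀.trans h1)
      have h6 : 1 / (T (ρ i) + 1) ≤ (1 / 2) ^ i := by
        rw [one_div_pow]; exact one_div_le_one_div_of_le (by positivity) h2
      rw [hsucc]
      refine ⟨?_, ?_, ?_⟩
      · have : 0 ≤ 1 / (T (ρ i) + 1) := by positivity
        linarith
      · rw [pow_succ]; linarith
      · rw [pow_succ]; linarith
  obtain ⟨i, hi⟩ := pow_unbounded_of_one_lt (T (r₀ + 2) + 1) (one_lt_two (α := ℝ))
  obtain ⟨h1, h2, h3⟩ := hge i
  have h4 : T (ρ i) ≤ T (r₀ + 2) := by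
    apply hmono (show 1 ≤ ρ i by linarith) (show (1:ℝ) ≤ r₀ + 2 by linarith)
    have : 0 ≤ 2 * ((1:ℝ) / 2) ^ i := by positivity
    linarith
  linarith

lemma bounded_of_logSmall {T u : ℝ → ℝ} (hT : ∀ r, 1 ≤ r → 0 ≤ T r) (hmono : MonotoneOn T (Ici 1))
    (hu : LogSmall T u) (A : ℝ) (hTu : ∀ r, 1 ≤ r → T r ≤ A + u r) :
    ∃ B, ∀ r, 1 ≤ r → T r ≤ B := by
  obtain ⟨C, hC, a, h1⟩ := hu
  have hmain : ∀ r R, 1 ≤ r → r < R → T r ≤ A + C * Real.log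
      (1 + C * (T R + 1) * (R / (R - r)) ^ a / Real.sqrt r) :=
    fun r R hr hR => (hTu r hr).trans (by linarith [h1 r R hr hR])
  -- slow growth on an unbounded set
  have hslow : ∃ C' : ℝ, 0 ≤ C' ∧ ∀ r, 1 ≤ r → T (r + 1 / (T r + 1)) + 1 ≤ 2 * (T r + 1) →
      T r ≤ C' * (1 + Real.log (r + 1)) := by
    set M : ℝ := 2 * C * (a + 1) + 1 with hM
    have hM0 : 0 < M := by positivity
    refine ⟨2 * (|A| + C * Real.log (1 + 2 * C) + C * (a + 1) * (|Real.log M|) + 1 + C * a), ?_, ?_⟩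
    · have := Real.log_nonneg (show (1:ℝ) ≤ 1 + 2 * C by linarith)
      positivity
    intro r hr hgr
    have ht := hT r hr
    have hpos : 0 < 1 / (T r + 1) := by positivity
    have h2 := hmain r (r + 1 / (T r + 1)) hr (by linarith)
    have h3 : (r + 1 / (T r + 1)) / (r + 1 / (T r + 1) - r) ≤ (r + 1) * (T r + 1) := by
      rw [add_sub_cancel_left, div_div_eq_mul_div, div_one]
      apply mul_le_mul_of_nonneg_right _ (by positivity)
      have : 1 / (T r + 1) ≤ 1 := by rw [div_le_one (by positivity)]; linarith
      linarith
    have h4 : 0 ≤ (r + 1 / (T r + 1)) / (r + 1 / (T r + 1) - r) := by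
      rw [add_sub_cancel_left]; positivity
    have hsr : 1 ≤ Real.sqrt r := by rw [Real.one_le_sqrt]; exact hr
    have ht2 := hT (r + 1 / (T r + 1)) (by linarith)
    have h5 : C * (T (r + 1 / (T r + 1)) + 1) * ((r + 1 / (T r + 1)) / (r + 1 / (T r + 1) - r)) ^ a
        / Real.sqrt r
        ≤ 2 * C * ((T r + 1) ^ (a + 1) * (r + 1) ^ a) := by
      calc _ ≤ C * (T (r + 1 / (T r + 1)) + 1) * ((r + 1 / (T r + 1)) / (r + 1 / (T r + 1) - r)) ^ a
          :=
            div_le_self (by positivity) hsr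
        _ ≤ C * (2 * (T r + 1)) * ((r + 1) * (T r + 1)) ^ a := by gcongr
        _ = _ := by rw [mul_pow]; ring
    have h6 : 1 ≤ (T r + 1) ^ (a + 1) * (r + 1) ^ a :=
      one_le_mul_of_one_le_of_one_le (one_le_pow₀ (by linarith)) (one_le_pow₀ (by linarith))
    have h7 : Real.log
        (1 + C * (T (r + 1 / (T r + 1)) + 1) * ((r + 1 / (T r + 1)) / (r + 1 / (T r + 1) - r)) ^ a
          / Real.sqrt r)
        ≤ Real.log (1 + 2 * C) + ((a + 1) * Real.log (T r + 1) + a * Real.log (r + 1)) := by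
      have : Real.log ((1 + 2 * C) * ((T r + 1) ^ (a + 1) * (r + 1) ^ a)) =
          Real.log (1 + 2 * C) + ((a + 1) * Real.log (T r + 1) + a * Real.log (r + 1)) := by
        rw [Real.log_mul (by positivity) (by positivity), Real.log_mul (by positivity)
            (by positivity),
          Real.log_pow, Real.log_pow]
        push_cast; ring
      rw [← this]
      apply Real.log_le_log (by positivity)
      nlinarith
    have h8 : Real.log (T r + 1) ≤ (T r + 1) / M + |Real.log M| := by
      have h := Real.log_le_sub_one_of_pos (show 0 < (T r + 1) / M by positivity)
      rw [Real.log_div (by positivity) (by positivity)] at h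
      linarith [le_abs_self (Real.log M)]
    have h9 : C * (a + 1) * ((T r + 1) / M) ≤ (T r + 1) / 2 := by
      rw [← mul_div_assoc, div_le_div_iff₀ hM0 two_pos]
      have : C * (a + 1) * 2 ≤ M := by rw [hM]; linarith
      nlinarith
    have h10 := mul_le_mul_of_nonneg_left h7 hC
    have h11 := mul_le_mul_of_nonneg_left h8 (show 0 ≤ C * (a + 1) by positivity)
    have hlr : 0 ≤ Real.log (r + 1) := Real.log_nonneg (by linarith)
    have hl2 := Real.log_nonneg (show (1:ℝ) ≤ 1 + 2 * C by linarith)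
    have hA := le_abs_self A
    have h12 : T r ≤ 2 *
        (|A| + C * Real.log (1 + 2 * C) + C * (a + 1) * (|Real.log M|) + 1 +
          C * a * Real.log (r + 1)) := by
      nlinarith
    have hx : 0 ≤ |A| + C * Real.log (1 + 2 * C) + C * (a + 1) * (|Real.log M|) + 1 := by positivity
    have hy : 0 ≤ C * a := by positivity
    nlinarith [mul_nonneg hx hlr]
  obtain ⟨C', hC', hslow⟩ := hslow
  refine ⟨A + C * Real.log (1 + C * (5 * C' + 1) * 2 ^ a), fun s hs => ?_⟩
  obtain ⟨r, hr, hgr⟩ := exists_slow_growth hT hmono (2 * s) (by linarith)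
  have h1 := hslow r (by linarith) hgr
  have h2 := hmain (r / 2) r (by linarith) (by linarith)
  have h3 : T s ≤ T (r / 2) := hmono (show 1 ≤ s from hs) (show 1 ≤ r / 2 by linarith) (by linarith)
  refine h3.trans (h2.trans ?_)
  have hq : r / (r - r / 2) = 2 := by
    have hr0 : r ≠ 0 := by linarith
    rw [show r - r / 2 = r / 2 by ring]; field_simp
  rw [hq]
  have ht := hT r (by linarith)
  have hs1 : 1 ≤ Real.sqrt (r / 2) := by rw [Real.one_le_sqrt]; linarith
  have hlog : Real.log (r + 1) ≤ 4 * Real.sqrt (r / 2) := by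
    have e1 : Real.log (r + 1) = 2 * Real.log (Real.sqrt (r + 1)) := by
      rw [Real.log_sqrt (by linarith)]; ring
    have e2 := Real.log_le_sub_one_of_pos (Real.sqrt_pos.2 (show 0 < r + 1 by linarith))
    have e3 : Real.sqrt (r + 1) ≤ 2 * Real.sqrt (r / 2) := by
      rw [Real.sqrt_le_iff]
      refine ⟨by positivity, ?_⟩
      rw [mul_pow, Real.sq_sqrt (by linarith)]; linarith
    linarith
  have hT1 : T r + 1 ≤ (5 * C' + 1) * Real.sqrt (r / 2) := by nlinarith
  have : C * (T r + 1) * 2 ^ a / Real.sqrt (r / 2) ≤ C * (5 * C' + 1) * 2 ^ a := by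
    rw [div_le_iff₀ (by linarith)]
    calc C * (T r + 1) * 2 ^ a ≤ C * ((5 * C' + 1) * Real.sqrt (r / 2)) * 2 ^ a := by gcongr
      _ = _ := by ring
  have hX : 0 ≤ C * (T r + 1) * 2 ^ a / Real.sqrt (r / 2) := by positivity
  have := mul_le_mul_of_nonneg_left (Real.log_le_log (by linarith)
    (show 1 + C * (T r + 1) * 2 ^ a / Real.sqrt (r / 2) ≤ 1 + C * (5 * C' + 1) * 2 ^ a
        by linarith)) hC
  linarith

section
open ValueDistribution MeromorphicOn

lemma meromorphicOrderAt_deriv_nonneg {F : ℂ → ℂ} {x : ℂ} (hF : MeromorphicAt F x)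
    (h : 0 ≤ meromorphicOrderAt F x) : 0 ≤ meromorphicOrderAt (deriv F) x := by
  obtain ⟨g, hg, hFg⟩ : ∃ g, AnalyticAt ℂ g x ∧ F =ᶠ[𝓝[≠] x] g := by
    cases ho : meromorphicOrderAt F x with
    | top =>
      exact ⟨0, analyticAt_const, meromorphicOrderAt_eq_top_iff.1 ho⟩
    | coe n =>
      obtain ⟨g, hg, -, hg2⟩ := (meromorphicOrderAt_eq_int_iff hF).1 ho
      rw [ho] at h
      have hn : 0 ≤ n := by exact_mod_cast h
      lift n to ℕ using hn
      refine ⟨fun z => (z - x) ^ n * g z, by fun_prop, ?_⟩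
      filter_upwards [hg2] with z hz
      simpa using hz
  rw [meromorphicOrderAt_congr hFg.nhdsNE_deriv]
  exact hg.deriv.meromorphicOrderAt_nonneg

lemma divisor_deriv {F : ℂ → ℂ} (hF : Meromorphic F) {z : ℂ} (hz : meromorphicOrderAt F z ≠ ⊤) :
    (divisor F univ z ≠ 0 → divisor (deriv F) univ z = divisor F univ z - 1) ∧
    (0 ≤ divisor F univ z → 0 ≤ divisor (deriv F) univ z) := by
  have e1 : divisor F univ z = (meromorphicOrderAt F z).untop₀ :=
    divisor_apply (fun z _ => hF z) (mem_univ z)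
  have e2 : divisor (deriv F) univ z = (meromorphicOrderAt (deriv F) z).untop₀ :=
    divisor_apply (fun z _ => (hF z).deriv) (mem_univ z)
  rw [e1, e2]
  lift meromorphicOrderAt F z to ℤ using hz with d hd
  constructor
  · intro h
    have h' : (d : ℂ) ≠ 0 := by simpa using h
    rw [meromorphicOrderAt_deriv_eq_sub_one h' hd.symm, WithTop.untop₀_coe, WithTop.untop₀_coe]
  · intro h
    have := meromorphicOrderAt_deriv_nonneg (hF z) (by rw [← hd]; exact_mod_cast h)
    exact WithTop.untop₀_nonneg.2 this

lemma logCounting_deriv_le {F : ℂ → ℂ} (hF : Meromorphic F) (ho : ∀ z, meromorphicOrderAt F z ≠ ⊤)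
    {r : ℝ} (hr : 1 ≤ r) : logCounting (deriv F) ⊤ r ≤ 2 * logCounting F ⊤ r := by
  rw [logCounting_top, logCounting_top, two_mul]
  have := Function.locallyFinsuppWithin.logCounting_le (f₁ := (divisor (deriv F) univ)⁻)
    (f₂ := (divisor F univ)⁻ + (divisor F univ)⁻) (fun z => ?_) hr
  · simpa using this
  · have h := divisor_deriv hF (ho z)
    change (divisor (deriv F) univ z)⁻ ≤ (divisor F univ z)⁻ + (divisor F univ z)⁻
    rw [negPart_def, negPart_def]
    by_cases h0 : divisor F univ z = 0
    · have := h.2 h0.ge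
      rw [h0]; simp [this]
    · rw [h.1 h0]; omega

lemma logDeriv_mul_self_eventuallyEq {F : ℂ → ℂ} (hF : Meromorphic F)
    (ho : ∀ z, meromorphicOrderAt F z ≠ ⊤) :
    deriv F =ᶠ[codiscrete ℂ] (fun z => deriv F z / F z) * F := by
  filter_upwards [MeromorphicOn.eventually_codiscreteWithin_apply_ne_zero (fun z _ => hF z)
    (fun z _ => ho z)] with z hz
  simp [hz]

/-- The characteristic of `F` is dominated by `T` up to powers of `R / (R - r)`. -/
def CharDominated (T : ℝ → ℝ) (F : ℂ → ℂ) : Prop :=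
  ∃ C : ℝ, 0 ≤ C ∧ ∃ a : ℕ, ∀ r R : ℝ, 1 ≤ r → r < R →
    characteristic F ⊤ r ≤ C * (T R + 1) * (R / (R - r)) ^ a

lemma CharDominated.self {F : ℂ → ℂ} (hF : Meromorphic F) :
    CharDominated (characteristic F ⊤) F := by
  refine ⟨1, zero_le_one, 0, fun r R _ hR => ?_⟩
  have := characteristic_monotoneOn hF (show (0:ℝ) < r by linarith) (show (0:ℝ) < R by linarith)
      hR.le
  simp; linarith

lemma CharDominated.sub_const {T : ℝ → ℝ} (hT : ∀ r, 1 ≤ r → 0 ≤ T r) {F : ℂ → ℂ}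
    (hF : Meromorphic F) (h : CharDominated T F) (c : ℂ) :
    CharDominated T (fun z => F z - c) := by
  obtain ⟨C, hC, a, h⟩ := h
  set K := Real.posLog ‖c‖ + Real.log 2
  have hK : 0 ≤ K := add_nonneg Real.posLog_nonneg (Real.log_nonneg one_le_two)
  refine ⟨C + K, by positivity, a, fun r R hr hR => ?_⟩
  have h1 := h r R hr hR
  have h2 := abs_characteristic_sub_characteristic_shift_le (r := r) (a₀ := c) hF
  have h3 := (abs_le.1 h2).1
  have h4 : characteristic (fun z => F z - c) ⊤ r ≤ characteristic F ⊤ r + K := by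
    have := (abs_le.1 h2).1; simp only [K]; linarith
  have h5 : 1 ≤ (T R + 1) * (R / (R - r)) ^ a := by
    have := hT R (hr.trans hR.le)
    have := one_le_pow₀ (n := a) (one_le_div_sub hr hR)
    nlinarith
  nlinarith

lemma half_quotients {r R : ℝ} (hR : r < R) :
    r < (r + R) / 2 ∧ (r + R) / 2 < R ∧ ((r + R) / 2) / ((r + R) / 2 - r) ≤ 2 * (R / (R - r)) ∧
    R / (R - (r + R) / 2) = 2 * (R / (R - r)) := by
  have h0 : 0 < R - r := sub_pos.2 hR
  have h3 : (r + R) / 2 - r = (R - r) / 2 := by ring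
  have h4 : R - (r + R) / 2 = (R - r) / 2 := by ring
  refine ⟨by linarith, by linarith, ?_, ?_⟩
  · rw [h3]
    have : (r + R) / 2 / ((R - r) / 2) = (r + R) / (R - r) := by field_simp
    rw [this, ← mul_div_assoc]
    gcongr; linarith
  · rw [h4]; field_simp

lemma CharDominated.logSmall_logDeriv {T : ℝ → ℝ} (hT : ∀ r, 1 ≤ r → 0 ≤ T r) {F : ℂ → ℂ}
    (hF : Meromorphic F) (ho : ∀ z, meromorphicOrderAt F z ≠ ⊤) (h : CharDominated T F) :
    LogSmall T (proximity (fun z => deriv F z / F z) ⊤) := by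
  obtain ⟨C, hC, a, h⟩ := h
  obtain ⟨K, hK, hl⟩ := proximity_logDeriv_le hF ho
  refine ⟨2 + K * (C * 2 ^ a + 1) * 8, by positivity, a + 3, fun r R hr hR => ?_⟩
  obtain ⟨h1, h2, h3, h4⟩ := half_quotients hR
  set ρ := (r + R) / 2
  set q := R / (R - r)
  have hq : 1 ≤ q := one_le_div_sub hr hR
  have hTR := hT R (hr.trans hR.le)
  have e1 := h ρ R (hr.trans h1.le) h2
  rw [h4, mul_pow] at e1
  have hqa : 1 ≤ q ^ a := one_le_pow₀ hq
  have e2 : characteristic F ⊤ ρ + 1 ≤ (C * 2 ^ a + 1) * (T R + 1) * q ^ a := by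
    have : 1 ≤ (T R + 1) * q ^ a := by nlinarith
    nlinarith
  have hc0 : 0 ≤ characteristic F ⊤ ρ := characteristic_nonneg (hr.trans h1.le)
  have hρ0 : 0 ≤ ρ / (ρ - r) := div_nonneg (by linarith) (by linarith)
  have e3 : K * (characteristic F ⊤ ρ + 1) * (ρ / (ρ - r)) ^ 3 ≤
      (2 + K * (C * 2 ^ a + 1) * 8) * (T R + 1) * q ^ (a + 3) := by
    calc _ ≤ K * ((C * 2 ^ a + 1) * (T R + 1) * q ^ a) * (2 * q) ^ 3 := by gcongr
      _ = (K * (C * 2 ^ a + 1) * 8) * ((T R + 1) * q ^ (a + 3)) := by ring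
      _ ≤ (2 + K * (C * 2 ^ a + 1) * 8) * ((T R + 1) * q ^ (a + 3)) := by gcongr; linarith
      _ = _ := by ring
  have hsr := Real.sqrt_nonneg r
  refine (hl r ρ hr h1).trans ?_
  have hp : 0 ≤ K * (characteristic F ⊤ ρ + 1) * (ρ / (ρ - r)) ^ 3 / Real.sqrt r := by positivity
  apply mul_le_mul
  · have : 0 ≤ K * (C * 2 ^ a + 1) * 8 := by positivity
    linarith
  · apply Real.log_le_log (by linarith)
    gcongr
  · exact Real.log_nonneg (by linarith)
  · positivity

lemma CharDominated.deriv {T : ℝ → ℝ} (hT : ∀ r, 1 ≤ r → 0 ≤ T r) {F : ℂ → ℂ}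
    (hF : Meromorphic F) (ho : ∀ z, meromorphicOrderAt F z ≠ ⊤) (h : CharDominated T F) :
    CharDominated T (deriv F) := by
  obtain ⟨D, hD, b, hl⟩ := h.logSmall_logDeriv hT hF ho
  obtain ⟨C, hC, a, h⟩ := h
  refine ⟨2 * C + D * D, by positivity, max a b, fun r R hr hR => ?_⟩
  have hr0 : r ≠ 0 := by linarith
  have hq := one_le_div_sub hr hR
  have hTR := hT R (hr.trans hR.le)
  have e1 := h r R hr hR
  have e2 := hl r R hr hR
  set q := R / (R - r)
  have e3 : proximity (_root_.deriv F) ⊤ r ≤ proximity (fun z => _root_.deriv F z / F z) ⊤ r +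
      proximity F ⊤ r := by
    rw [proximity_congr_codiscrete (logDeriv_mul_self_eventuallyEq hF ho) hr0]
    exact proximity_mul_top_le (fun z => (hF z).deriv.div (hF z)) hF r
  have e4 := logCounting_deriv_le hF ho hr
  have e5 : 0 ≤ proximity F ⊤ r := proximity_nonneg r
  have e6 : D * Real.log (1 + D * (T R + 1) * q ^ b / Real.sqrt r) ≤
      D * (D * (T R + 1) * q ^ b) := by
    gcongr
    have h1 : 1 ≤ Real.sqrt r := by rw [Real.one_le_sqrt]; exact hr
    have h2 : 0 ≤ D * (T R + 1) * q ^ b := by positivity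
    have h3 : D * (T R + 1) * q ^ b / Real.sqrt r ≤ D * (T R + 1) * q ^ b := div_le_self h2 h1
    have h4 : 0 ≤ D * (T R + 1) * q ^ b / Real.sqrt r := by positivity
    have := Real.log_le_sub_one_of_pos
        (show 0 < 1 + D * (T R + 1) * q ^ b / Real.sqrt r by linarith)
    linarith
  have ea : q ^ a ≤ q ^ max a b := pow_le_pow_right₀ hq (le_max_left _ _)
  have eb : q ^ b ≤ q ^ max a b := pow_le_pow_right₀ hq (le_max_right _ _)
  have e7 : C * (T R + 1) * q ^ a ≤ C * (T R + 1) * q ^ max a b := by gcongr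
  have e8 : D * (D * (T R + 1) * q ^ b) ≤ D * (D * (T R + 1) * q ^ max a b) := by gcongr
  simp only [characteristic, Pi.add_apply] at e1 ⊢
  nlinarith


lemma divisor_univ_eq {F : ℂ → ℂ} (hF : Meromorphic F) (z : ℂ) :
    divisor F univ z = (meromorphicOrderAt F z).untop₀ :=
  divisor_apply (fun z _ => hF z) (mem_univ z)

lemma meromorphicOrderAt_iterate_deriv {F : ℂ → ℂ} {z : ℂ} {d : ℤ}
    (hd : meromorphicOrderAt F z = d) (i : ℕ) (h : d < 0 ∨ (i : ℤ) ≤ d) :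
    meromorphicOrderAt (deriv^[i] F) z = ((d - i : ℤ) : WithTop ℤ) := by
  induction i with
  | zero => simpa using hd
  | succ i ih =>
    rw [Function.iterate_succ_apply']
    have h1 := ih (by push_cast at h; omega)
    have h2 : ((d - i : ℤ) : ℂ) ≠ 0 := by
      rw [Int.cast_ne_zero]; push_cast at h; omega
    rw [meromorphicOrderAt_deriv_eq_sub_one h2 h1]
    congr 1; push_cast; ring

lemma meromorphicOrderAt_iterate_deriv_nonneg {F : ℂ → ℂ} (hF : Meromorphic F) {z : ℂ}
    (hd : 0 ≤ meromorphicOrderAt F z) (i : ℕ) : 0 ≤ meromorphicOrderAt (deriv^[i] F) z := by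
  induction i with
  | zero => simpa using hd
  | succ i ih =>
    rw [Function.iterate_succ_apply']
    exact meromorphicOrderAt_deriv_nonneg (hF.iterated_deriv z) ih

lemma meromorphicOrderAt_deriv_eq_top {F : ℂ → ℂ} {z : ℂ}
    (h : meromorphicOrderAt F z = ⊤) : meromorphicOrderAt (deriv F) z = ⊤ := by
  rw [meromorphicOrderAt_eq_top_iff] at h ⊢
  have : F =ᶠ[𝓝[≠] z] fun _ => (0:ℂ) := h
  filter_upwards [this.nhdsNE_deriv] with w hw
  rw [hw]; simp

lemma meromorphicOrderAt_iterate_deriv_eq_top {F : ℂ → ℂ} {z : ℂ} {i j : ℕ} (hij : i ≤ j)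
    (h : meromorphicOrderAt (deriv^[i] F) z = ⊤) : meromorphicOrderAt (deriv^[j] F) z = ⊤ := by
  induction j, hij using Nat.le_induction with
  | base => exact h
  | succ j _ ih =>
    rw [Function.iterate_succ_apply']
    exact meromorphicOrderAt_deriv_eq_top ih

lemma forall_order_eq_top {F : ℂ → ℂ} (hF : Meromorphic F) {z : ℂ}
    (h : meromorphicOrderAt F z = ⊤) (w : ℂ) : meromorphicOrderAt F w = ⊤ := by
  by_contra hw
  exact meromorphicOrderAt_ne_top_of_isPreconnected (U := univ) (fun z _ => hF z)
    isPreconnected_univ (mem_univ w) (mem_univ z) hw h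

/-- A meromorphic function with bounded characteristic is constant. -/
lemma exists_eq_const_of_characteristic_bounded {g : ℂ → ℂ} (hg : Meromorphic g) {B : ℝ}
    (hB : ∀ r, 1 ≤ r → characteristic g ⊤ r ≤ B) :
    ∃ a : ℂ, ∀ z, ∀ᶠ w in 𝓝[≠] z, g w = a := by
  obtain ⟨z₁, hz₁⟩ := (hg 0).eventually_analyticAt.exists
  refine ⟨g z₁, ?_⟩
  set a := g z₁
  set F : ℂ → ℂ := fun z => g z - a
  have hF : Meromorphic F := fun z => (hg z).sub (MeromorphicAt.const a z)
  have hFa : AnalyticAt ℂ F z₁ := hz₁.sub analyticAt_const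
  have key : meromorphicOrderAt F z₁ = ⊤ := by
    by_contra hne
    have hpos : 0 < meromorphicOrderAt F z₁ := by
      refine lt_of_le_of_ne hFa.meromorphicOrderAt_nonneg fun h0 => ?_
      have h1 := (hFa.meromorphicNFAt).meromorphicOrderAt_eq_zero_iff.1 h0.symm
      exact h1 (by simp [F, a])
    have hdiv : 0 < divisor F univ z₁ := by
      rw [divisor_univ_eq hF]
      lift meromorphicOrderAt F z₁ to ℤ using hne with d
      simpa using hpos
    have hD : (divisor F univ)⁺ = 0 := by
      rw [Function.locallyFinsuppWithin.zero_iff_logCounting_bounded (posPart_nonneg _)]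
      rw [Asymptotics.isBigO_iff]
      set K := Real.posLog ‖a‖ + Real.log 2
      refine ⟨B + K + |Real.log ‖meromorphicTrailingCoeffAt F 0‖|, ?_⟩
      filter_upwards [eventually_ge_atTop 1] with r hr
      have h1 : 0 ≤ logCounting F 0 r := logCounting_nonneg hr
      have h2 : logCounting F 0 r ≤ characteristic F⁻¹ ⊤ r := by
        have : 0 ≤ proximity F⁻¹ ⊤ r := proximity_nonneg r
        have h3 : logCounting F⁻¹ ⊤ = logCounting F 0 := logCounting_inv
        simp only [characteristic, Pi.add_apply, h3]; linarith
      have h3 := characteristic_inv_le hF (show r ≠ 0 by linarith)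
      have h4 := (abs_le.1 (abs_characteristic_sub_characteristic_shift_le (r := r) (a₀ := a) hg)).1
      have h5 := hB r hr
      rw [← logCounting_zero, Real.norm_eq_abs, abs_of_nonneg h1]
      simp only [Pi.one_apply, norm_one, mul_one, K]
      change _ ≤ characteristic g ⊤ r - characteristic F ⊤ r at h4
      linarith
    have := DFunLike.congr_fun hD z₁
    change (divisor F univ z₁)⁺ = 0 at this
    rw [posPart_def] at this
    simp at this; omega
  intro z
  have := meromorphicOrderAt_eq_top_iff.1 (forall_order_eq_top hF key z)
  filter_upwards [this] with w hw
  exact sub_eq_zero.1 hw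

/-- A meromorphic function without zeros and poles, some iterated derivative of which vanishes,
has bounded characteristic. -/
lemma characteristic_bounded_of_iterate_deriv {F : ℂ → ℂ} (hF : Meromorphic F)
    (ho : ∀ z, meromorphicOrderAt F z = 0) (k : ℕ)
    (hk : ∀ z, meromorphicOrderAt (deriv^[k] F) z = ⊤) :
    ∃ B, ∀ r, 1 ≤ r → characteristic F ⊤ r ≤ B := by
  set H := toMeromorphicNFOn F univ with hH
  have hFH : F =ᶠ[codiscrete ℂ] H := toMeromorphicNFOn_eqOn_codiscrete (fun z _ => hF z)
  have hloc : ∀ z, F =ᶠ[𝓝[≠] z] H := fun z =>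
    (toMeromorphicNFOn_eq_self_on_nhdsNE (fun z _ => hF z) (mem_univ z)).symm
  have hnf : ∀ z, MeromorphicNFAt H z := fun z =>
    meromorphicNFOn_toMeromorphicNFOn F univ (mem_univ z)
  have hoH : ∀ z, meromorphicOrderAt H z = 0 := fun z => by
    rw [← meromorphicOrderAt_congr (hloc z)]; exact ho z
  have hana : ∀ z, AnalyticAt ℂ H z := fun z =>
    (hnf z).meromorphicOrderAt_nonneg_iff_analyticAt.1 (hoH z).ge
  have hne : ∀ z, H z ≠ 0 := fun z => (hnf z).meromorphicOrderAt_eq_zero_iff.1 (hoH z)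
  have hdiff : Differentiable ℂ H := fun z => (hana z).differentiableAt
  have hit : ∀ i z, deriv^[i] F =ᶠ[𝓝[≠] z] deriv^[i] H := by
    intro i z
    induction i with
    | zero => exact hloc z
    | succ i ih =>
      rw [Function.iterate_succ_apply', Function.iterate_succ_apply']
      exact ih.nhdsNE_deriv
  have hzero : ∀ z, deriv^[k] H z = 0 := by
    intro z
    have h1 : ∀ᶠ w in 𝓝[≠] z, deriv^[k] H w = 0 := by
      filter_upwards [hit k z, meromorphicOrderAt_eq_top_iff.1 (hk z)] with w h1 h2
      rw [← h1, h2]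
    have h2 : AnalyticAt ℂ (deriv^[k] H) z := (hana z).iterated_deriv k
    have h3 : ∀ᶠ w in 𝓝 z, deriv^[k] H w = 0 :=
      (h2.frequently_zero_iff_eventually_zero).1 h1.frequently
    exact h3.self_of_nhds
  have hzero' : ∀ i, k ≤ i → ∀ z, deriv^[i] H z = 0 := by
    intro i hi
    induction i, hi using Nat.le_induction with
    | base => exact hzero
    | succ j _ ih =>
      intro z
      rw [Function.iterate_succ_apply', show deriv^[j] H = fun _ => 0 from funext ih]
      simp
  obtain ⟨P, hP⟩ : ∃ P : Polynomial ℂ, ∀ z, H z = P.eval z := by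
    refine ⟨∑ i ∈ Finset.range k, Polynomial.C ((i.factorial : ℂ)⁻¹ * deriv^[i] H 0) * Polynomial.X
        ^ i, fun z => ?_⟩
    have h1 := Complex.hasSum_taylorSeries_of_entire hdiff 0 z
    have h2 : HasSum (fun n : ℕ => (n.factorial : ℂ)⁻¹ • (z - 0) ^ n • iteratedDeriv n H 0)
        (∑ i ∈ Finset.range k, (i.factorial : ℂ)⁻¹ • (z - 0) ^ i • iteratedDeriv i H 0) := by
      apply hasSum_sum_of_ne_finset_zero
      intro i hi
      rw [iteratedDeriv_eq_iterate, hzero' i (by simpa using hi)]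
      simp
    rw [h1.unique h2, Polynomial.eval_finsetSum]
    refine Finset.sum_congr rfl fun i _ => ?_
    simp [iteratedDeriv_eq_iterate]; ring
  have hdeg : P.degree ≤ 0 := by
    by_contra h
    obtain ⟨z, hz⟩ := Complex.exists_root (not_le.1 h)
    exact hne z (by rw [hP]; exact hz)
  have hconst : H = fun _ => P.coeff 0 := by
    ext z; rw [hP, Polynomial.eq_C_of_degree_le_zero hdeg]; simp
  refine ⟨Real.posLog ‖P.coeff 0‖, fun r hr => ?_⟩
  rw [characteristic_congr_codiscrete hFH (by linarith), hconst]
  simp [characteristic]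


/-- Sum of the proximity functions of the successive logarithmic derivatives. -/
def logDerivSum (F : ℂ → ℂ) (k : ℕ) (r : ℝ) : ℝ :=
  ∑ i ∈ Finset.range k, proximity (fun z => deriv (deriv^[i] F) z / deriv^[i] F z) ⊤ r

lemma logDerivSum_nonneg (F : ℂ → ℂ) (k : ℕ) (r : ℝ) : 0 ≤ logDerivSum F k r :=
  Finset.sum_nonneg fun _ _ => proximity_nonneg r

lemma logDerivSum_succ (F : ℂ → ℂ) (k : ℕ) (r : ℝ) : logDerivSum F (k + 1) r =
    logDerivSum F k r + proximity (fun z => deriv (deriv^[k] F) z / deriv^[k] F z) ⊤ r :=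
  Finset.sum_range_succ _ _

lemma proximity_iterate_deriv_div_le {F : ℂ → ℂ} (hF : Meromorphic F) (j : ℕ)
    (ho : ∀ i < j, ∀ z, meromorphicOrderAt (deriv^[i] F) z ≠ ⊤) {r : ℝ} (hr : r ≠ 0) :
    proximity (fun z => deriv^[j] F z / F z) ⊤ r ≤ logDerivSum F j r := by
  induction j with
  | zero =>
    rw [proximity_top]
    have : (fun z => Real.posLog ‖deriv^[0] F z / F z‖) = fun _ => 0 := by
      ext z
      by_cases h : F z = 0 <;> simp [h]
    rw [this, Real.circleAverage_const]
    exact logDerivSum_nonneg _ _ _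
  | succ j ih =>
    have h1 := ih (fun i hi => ho i (by omega))
    have hj : Meromorphic (deriv^[j] F) := hF.iterated_deriv
    have h2 : (fun z => deriv^[j + 1] F z / F z) =ᶠ[codiscrete ℂ]
        (fun z => deriv (deriv^[j] F) z / deriv^[j] F z) * (fun z => deriv^[j] F z / F z) := by
      filter_upwards [MeromorphicOn.eventually_codiscreteWithin_apply_ne_zero (fun z _ => hj z)
        (fun z _ => ho j (by omega) z)] with z hz
      rw [Function.iterate_succ_apply']
      simp only [Pi.mul_apply]
      field_simp
    rw [proximity_congr_codiscrete h2 hr, logDerivSum_succ]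
    have h3 := proximity_mul_top_le (f₁ := fun z => deriv (deriv^[j] F) z / deriv^[j] F z)
      (f₂ := fun z => deriv^[j] F z / F z) (fun z => (hj z).deriv.div (hj z))
      (fun z => (hj z).div (hF z)) r
    simp only [Pi.add_apply] at h3
    linarith

lemma logSmall_zero {T : ℝ → ℝ} : LogSmall T (fun _ => 0) :=
  ⟨0, le_rfl, 0, fun _ _ _ _ => by simp⟩

lemma charDominated_iterate_deriv {F : ℂ → ℂ} (hF : Meromorphic F) (j : ℕ)
    (ho : ∀ i < j, ∀ z, meromorphicOrderAt (deriv^[i] F) z ≠ ⊤) :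
    CharDominated (characteristic F ⊤) (deriv^[j] F) := by
  induction j with
  | zero => exact CharDominated.self hF
  | succ j ih =>
    rw [Function.iterate_succ_apply']
    exact (ih (fun i hi => ho i (by omega))).deriv (fun r hr => characteristic_nonneg hr)
      hF.iterated_deriv (ho j (by omega))

lemma logSmall_logDerivSum {F : ℂ → ℂ} (hF : Meromorphic F) (j : ℕ)
    (ho : ∀ i < j, ∀ z, meromorphicOrderAt (deriv^[i] F) z ≠ ⊤) :
    LogSmall (characteristic F ⊤) (logDerivSum F j) := by
  induction j with
  | zero =>
    have : logDerivSum F 0 = fun _ => 0 := by ext r; simp [logDerivSum]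
    rw [this]; exact logSmall_zero
  | succ j ih =>
    have : logDerivSum F (j + 1) = fun r => logDerivSum F j r +
        proximity (fun z => deriv (deriv^[j] F) z / deriv^[j] F z) ⊤ r := by
      ext r; exact logDerivSum_succ F j r
    rw [this]
    have hT : ∀ r, 1 ≤ r → 0 ≤ characteristic F ⊤ r := fun r hr => characteristic_nonneg hr
    exact (ih (fun i hi => ho i (by omega))).add hT
      ((charDominated_iterate_deriv hF j (fun i hi => ho i (by omega))).logSmall_logDeriv hT
        hF.iterated_deriv (ho j (by omega)))

/-- Order bookkeeping for `f`, `f⁽ᵏ⁾ - c` and `f⁽ᵏ⁺¹⁾`. -/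
lemma divisor_inequalities {f : ℂ → ℂ} (hf : Meromorphic f) {k m n : ℕ} {c : ℂ} (hc : c ≠ 0)
    (hkn : k + 3 ≤ n) (ho : ∀ i ≤ k + 1, ∀ z, meromorphicOrderAt (deriv^[i] f) z ≠ ⊤)
    (hoc : ∀ z, meromorphicOrderAt (fun z => deriv^[k] f z - c) z ≠ ⊤)
    (hdvd : ∀ z, (n : ℤ) ∣ divisor f univ z)
    (hmult : ∀ z, 0 < meromorphicOrderAt (fun z => deriv^[k] f z - c) z →
      ((m : ℤ) : WithTop ℤ) ≤ meromorphicOrderAt (fun z => deriv^[k] f z - c) z) (z : ℂ) :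
    ((n * m : ℕ) : ℤ) * (divisor (fun z => deriv^[k] f z - c) univ z -
        divisor (deriv^[k + 1] f) univ z + (divisor f univ z)⁺) ≤
      (((k + 1) * m : ℕ) : ℤ) * (divisor f univ z)⁺ + (m : ℤ) * (divisor f univ z)⁻ +
        (n : ℤ) * (divisor (fun z => deriv^[k] f z - c) univ z)⁺ ∧
    (n : ℤ) * (divisor (deriv^[k] f) univ z)⁻ ≤ ((n + k : ℕ) : ℤ) * (divisor f univ z)⁻ := by
  set G : ℂ → ℂ := fun z => deriv^[k] f z - c with hG
  have hFk : Meromorphic (deriv^[k] f) := hf.iterated_deriv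
  have hFk1 : Meromorphic (deriv^[k + 1] f) := hf.iterated_deriv
  have hGm : Meromorphic G := fun z => (hFk z).sub (MeromorphicAt.const c z)
  have hderG : deriv G = deriv^[k + 1] f := by
    rw [Function.iterate_succ_apply']; ext w; simp [hG]
  have hG' := divisor_deriv hGm (hoc z)
  rw [hderG] at hG'
  obtain ⟨d, hd⟩ : ∃ d : ℤ, (d : WithTop ℤ) = meromorphicOrderAt f z :=
    WithTop.ne_top_iff_exists.1 (ho 0 (by omega) z)
  have ed : divisor f univ z = d := by rw [divisor_univ_eq hf, ← hd]; rfl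
  obtain ⟨e, he⟩ := hdvd z
  rw [ed] at he
  obtain ⟨h, hh⟩ := WithTop.ne_top_iff_exists.1 (hoc z)
  have eh : divisor G univ z = h := by rw [divisor_univ_eq hGm, ← hh]; rfl
  have hn : (k:ℤ) + 3 ≤ n := by exact_mod_cast hkn
  have hcst : meromorphicOrderAt (fun _ : ℂ => -c) z = 0 := by
    have h1 : AnalyticAt ℂ (fun _ : ℂ => -c) z := analyticAt_const
    exact h1.meromorphicNFAt.meromorphicOrderAt_eq_zero_iff.2 (neg_ne_zero.2 hc)
  have hGadd : G = deriv^[k] f + fun _ => -c := by ext w; simp [hG, sub_eq_add_neg]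
  rw [eh] at hG'
  rw [ed, eh]
  have hmn : (0:ℤ) ≤ m := by positivity
  rcases lt_trichotomy d 0 with hneg | h0 | hpos
  · have e1 := meromorphicOrderAt_iterate_deriv hd.symm k (Or.inl hneg)
    have e2 := meromorphicOrderAt_iterate_deriv hd.symm (k + 1) (Or.inl hneg)
    have e3 : divisor (deriv^[k] f) univ z = d - k := by rw [divisor_univ_eq hFk, e1]; rfl
    have e4 : divisor (deriv^[k + 1] f) univ z = d - (k + 1 : ℕ) := by
      rw [divisor_univ_eq hFk1, e2]; rfl
    have e5 : h = d - k := by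
      have : meromorphicOrderAt G z = ((d - k : ℤ) : WithTop ℤ) := by
        rw [hGadd, meromorphicOrderAt_add_eq_left_of_lt (MeromorphicAt.const _ z), e1]
        rw [e1, hcst]
        exact_mod_cast (by omega : d - (k:ℤ) < 0)
      rw [← hh] at this
      exact_mod_cast this
    have hee : (n : ℤ) ≤ -d := by
      have : e ≤ -1 := by by_contra hcon; nlinarith
      nlinarith
    rw [e3, e4, e5]
    have p1 : d⁺ = 0 := posPart_eq_zero.2 hneg.le
    have p2 : d⁻ = -d := negPart_of_nonpos hneg.le
    have p3 : (d - (k:ℤ))⁺ = 0 := posPart_eq_zero.2 (by omega)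
    have p4 : (d - (k:ℤ))⁻ = -(d - k) := negPart_of_nonpos (by omega)
    rw [p1, p2, p3, p4]
    push_cast
    constructor <;> nlinarith
  · subst h0
    have hnn := meromorphicOrderAt_iterate_deriv_nonneg hf (z := z) (by rw [← hd]; rfl) k
    have e3 : 0 ≤ divisor (deriv^[k] f) univ z := by
      rw [divisor_univ_eq hFk]; exact WithTop.untop₀_nonneg.2 hnn
    have hh0 : 0 ≤ h := by
      have : min (meromorphicOrderAt (deriv^[k] f) z) (meromorphicOrderAt (fun _ : ℂ => -c) z)
          ≤ meromorphicOrderAt G z := by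
        rw [hGadd]; exact meromorphicOrderAt_add (hFk z) (MeromorphicAt.const _ z)
      rw [hcst, min_eq_right hnn, ← hh] at this
      exact_mod_cast this
    have p4 : (divisor (deriv^[k] f) univ z)⁻ = 0 := negPart_eq_zero.2 e3
    have p3 : h⁺ = h := posPart_of_nonneg hh0
    rw [p3, p4]
    simp only [posPart_zero, negPart_zero]
    push_cast
    refine ⟨?_, by simp⟩
    rcases hh0.eq_or_lt with h0 | h0
    · have := hG'.2 h0.le
      rw [← h0]
      have : 0 ≤ (n : ℤ) * m := by positivity
      nlinarith
    · rw [hG'.1 h0.ne']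
      have hm' := hmult z (by rw [← hh]; exact_mod_cast h0)
      rw [← hh] at hm'
      have : (m : ℤ) ≤ h := by exact_mod_cast hm'
      nlinarith
  · have hee : (n : ℤ) ≤ d := by
      have : 1 ≤ e := by by_contra hcon; nlinarith
      nlinarith
    have e1 := meromorphicOrderAt_iterate_deriv hd.symm k (Or.inr (by omega))
    have e2 := meromorphicOrderAt_iterate_deriv hd.symm (k + 1) (Or.inr (by push_cast; omega))
    have e3 : divisor (deriv^[k] f) univ z = d - k := by rw [divisor_univ_eq hFk, e1]; rfl
    have e4 : divisor (deriv^[k + 1] f) univ z = d - (k + 1 : ℕ) := by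
      rw [divisor_univ_eq hFk1, e2]; rfl
    have e5 : h = 0 := by
      have : meromorphicOrderAt G z = ((0 : ℤ) : WithTop ℤ) := by
        rw [hGadd, meromorphicOrderAt_add_eq_right_of_lt (hFk z), hcst]
        · rfl
        · rw [e1, hcst]
          exact_mod_cast (by omega : 0 < d - (k:ℤ))
      rw [← hh] at this
      exact_mod_cast this
    rw [e3, e4, e5]
    have p1 : d⁺ = d := posPart_of_nonneg hpos.le
    have p2 : d⁻ = 0 := negPart_eq_zero.2 hpos.le
    have p4 : (d - (k:ℤ))⁻ = 0 := negPart_eq_zero.2 (by omega)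
    rw [p1, p2, p4]
    simp only [posPart_zero]
    push_cast
    constructor
    · have h1 : 0 ≤ ((k:ℤ) + 1) * m := by positivity
      nlinarith
    · simp


lemma logCounting_zero_le {F : ℂ → ℂ} (hF : Meromorphic F) {r : ℝ} (hr : 1 ≤ r) :
    logCounting F 0 r ≤ characteristic F ⊤ r + |Real.log ‖meromorphicTrailingCoeffAt F 0‖| := by
  have : 0 ≤ proximity F⁻¹ ⊤ r := proximity_nonneg r
  have h3 : logCounting F⁻¹ ⊤ = logCounting F 0 := logCounting_inv
  have := characteristic_inv_le hF (show r ≠ 0 by linarith)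
  simp only [characteristic, Pi.add_apply, h3] at this ⊢; linarith

/-- A Milloux-type inequality. -/
lemma proximity_inv_le {f : ℂ → ℂ} (hf : Meromorphic f) {k : ℕ} {c : ℂ} (hc : c ≠ 0)
    (ho : ∀ i ≤ k + 1, ∀ z, meromorphicOrderAt (deriv^[i] f) z ≠ ⊤) :
    ∃ A, ∀ r, 1 ≤ r → proximity f⁻¹ ⊤ r ≤ 2 * logDerivSum f (k + 1) r +
      proximity (fun z => deriv (fun z => deriv^[k] f z - c) z / (deriv^[k] f z - c)) ⊤ r +
      Function.locallyFinsuppWithin.logCounting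
        (divisor (fun z => deriv^[k] f z - c) univ - divisor (deriv^[k + 1] f) univ) r + A := by
  set G : ℂ → ℂ := fun z => deriv^[k] f z - c with hG
  have hFk : Meromorphic (deriv^[k] f) := hf.iterated_deriv
  have hFk1 : Meromorphic (deriv^[k + 1] f) := hf.iterated_deriv
  have hGm : Meromorphic G := fun z => (hFk z).sub (MeromorphicAt.const c z)
  have hderG : deriv G = deriv^[k + 1] f := by
    rw [Function.iterate_succ_apply']; ext w; simp [hG]
  have hoG : ∀ z, meromorphicOrderAt G z ≠ ⊤ := fun z h => by
    have := meromorphicOrderAt_deriv_eq_top h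
    rw [hderG] at this
    exact ho (k + 1) le_rfl z this
  rw [hderG]
  set W : ℂ → ℂ := G * (deriv^[k + 1] f)⁻¹ with hW
  have hWm : Meromorphic W := fun z => (hGm z).mul (hFk1 z).inv
  have hWi : W⁻¹ = fun z => deriv^[k + 1] f z / (deriv^[k] f z - c) := by
    ext z; simp [hW, hG, div_eq_mul_inv, mul_comm]
  have hWim : Meromorphic W⁻¹ := fun z => (hWm z).inv
  have hdivW : divisor W univ = divisor G univ - divisor (deriv^[k + 1] f) univ := by
    ext z
    change divisor W univ z = divisor G univ z - divisor (deriv^[k + 1] f) univ z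
    rw [divisor_univ_eq hWm, divisor_univ_eq hGm, divisor_univ_eq hFk1, hW,
      meromorphicOrderAt_mul (hGm z) (hFk1 z).inv, meromorphicOrderAt_inv]
    have h1 := hoG z
    have h2 := ho (k + 1) le_rfl z
    lift meromorphicOrderAt G z to ℤ using h1 with a
    lift meromorphicOrderAt (deriv^[k + 1] f) z to ℤ using h2 with b
    change (((a + -b : ℤ)) : WithTop ℤ).untop₀ = _
    simp [sub_eq_add_neg]
  rw [← hWi, ← hdivW]
  refine ⟨Real.posLog ‖c⁻¹‖ + Real.log 2 + |Real.log ‖meromorphicTrailingCoeffAt W⁻¹ 0‖|,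
    fun r hr => ?_⟩
  have hr0 : r ≠ 0 := by linarith
  have hid : f⁻¹ =ᶠ[codiscrete ℂ]
      (fun _ => c⁻¹) * ((fun z => deriv^[k] f z / f z) +
        (fun _ => -1) * (W * fun z => deriv^[k + 1] f z / f z)) := by
    filter_upwards [MeromorphicOn.eventually_codiscreteWithin_apply_ne_zero (fun z _ => hf z)
        (fun z _ => ho 0 (by omega) z), MeromorphicOn.eventually_codiscreteWithin_apply_ne_zero
            (fun z _ => hFk1 z)
        (fun z _ => ho (k + 1) le_rfl z)] with z h1 h2
    simp only [Pi.mul_apply, Pi.add_apply, Pi.inv_apply, hW, hG]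
    field_simp
    ring
  have m1 : Meromorphic (fun z => deriv^[k] f z / f z) := fun z => (hFk z).div (hf z)
  have m2 : Meromorphic (fun z => deriv^[k + 1] f z / f z) := fun z => (hFk1 z).div (hf z)
  have m3 : Meromorphic (W * fun z => deriv^[k + 1] f z / f z) := fun z => (hWm z).mul (m2 z)
  have mc : ∀ a : ℂ, Meromorphic (fun _ : ℂ => a) := fun a z => MeromorphicAt.const a z
  have m4 : Meromorphic ((fun _ => -1) * (W * fun z => deriv^[k + 1] f z / f z)) :=
    fun z => (mc (-1) z).mul (m3 z)
  rw [proximity_congr_codiscrete hid hr0]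
  have e1 := proximity_mul_top_le (mc c⁻¹)
    (f₂ := ((fun z => deriv^[k] f z / f z) +
      (fun _ => -1) * (W * fun z => deriv^[k + 1] f z / f z)))
    (fun z => (m1 z).add (m4 z)) r
  have e2 := proximity_add_top_le m1 m4 r
  have e3 := proximity_mul_top_le (mc (-1)) m3 r
  have e4 := proximity_mul_top_le hWm m2 r
  have c1 : ∀ a : ℂ, proximity (fun _ : ℂ => a) ⊤ r = Real.posLog ‖a‖ := fun a => by simp
  simp only [Pi.add_apply, c1] at e1 e2 e3 e4
  have c2 : Real.posLog ‖(-1 : ℂ)‖ = 0 := by simp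
  rw [c2] at e3
  have e5 := proximity_iterate_deriv_div_le hf k (fun i hi => ho i (by omega)) hr0
  have e6 := proximity_iterate_deriv_div_le hf (k + 1) (fun i hi => ho i (by omega)) hr0
  have e7 : logDerivSum f k r ≤ logDerivSum f (k + 1) r := by
    rw [logDerivSum_succ]
    have : 0 ≤ proximity (fun z => deriv (deriv^[k] f) z / deriv^[k] f z) ⊤ r := proximity_nonneg r
    linarith
  have e8 := characteristic_inv_le hWim hr0
  rw [inv_inv] at e8
  simp only [characteristic, Pi.add_apply] at e8
  have e9 : logCounting W⁻¹ ⊤ = logCounting W 0 := logCounting_inv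
  rw [e9] at e8
  have e10 := congrFun (log_counting_zero_sub_logCounting_top (f := W)) r
  simp only [Pi.sub_apply] at e10
  rw [e10]
  linarith

theorem eq_const_of_zeros_multiplicity {g : ℂ → ℂ} (hg : Meromorphic g) {k m n : ℕ} {c : ℂ}
    (hc : c ≠ 0) (hkn : k + 3 ≤ n) (hcond : (k + 2) * m + n + k < n * m)
    (hmult : ∀ z, 0 < meromorphicOrderAt (fun z => deriv^[k] (g ^ n) z - c) z →
      ((m : ℤ) : WithTop ℤ) ≤ meromorphicOrderAt (fun z => deriv^[k] (g ^ n) z - c) z) :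
    ∃ a : ℂ, ∀ z, ∀ᶠ w in 𝓝[≠] z, g w = a := by
  by_cases htop : ∃ z, meromorphicOrderAt g z = ⊤
  · obtain ⟨z, hz⟩ := htop
    exact ⟨0, fun w => meromorphicOrderAt_eq_top_iff.1 (forall_order_eq_top hg hz w)⟩
  push Not at htop
  have hn0 : n ≠ 0 := by omega
  set f := g ^ n with hfdef
  have hf : Meromorphic f := fun z => (hg z).pow n
  have hof : ∀ z, ∃ e : ℤ, meromorphicOrderAt f z = ((n * e : ℤ) : WithTop ℤ) := by
    intro z
    obtain ⟨e, he⟩ := WithTop.ne_top_iff_exists.1 (htop z)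
    refine ⟨e, ?_⟩
    rw [hfdef, meromorphicOrderAt_pow (hg z), ← he]
    rfl
  have hTf : ∀ r, characteristic f ⊤ r = n * characteristic g ⊤ r := fun r => by
    rw [hfdef, characteristic_pow_top hg]; simp
  suffices h : ∃ B, ∀ r, 1 ≤ r → characteristic f ⊤ r ≤ B by
    obtain ⟨B, hB⟩ := h
    refine exists_eq_const_of_characteristic_bounded hg (B := B) fun r hr => ?_
    have h1 := hB r hr
    rw [hTf] at h1
    have h2 : 0 ≤ characteristic g ⊤ r := characteristic_nonneg hr
    have h3 : (1:ℝ) ≤ n := by exact_mod_cast (by omega : 1 ≤ n)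
    nlinarith
  by_cases hdeg : ∃ i ≤ k + 1, ∃ z, meromorphicOrderAt (deriv^[i] f) z = ⊤
  · obtain ⟨i, hi, z, hz⟩ := hdeg
    have h1 := meromorphicOrderAt_iterate_deriv_eq_top hi hz
    have h2 : Meromorphic (deriv^[k + 1] f) := hf.iterated_deriv
    refine characteristic_bounded_of_iterate_deriv hf (fun w => ?_) (k + 1)
        (forall_order_eq_top h2 h1)
    obtain ⟨e, he⟩ := hof w
    by_contra hne
    have hd : (n : ℤ) * e ≠ 0 := fun h0 => hne (by rw [he, h0]; rfl)
    have : (n : ℤ) * e < 0 ∨ ((k + 1 : ℕ) : ℤ) ≤ n * e := by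
      rcases lt_or_gt_of_ne hd with h | h
      · exact Or.inl h
      · right
        have h3 : 1 ≤ e := by by_contra hcon; nlinarith
        have : (k : ℤ) + 3 ≤ n := by exact_mod_cast hkn
        push_cast; nlinarith
    have := meromorphicOrderAt_iterate_deriv he (k + 1) this
    rw [forall_order_eq_top h2 h1 w] at this
    exact WithTop.coe_ne_top this.symm
  push Not at hdeg
  set G : ℂ → ℂ := fun z => deriv^[k] f z - c with hG
  have hFk : Meromorphic (deriv^[k] f) := hf.iterated_deriv
  have hGm : Meromorphic G := fun z => (hFk z).sub (MeromorphicAt.const c z)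
  have hderG : deriv G = deriv^[k + 1] f := by
    rw [Function.iterate_succ_apply']; ext w; simp [hG]
  have hoG : ∀ z, meromorphicOrderAt G z ≠ ⊤ := fun z h => by
    have := meromorphicOrderAt_deriv_eq_top h
    rw [hderG] at this
    exact hdeg (k + 1) le_rfl z this
  have hdvd : ∀ z, (n : ℤ) ∣ divisor f univ z := fun z => by
    obtain ⟨e, he⟩ := hof z
    rw [divisor_univ_eq hf, he]
    exact ⟨e, rfl⟩
  have hineq := divisor_inequalities hf hc hkn hdeg hoG hdvd hmult
  obtain ⟨A, hA⟩ := proximity_inv_le hf hc hdeg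
  set T := characteristic f ⊤ with hT
  have hTnn : ∀ r, 1 ≤ r → 0 ≤ T r := fun r hr => characteristic_nonneg hr
  set v : ℝ → ℝ := proximity (fun z => deriv G z / G z) ⊤ with hv
  have hsv : LogSmall T v :=
    ((charDominated_iterate_deriv hf k (fun i hi => hdeg i (by omega))).sub_const hTnn hFk c
        ).logSmall_logDeriv
      hTnn hGm hoG
  have hsS : LogSmall T (logDerivSum f (k + 1)) := logSmall_logDerivSum hf (k + 1)
      (fun i hi => hdeg i (by omega))
  set L := |Real.log ‖meromorphicTrailingCoeffAt f⁻¹ 0‖| with hL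
  set L' := |Real.log ‖meromorphicTrailingCoeffAt f 0‖| with hL'
  set L'' := |Real.log ‖meromorphicTrailingCoeffAt G 0‖| with hL''
  set K := Real.posLog ‖c‖ + Real.log 2 with hK
  have hsmall : LogSmall T
      (fun r => (2 * n * m + n : ℝ) * logDerivSum f (k + 1) r + (n * m : ℝ) * v r) :=
    (hsS.const_mul hTnn (by positivity)).add hTnn (hsv.const_mul hTnn (by positivity))
  refine bounded_of_logSmall hTnn (fun a ha b hb hab => characteristic_monotoneOn hf
    (show (0:ℝ) < a from lt_of_lt_of_le one_pos ha) (show (0:ℝ) < b from lt_of_lt_of_le one_pos hb)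
        hab) hsmall
    ((n * m : ℝ) * (A + L) + ((k + 1) * m : ℝ) * L' + n * (L'' + K)) (fun r hr => ?_)
  have hr0 : r ≠ 0 := by linarith
  have hfi : Meromorphic f⁻¹ := fun z => (hf z).inv
  have i1 := characteristic_inv_le hfi hr0
  rw [inv_inv] at i1
  have i2 : logCounting f⁻¹ ⊤ = logCounting f 0 := logCounting_inv
  have i3 : characteristic f⁻¹ ⊤ r = proximity f⁻¹ ⊤ r + logCounting f 0 r := by
    simp only [characteristic, Pi.add_apply, i2]
  have i4 := hA r hr
  have i5 := Function.locallyFinsuppWithin.logCounting_le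
    (f₁ := (n * m) • (divisor G univ - divisor (deriv^[k + 1] f) univ + (divisor f univ)⁺))
    (f₂ := ((k + 1) * m) • (divisor f univ)⁺ + m • (divisor f univ)⁻ + n • (divisor G univ)⁺)
    (fun z => by
      have := (hineq z).1
      simp only [← nsmul_eq_mul] at this
      exact this) hr
  simp only [map_add, map_nsmul, Pi.add_apply, Pi.smul_apply, ← logCounting_zero,
    ← logCounting_top] at i5
  simp only [nsmul_eq_mul] at i5
  have i6 := Function.locallyFinsuppWithin.logCounting_le
    (f₁ := n • (divisor (deriv^[k] f) univ)⁻) (f₂ := (n + k) • (divisor f univ)⁻)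
    (fun z => by
      have := (hineq z).2
      simp only [← nsmul_eq_mul] at this
      exact this) hr
  simp only [map_nsmul, Pi.smul_apply, nsmul_eq_mul, ← logCounting_top] at i6
  have i7 : logCounting f 0 r ≤ T r + L' := logCounting_zero_le hf hr
  have i8 : logCounting f ⊤ r ≤ T r := by
    have : 0 ≤ proximity f ⊤ r := proximity_nonneg r
    simp only [hT, characteristic, Pi.add_apply]; linarith
  have i9 : logCounting G 0 r ≤ characteristic G ⊤ r + L'' := logCounting_zero_le hGm hr
  have i10 : characteristic G ⊤ r ≤ characteristic (deriv^[k] f) ⊤ r + K := by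
    have := (abs_le.1 (abs_characteristic_sub_characteristic_shift_le (r := r) (a₀ := c) hFk)).1
    change _ ≤ characteristic (deriv^[k] f) ⊤ r - characteristic G ⊤ r at this
    linarith
  have i11 : proximity (deriv^[k] f) ⊤ r ≤ logDerivSum f (k + 1) r + proximity f ⊤ r := by
    have h1 : deriv^[k] f =ᶠ[codiscrete ℂ] (fun z => deriv^[k] f z / f z) * f := by
      filter_upwards [MeromorphicOn.eventually_codiscreteWithin_apply_ne_zero (fun z _ => hf z)
        (fun z _ => hdeg 0 (by omega) z)] with z h1
      simp [h1]
    have m1 : Meromorphic (fun z => deriv^[k] f z / f z) := fun z => (hFk z).div (hf z)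
    rw [proximity_congr_codiscrete h1 hr0]
    have h2 := proximity_mul_top_le m1 hf r
    simp only [Pi.add_apply] at h2
    have h3 := proximity_iterate_deriv_div_le hf k (fun i hi => hdeg i (by omega)) hr0
    have h4 : 0 ≤ proximity (fun z => deriv (deriv^[k] f) z / deriv^[k] f z) ⊤ r :=
        proximity_nonneg r
    rw [logDerivSum_succ]
    linarith
  have i12 : n * characteristic (deriv^[k] f) ⊤ r ≤
      n * logDerivSum f (k + 1) r + (n + k) * T r := by
    have h1 : T r = proximity f ⊤ r + logCounting f ⊤ r :=
        by simp only [hT, characteristic, Pi.add_apply]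
    have h2 : characteristic (deriv^[k] f) ⊤ r = proximity (deriv^[k] f) ⊤ r +
        logCounting (deriv^[k] f) ⊤ r := by
      simp only [characteristic, Pi.add_apply]
    rw [h1, h2]
    have h3 : 0 ≤ proximity f ⊤ r := proximity_nonneg r
    have h4 : n * proximity (deriv^[k] f) ⊤ r ≤
        n * (logDerivSum f (k + 1) r + proximity f ⊤ r) := by gcongr
    have h5 : 0 ≤ (k : ℝ) * proximity f ⊤ r := by positivity
    push_cast at i6
    linarith
  have hcond' : ((k : ℝ) + 2) * m + n + k + 1 ≤ n * m := by exact_mod_cast hcond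
  have hTr := hTnn r hr
  have j1 : (n * m : ℝ) * T r ≤ n * m * (2 * logDerivSum f (k + 1) r + v r + A + L) +
      ((n * m : ℕ) : ℝ) * (Function.locallyFinsuppWithin.logCounting
        (divisor G univ - divisor (deriv^[k + 1] f) univ) r + logCounting f 0 r) := by
    push_cast
    rw [← mul_add]
    apply mul_le_mul_of_nonneg_left _ (by positivity)
    linarith
  have j2 : ((k + 1 : ℝ) * m) * logCounting f 0 r ≤ ((k + 1 : ℝ) * m) * (T r + L') := by gcongr
  have j3 : (m : ℝ) * logCounting f ⊤ r ≤ m * T r := by gcongr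
  have j4 : (n : ℝ) * logCounting G 0 r ≤ n * (characteristic (deriv^[k] f) ⊤ r + K + L'') := by
    gcongr; linarith
  push_cast at i5 j1
  have j5 := mul_le_mul_of_nonneg_right hcond' hTr
  linarith

end

/-- Stereographic embedding of the plane. -/
def stereo (w : ℂ) : ℝ × ℂ := (1 / (1 + ‖w‖ ^ 2), ((1 / (1 + ‖w‖ ^ 2) : ℝ) : ℂ) * w)

/-- Stereographic embedding of the Riemann sphere. -/
def stereoSphere (a : OnePoint ℂ) : ℝ × ℂ := Option.elim a 0 stereo

/-- The involution of the embedded sphere induced by `w ↦ w⁻¹`. -/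
def stereoInv (p : ℝ × ℂ) : ℝ × ℂ := (1 - p.1, (starRingEnd ℂ) p.2)

@[simp] lemma stereoSphere_coe (w : ℂ) : stereoSphere (w : OnePoint ℂ) = stereo w := rfl

@[simp] lemma stereoSphere_infty : stereoSphere OnePoint.infty = 0 := rfl

lemma sphDist_coe_coe (z w : ℂ) : sphDist z w =
    ‖z - w‖ / (Real.sqrt (1 + ‖z‖ ^ 2) * Real.sqrt (1 + ‖w‖ ^ 2)) := rfl

lemma sphDist_coe_infty (z : ℂ) : sphDist z OnePoint.infty = 1 / Real.sqrt (1 + ‖z‖ ^ 2) := rfl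

lemma sphDist_infty_coe (z : ℂ) : sphDist OnePoint.infty z = 1 / Real.sqrt (1 + ‖z‖ ^ 2) := rfl

lemma sphDist_infty_infty : sphDist OnePoint.infty OnePoint.infty = 0 := rfl

lemma sphDist_nonneg (a b : OnePoint ℂ) : 0 ≤ sphDist a b := by
  induction a using OnePoint.rec with
  | infty =>
    induction b using OnePoint.rec with
    | infty => rw [sphDist_infty_infty]
    | coe w => rw [sphDist_infty_coe]; positivity
  | coe z =>
    induction b using OnePoint.rec with
    | infty => rw [sphDist_coe_infty]; positivity
    | coe w => rw [sphDist_coe_coe]; positivity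

lemma stereo_norm_sq (z : ℂ) : ‖(stereo z).2‖ ^ 2 + (stereo z).1 ^ 2 = (stereo z).1 := by
  have : 0 < 1 + ‖z‖ ^ 2 := by positivity
  simp only [stereo, norm_mul, Complex.norm_real, Real.norm_eq_abs, mul_pow, sq_abs]
  field_simp
  ring

lemma sphDist_coe_sq (z w : ℂ) : sphDist z w ^ 2 =
    ((stereo z).1 - (stereo w).1) ^ 2 + ‖(stereo z).2 - (stereo w).2‖ ^ 2 := by
  rw [sphDist_coe_coe, div_pow, mul_pow, Real.sq_sqrt (by positivity), Real.sq_sqrt (by positivity)]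
  have hz : 0 < 1 + ‖z‖ ^ 2 := by positivity
  have hw : 0 < 1 + ‖w‖ ^ 2 := by positivity
  simp only [stereo]
  rw [Complex.sq_norm, Complex.sq_norm, Complex.sq_norm, Complex.sq_norm] at *
  simp only [Complex.normSq_apply, Complex.sub_re, Complex.sub_im, Complex.re_ofReal_mul,
    Complex.im_ofReal_mul] at *
  field_simp
  ring

lemma sphDist_sq (a b : OnePoint ℂ) : sphDist a b ^ 2 =
    ((stereoSphere a).1 - (stereoSphere b).1) ^ 2 +
      ‖(stereoSphere a).2 - (stereoSphere b).2‖ ^ 2 := by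
  have key : ∀ z : ℂ, (1 / Real.sqrt (1 + ‖z‖ ^ 2)) ^ 2 = (stereo z).1 ^ 2 + ‖(stereo z).2‖ ^ 2 :=
      by
    intro z
    rw [div_pow, Real.sq_sqrt (by positivity), add_comm ((stereo z).1 ^ 2), stereo_norm_sq]
    simp [stereo]
  induction a using OnePoint.rec with
  | infty =>
    induction b using OnePoint.rec with
    | infty => simp [sphDist_infty_infty]
    | coe w => rw [sphDist_infty_coe, key]; simp
  | coe z =>
    induction b using OnePoint.rec with
    | infty => rw [sphDist_coe_infty, key]; simp
    | coe w => exact sphDist_coe_sq z w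

lemma dist_stereo_le_sphDist (a b : OnePoint ℂ) :
    dist (stereoSphere a) (stereoSphere b) ≤ sphDist a b := by
  have h := sphDist_sq a b
  have h0 := sphDist_nonneg a b
  rw [Prod.dist_eq]
  apply max_le
  · rw [Real.dist_eq]
    refine abs_le_of_sq_le_sq ?_ h0
    nlinarith [sq_nonneg ‖(stereoSphere a).2 - (stereoSphere b).2‖]
  · rw [dist_eq_norm]
    refine le_of_abs_le (abs_le_of_sq_le_sq ?_ h0)
    nlinarith [sq_nonneg ((stereoSphere a).1 - (stereoSphere b).1)]

lemma sphDist_le_dist_stereo (a b : OnePoint ℂ) :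
    sphDist a b ≤ 2 * dist (stereoSphere a) (stereoSphere b) := by
  have h := sphDist_sq a b
  have h0 : 0 ≤ dist (stereoSphere a) (stereoSphere b) := dist_nonneg
  refine le_of_abs_le (abs_le_of_sq_le_sq ?_ (by positivity))
  have h1 : |(stereoSphere a).1 - (stereoSphere b).1| ≤ dist (stereoSphere a) (stereoSphere b) := by
    rw [Prod.dist_eq, ← Real.dist_eq]; exact le_max_left _ _
  have h2 : ‖(stereoSphere a).2 - (stereoSphere b).2‖ ≤ dist (stereoSphere a) (stereoSphere b) := by
    rw [Prod.dist_eq, ← dist_eq_norm]; exact le_max_right _ _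
  have h3 := sq_le_sq' (by linarith [abs_nonneg ((stereoSphere a).1 - (stereoSphere b).1)]) h1
  have h4 := sq_le_sq' (by linarith [norm_nonneg ((stereoSphere a).2 - (stereoSphere b).2)]) h2
  rw [sq_abs] at h3
  nlinarith

lemma dist_stereo_le (z w : ℂ) : dist (stereo z) (stereo w) ≤ ‖z - w‖ := by
  refine (dist_stereo_le_sphDist (z : OnePoint ℂ) w).trans ?_
  rw [sphDist_coe_coe]
  apply div_le_self (norm_nonneg _)
  have h1 : 1 ≤ Real.sqrt (1 + ‖z‖ ^ 2) := by rw [Real.one_le_sqrt]; nlinarith [sq_nonneg ‖z‖]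
  have h2 : 1 ≤ Real.sqrt (1 + ‖w‖ ^ 2) := by rw [Real.one_le_sqrt]; nlinarith [sq_nonneg ‖w‖]
  nlinarith

lemma continuous_stereo : Continuous stereo := by
  have : LipschitzWith 1 stereo := LipschitzWith.of_dist_le_mul fun z w => by
    simpa [dist_eq_norm] using dist_stereo_le z w
  exact this.continuous

lemma norm_sub_le_sphDist {z w : ℂ} {C : ℝ} (hz : ‖z‖ ≤ C) (hw : ‖w‖ ≤ C) :
    ‖z - w‖ ≤ (1 + C ^ 2) * sphDist z w := by
  rw [sphDist_coe_coe]
  have hC : 0 ≤ C := (norm_nonneg z).trans hz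
  have h1 : Real.sqrt (1 + ‖z‖ ^ 2) ≤ Real.sqrt (1 + C ^ 2) := by gcongr
  have h2 : Real.sqrt (1 + ‖w‖ ^ 2) ≤ Real.sqrt (1 + C ^ 2) := by gcongr
  have h3 : 0 < Real.sqrt (1 + ‖z‖ ^ 2) := by positivity
  have h4 : 0 < Real.sqrt (1 + ‖w‖ ^ 2) := by positivity
  rw [mul_div_assoc', le_div_iff₀ (by positivity), mul_comm]
  apply mul_le_mul_of_nonneg_right _ (norm_nonneg _)
  calc _ ≤ Real.sqrt (1 + C ^ 2) * Real.sqrt (1 + C ^ 2) := by gcongr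
    _ = _ := Real.mul_self_sqrt (by positivity)

lemma norm_sub_le_dist_stereo {z w : ℂ} {C : ℝ} (hz : ‖z‖ ≤ C) (hw : ‖w‖ ≤ C) :
    ‖z - w‖ ≤ 2 * (1 + C ^ 2) * dist (stereo z) (stereo w) := by
  have h1 := norm_sub_le_sphDist hz hw
  have h2 := sphDist_le_dist_stereo (z : OnePoint ℂ) w
  simp only [stereoSphere_coe] at h2
  nlinarith [sq_nonneg C]

lemma stereo_snd_div_fst (w : ℂ) : (stereo w).2 / ((stereo w).1 : ℂ) = w := by
  have : ((1 / (1 + ‖w‖ ^ 2) : ℝ) : ℂ) ≠ 0 := by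
    rw [Complex.ofReal_ne_zero]; positivity
  simp only [stereo]
  rw [mul_div_assoc, mul_div_cancel₀ _ this]

lemma stereo_fst_pos (w : ℂ) : 0 < (stereo w).1 := by simp only [stereo]; positivity

lemma stereoInv_stereoInv (p : ℝ × ℂ) : stereoInv (stereoInv p) = p := by
  ext <;> simp [stereoInv]

lemma dist_stereoInv (p q : ℝ × ℂ) : dist (stereoInv p) (stereoInv q) = dist p q := by
  have h1 : ‖(starRingEnd ℂ) p.2 - (starRingEnd ℂ) q.2‖ = ‖p.2 - q.2‖ := by
    rw [← map_sub, Complex.norm_conj]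
  have h2 : |1 - p.1 - (1 - q.1)| = |p.1 - q.1| := by
    rw [show 1 - p.1 - (1 - q.1) = -(p.1 - q.1) by ring, abs_neg]
  rw [Prod.dist_eq, Prod.dist_eq, Real.dist_eq, Real.dist_eq, dist_eq_norm p.2, ← h1, ← h2,
    ← dist_eq_norm]
  rfl

lemma stereoInv_stereo {w : ℂ} (hw : w ≠ 0) : stereoInv (stereo w) = stereo w⁻¹ := by
  have h0 : ‖w‖ ≠ 0 := norm_ne_zero_iff.2 hw
  have h1 : (0:ℝ) < 1 + ‖w‖ ^ 2 := by positivity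
  have h3 : 1 / (1 + ‖w⁻¹‖ ^ 2) = ‖w‖ ^ 2 * (1 / (1 + ‖w‖ ^ 2)) := by
    rw [norm_inv]; field_simp; ring
  ext1
  · simp only [stereo, stereoInv, h3]; field_simp; ring
  · simp only [stereo, stereoInv, h3]
    rw [map_mul, Complex.conj_ofReal, Complex.ofReal_mul]
    have : ((‖w‖ ^ 2 : ℝ) : ℂ) = w * (starRingEnd ℂ) w := by
      rw [Complex.mul_conj, Complex.normSq_eq_norm_sq]
    rw [this]; field_simp

@[simp] lemma stereoInv_stereo_zero : stereoInv (stereo 0) = 0 := by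
  ext <;> simp [stereo, stereoInv]

lemma norm_stereo_le (a : OnePoint ℂ) : ‖stereoSphere a‖ ≤ 1 := by
  induction a using OnePoint.rec with
  | infty => simp
  | coe z =>
    have h := stereo_norm_sq z
    have h1 := stereo_fst_pos z
    have h2 : (stereo z).1 ≤ 1 := by nlinarith [sq_nonneg ‖(stereo z).2‖]
    rw [stereoSphere_coe, Prod.norm_def]
    apply max_le
    · rw [Real.norm_eq_abs, abs_of_pos h1]; exact h2
    · refine le_of_abs_le (abs_le_of_sq_le_sq ?_ zero_le_one); nlinarith

/-- `f` blows up at `z`. -/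
def IsPoleAt (f : ℂ → ℂ) (z : ℂ) : Prop := Tendsto (fun w => ‖f w‖) (𝓝[≠] z) atTop

/-- The reciprocal of `f`, with value `0` at the poles of `f`. -/
def sphInv (f : ℂ → ℂ) (z : ℂ) : ℂ := if IsPoleAt f z then 0 else (f z)⁻¹

/-- The sphere-valued version of `f`, in the stereographic embedding. -/
def stereoFun (f : ℂ → ℂ) (z : ℂ) : ℝ × ℂ := stereoSphere (toSphere f z)

lemma toSphere_of_isPoleAt {f : ℂ → ℂ} {z : ℂ} (h : IsPoleAt f z) :
    toSphere f z = OnePoint.infty := if_pos h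

lemma toSphere_of_not_isPoleAt {f : ℂ → ℂ} {z : ℂ} (h : ¬ IsPoleAt f z) :
    toSphere f z = f z := if_neg h

lemma stereoFun_of_isPoleAt {f : ℂ → ℂ} {z : ℂ} (h : IsPoleAt f z) : stereoFun f z = 0 := by
  rw [stereoFun, toSphere_of_isPoleAt h, stereoSphere_infty]

lemma stereoFun_of_not_isPoleAt {f : ℂ → ℂ} {z : ℂ} (h : ¬ IsPoleAt f z) :
    stereoFun f z = stereo (f z) := by
  rw [stereoFun, toSphere_of_not_isPoleAt h, stereoSphere_coe]

lemma not_isPoleAt_of_continuousAt {f : ℂ → ℂ} {z : ℂ} (h : ContinuousAt f z) :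
    ¬ IsPoleAt f z := fun hp =>
  not_tendsto_nhds_of_tendsto_atTop hp _ (h.norm.tendsto.mono_left nhdsWithin_le_nhds)

lemma IsPoleAt.congr {f g : ℂ → ℂ} {z : ℂ} (hf : IsPoleAt f z) (h : f =ᶠ[𝓝[≠] z] g) :
    IsPoleAt g z :=
  Tendsto.congr' (h.mono fun w hw => by simp only [hw]) hf

lemma MeromorphicNiceOn.mono {f : ℂ → ℂ} {D E : Set ℂ} (hf : MeromorphicNiceOn f D)
    (h : E ⊆ D) : MeromorphicNiceOn f E :=
  ⟨fun z hz => hf.1 z (h hz), fun z hz => hf.2 z (h hz)⟩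

lemma MeromorphicNiceOn.analyticAt {f : ℂ → ℂ} {D : Set ℂ} (hf : MeromorphicNiceOn f D)
    {z : ℂ} (hz : z ∈ D) (hp : ¬ IsPoleAt f z) : AnalyticAt ℂ f z :=
  (hf.1 z hz).analyticAt ((hf.2 z hz).resolve_right hp)

lemma eventually_not_isPoleAt {f : ℂ → ℂ} {z : ℂ} (hf : MeromorphicAt f z) :
    ∀ᶠ w in 𝓝[≠] z, ¬ IsPoleAt f w :=
  hf.eventually_analyticAt.mono fun _ hw => not_isPoleAt_of_continuousAt hw.continuousAt

lemma analyticAt_sphInv_of_ne {f : ℂ → ℂ} {z : ℂ} (hf : AnalyticAt ℂ f z) (h0 : f z ≠ 0) :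
    AnalyticAt ℂ (sphInv f) z := by
  refine (hf.inv h0).congr ?_
  filter_upwards [hf.eventually_analyticAt] with w hw
  rw [sphInv, if_neg (not_isPoleAt_of_continuousAt hw.continuousAt), Pi.inv_apply]

lemma analyticAt_sphInv_of_isPoleAt {f : ℂ → ℂ} {z : ℂ} (hf : MeromorphicAt f z)
    (hp : IsPoleAt f z) : AnalyticAt ℂ (sphInv f) z := by
  have h1 : f⁻¹ =ᶠ[𝓝[≠] z] sphInv f := by
    filter_upwards [eventually_not_isPoleAt hf] with w hw
    rw [sphInv, if_neg hw, Pi.inv_apply]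
  refine (hf.inv.congr h1).analyticAt ?_
  rw [continuousAt_iff_punctured_nhds, show sphInv f z = 0 from if_pos hp]
  refine Tendsto.congr' h1 ?_
  rw [tendsto_zero_iff_norm_tendsto_zero]
  simp only [Pi.inv_apply, norm_inv]
  exact hp.inv_tendsto_atTop

lemma stereoFun_eq_stereoInv {f : ℂ → ℂ} {z : ℂ} (h : IsPoleAt f z ∨ f z ≠ 0) :
    stereoFun f z = stereoInv (stereo (sphInv f z)) := by
  by_cases hp : IsPoleAt f z
  · rw [stereoFun_of_isPoleAt hp, sphInv, if_pos hp, stereoInv_stereo_zero]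
  · have h0 := h.resolve_left hp
    rw [stereoFun_of_not_isPoleAt hp, sphInv, if_neg hp, stereoInv_stereo (inv_ne_zero h0), inv_inv]

lemma norm_stereoFun_le (f : ℂ → ℂ) (z : ℂ) : ‖stereoFun f z‖ ≤ 1 := norm_stereo_le _

lemma norm_sub_le_of_norm_le {h : ℂ → ℂ} {z₀ : ℂ} {ρ C : ℝ} (hρ : 0 < ρ)
    (hd : DifferentiableOn ℂ h (Metric.ball z₀ ρ)) (hC : ∀ z ∈ Metric.ball z₀ ρ, ‖h z‖ ≤ C)
    {z w : ℂ} (hz : z ∈ Metric.ball z₀ (ρ / 2)) (hw : w ∈ Metric.ball z₀ (ρ / 2)) :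
    ‖h z - h w‖ ≤ C / (ρ / 4) * ‖z - w‖ := by
  refine (convex_ball z₀ (ρ / 2)).norm_image_sub_le_of_norm_deriv_le (𝕜 := ℂ) ?_ ?_ hw hz
  · intro x hx
    exact hd.differentiableAt (Metric.isOpen_ball.mem_nhds
      (Metric.ball_subset_ball (by linarith) hx))
  · intro x hx
    have hsub : Metric.closedBall x (ρ / 4) ⊆ Metric.ball z₀ ρ := by
      intro y hy
      rw [Metric.mem_ball] at *
      rw [Metric.mem_closedBall] at hy
      linarith [dist_triangle y x z₀]
    refine Complex.norm_deriv_le_of_forall_mem_sphere_norm_le (by positivity) ?_ ?_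
    · refine DifferentiableOn.diffContOnCl ?_
      rw [closure_ball _ (by positivity)]
      exact hd.mono hsub
    · intro y hy
      exact hC y (hsub (Metric.sphere_subset_closedBall hy))

/-- A form of the Arzelà–Ascoli theorem for eventually locally equi-Lipschitz sequences. -/
theorem exists_subseq_tendstoLocallyUniformlyOn {E : Type*} [NormedAddCommGroup E] [ProperSpace E]
    {u : ℕ → ℂ → E} (hb : ∀ j z, ‖u j z‖ ≤ 1) {D : Set ℂ}
    (hL : ∀ z₀ ∈ D, ∃ ρ > 0, ∃ L : ℝ, ∀ᶠ j in atTop, ∀ z ∈ Metric.ball z₀ ρ,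
      ∀ w ∈ Metric.ball z₀ ρ, dist (u j z) (u j w) ≤ L * dist z w) :
    ∃ σ : ℕ → ℕ, StrictMono σ ∧ ∃ v : ℂ → E,
      TendstoLocallyUniformlyOn (fun j => u (σ j)) v atTop D := by
  set q := TopologicalSpace.denseSeq ℂ with hq
  have hK : IsCompact (Set.pi univ fun _ : ℕ => Metric.closedBall (0 : E) 1) :=
    isCompact_univ_pi fun _ => isCompact_closedBall 0 1
  obtain ⟨a, -, σ, hσ, ha⟩ := hK.tendsto_subseq (x := fun j i => u j (q i)) (by
    intro j i _
    simpa using hb j (q i))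
  rw [tendsto_pi_nhds] at ha
  have hL' : ∀ z₀ ∈ D, ∃ ρ > 0, ∃ L > 0, ∀ᶠ j in atTop, ∀ z ∈ Metric.ball z₀ ρ,
      ∀ w ∈ Metric.ball z₀ ρ, dist (u (σ j) z) (u (σ j) w) ≤ L * dist z w := by
    intro z₀ hz₀
    obtain ⟨ρ, hρ, L, h⟩ := hL z₀ hz₀
    refine ⟨ρ, hρ, max L 1, by positivity, (hσ.tendsto_atTop.eventually h).mono ?_⟩
    intro j hj z hz w hw
    exact (hj z hz w hw).trans (by gcongr; exact le_max_left _ _)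
  have hlim : ∀ z ∈ D, ∃ l, Tendsto (fun j => u (σ j) z) atTop (𝓝 l) := by
    intro z hz
    obtain ⟨ρ, hρ, L, hL0, h⟩ := hL' z hz
    apply cauchySeq_tendsto_of_complete
    rw [Metric.cauchySeq_iff']
    intro ε hε
    have hδ : 0 < min ρ (ε / (4 * L)) := by positivity
    obtain ⟨i, hi⟩ := (TopologicalSpace.denseRange_denseSeq ℂ).exists_dist_lt z hδ
    have hi1 : dist z (q i) < ρ := hi.trans_le (min_le_left _ _)
    have hi2 : L * dist z (q i) ≤ ε / 4 := by
      have := (hi.trans_le (min_le_right _ _)).le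
      rw [le_div_iff₀ (by positivity)] at this
      simp only [← hq] at this
      linarith
    have hc := Metric.tendsto_atTop.1 (ha i) (ε / 4) (by positivity)
    obtain ⟨N1, hN1⟩ := hc
    obtain ⟨N2, hN2⟩ := eventually_atTop.1 h
    have hmem : q i ∈ Metric.ball z ρ := by rwa [Metric.mem_ball, dist_comm]
    have key : ∀ j ≥ max N1 N2, dist (u (σ j) z) (a i) < ε / 2 := by
      intro j hj
      have e1 := hN1 j (le_of_max_le_left hj)
      have e2 := hN2 j (le_of_max_le_right hj) z (Metric.mem_ball_self hρ) _ hmem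
      have e3 := dist_triangle (u (σ j) z) (u (σ j) (q i)) (a i)
      simp only [Function.comp] at e1
      linarith
    refine ⟨max N1 N2, fun j hj => ?_⟩
    have := dist_triangle_right (u (σ j) z) (u (σ (max N1 N2)) z) (a i)
    linarith [key j hj, key _ le_rfl]
  choose! v hv using hlim
  refine ⟨σ, hσ, v, ?_⟩
  rw [Metric.tendstoLocallyUniformlyOn_iff]
  intro ε hε z hz
  obtain ⟨ρ, hρ, L, hL0, h⟩ := hL' z hz
  have hδ : 0 < min ρ (ε / (4 * L)) := by positivity
  refine ⟨D ∩ Metric.ball z (min ρ (ε / (4 * L))),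
    inter_mem_nhdsWithin _ (Metric.ball_mem_nhds z hδ), ?_⟩
  filter_upwards [h, Metric.tendsto_nhds.1 (hv z hz) (ε / 4) (by positivity)] with j hj hj2 y hy
  have hyd : dist y z ≤ ε / (4 * L) := ((Metric.mem_ball.1 hy.2).trans_le (min_le_right _ _)).le
  have hyρ : y ∈ Metric.ball z ρ :=
    Metric.ball_subset_ball (min_le_left _ _) hy.2
  have hb1 : L * dist y z ≤ ε / 4 := by
    rw [le_div_iff₀ (by positivity)] at hyd; linarith
  have e1 := hj y hyρ z (Metric.mem_ball_self hρ)
  have e2 : dist (v y) (v z) ≤ L * dist y z := by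
    refine le_of_tendsto ((hv y hy.1).dist (hv z hz)) ?_
    filter_upwards [h] with i hi
    exact hi y hyρ z (Metric.mem_ball_self hρ)
  have e3 := dist_triangle4 (v y) (v z) (u (σ j) z) (u (σ j) y)
  rw [dist_comm (v z)] at e3
  rw [dist_comm (u (σ j) y)] at e1
  linarith

/-- Boundedness turns spherical convergence into ordinary convergence. -/
lemma exists_differentiableOn_of_stereo_tendsto {h : ℕ → ℂ → ℂ} {B : Set ℂ} (hB : IsOpen B)
    {C : ℝ} (hd : ∀ j, DifferentiableOn ℂ (h j) B) (hC : ∀ j, ∀ z ∈ B, ‖h j z‖ ≤ C)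
    {v : ℂ → ℝ × ℂ} (hv : TendstoLocallyUniformlyOn (fun j z => stereo (h j z)) v atTop B) :
    ∃ g : ℂ → ℂ, DifferentiableOn ℂ g B ∧ ∀ z ∈ B, v z = stereo (g z) := by
  have hlim : ∀ z ∈ B, ∃ l, Tendsto (fun j => h j z) atTop (𝓝 l) := by
    intro z hz
    apply cauchySeq_tendsto_of_complete
    rw [Metric.cauchySeq_iff']
    intro ε hε
    have hcs := (hv.tendsto_at hz).cauchySeq
    rw [Metric.cauchySeq_iff'] at hcs
    obtain ⟨N, hN⟩ := hcs (ε / (2 * (1 + C ^ 2))) (by positivity)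
    refine ⟨N, fun j hj => ?_⟩
    have e := norm_sub_le_dist_stereo (hC j z hz) (hC N z hz)
    have e2 := hN j hj
    rw [lt_div_iff₀ (by positivity)] at e2
    rw [dist_eq_norm]
    linarith
  choose! g hg using hlim
  have hgC : ∀ z ∈ B, ‖g z‖ ≤ C := fun z hz =>
    le_of_tendsto (hg z hz).norm (Eventually.of_forall fun j => hC j z hz)
  have hgv : ∀ z ∈ B, v z = stereo (g z) := fun z hz =>
    tendsto_nhds_unique (hv.tendsto_at hz) ((continuous_stereo.tendsto _).comp (hg z hz))
  refine ⟨g, ?_, hgv⟩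
  have hunif : TendstoLocallyUniformlyOn h g atTop B := by
    rw [Metric.tendstoLocallyUniformlyOn_iff] at hv ⊢
    intro ε hε z hz
    obtain ⟨t, ht, hev⟩ := hv (ε / (2 * (1 + C ^ 2))) (by positivity) z hz
    refine ⟨t ∩ B, inter_mem ht self_mem_nhdsWithin, hev.mono fun j hj y hy => ?_⟩
    have e2 := hj y hy.1
    rw [hgv y hy.2, lt_div_iff₀ (by positivity)] at e2
    have e := norm_sub_le_dist_stereo (hgC y hy.2) (hC j y hy.2)
    rw [dist_eq_norm]
    linarith
  exact hunif.differentiableOn (Eventually.of_forall hd) hB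

/-- On `B`, the function `f` is bounded by `C`. -/
def BddOnSet (f : ℂ → ℂ) (B : Set ℂ) (C : ℝ) : Prop := ∀ w ∈ B, ¬ IsPoleAt f w ∧ ‖f w‖ ≤ C

/-- On `B`, the function `f` is bounded away from zero by `c`. -/
def BddBelowOnSet (f : ℂ → ℂ) (B : Set ℂ) (c : ℝ) : Prop := ∀ w ∈ B, IsPoleAt f w ∨ c ≤ ‖f w‖

/-- Eventually in `j`, the functions `f j` are locally bounded or locally bounded away from `0`. -/
def LocallyTame (f : ℕ → ℂ → ℂ) (D : Set ℂ) : Prop :=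
  ∀ z₀ ∈ D, ∃ ρ > 0, ∃ C > 0, Metric.ball z₀ ρ ⊆ D ∧ ∀ᶠ j in atTop,
    MeromorphicNiceOn (f j) (Metric.ball z₀ ρ) ∧
      (BddOnSet (f j) (Metric.ball z₀ ρ) C ∨ BddBelowOnSet (f j) (Metric.ball z₀ ρ) C⁻¹)

lemma BddOnSet.differentiableOn {f : ℂ → ℂ} {B : Set ℂ} {C : ℝ} (h : BddOnSet f B C)
    (hf : MeromorphicNiceOn f B) : DifferentiableOn ℂ f B := fun z hz =>
  (hf.analyticAt hz (h z hz).1).differentiableAt.differentiableWithinAt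

lemma BddOnSet.stereoFun_eq {f : ℂ → ℂ} {B : Set ℂ} {C : ℝ} (h : BddOnSet f B C) {z : ℂ}
    (hz : z ∈ B) : stereoFun f z = stereo (f z) := stereoFun_of_not_isPoleAt (h z hz).1

lemma BddBelowOnSet.isPoleAt_or_ne {f : ℂ → ℂ} {B : Set ℂ} {c : ℝ} (h : BddBelowOnSet f B c)
    (hc : 0 < c) {z : ℂ} (hz : z ∈ B) : IsPoleAt f z ∨ f z ≠ 0 :=
  (h z hz).imp_right fun h1 => norm_pos_iff.1 (hc.trans_le h1)

lemma BddBelowOnSet.differentiableOn {f : ℂ → ℂ} {B : Set ℂ} {c : ℝ} (h : BddBelowOnSet f B c)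
    (hc : 0 < c) (hf : MeromorphicNiceOn f B) : DifferentiableOn ℂ (sphInv f) B := fun z hz => by
  refine AnalyticAt.differentiableWithinAt ?_
  by_cases hp : IsPoleAt f z
  · exact analyticAt_sphInv_of_isPoleAt (hf.1 z hz) hp
  · exact analyticAt_sphInv_of_ne (hf.analyticAt hz hp)
      ((h.isPoleAt_or_ne hc hz).resolve_left hp)

lemma BddBelowOnSet.norm_sphInv_le {f : ℂ → ℂ} {B : Set ℂ} {C : ℝ} (h : BddBelowOnSet f B C⁻¹)
    (hC : 0 < C) {z : ℂ} (hz : z ∈ B) : ‖sphInv f z‖ ≤ C := by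
  by_cases hp : IsPoleAt f z
  · rw [sphInv, if_pos hp, norm_zero]; exact hC.le
  · rw [sphInv, if_neg hp, norm_inv]
    exact inv_le_of_inv_le₀ hC ((h z hz).resolve_left hp)

lemma BddBelowOnSet.stereoFun_eq {f : ℂ → ℂ} {B : Set ℂ} {c : ℝ} (h : BddBelowOnSet f B c)
    (hc : 0 < c) {z : ℂ} (hz : z ∈ B) : stereoFun f z = stereoInv (stereo (sphInv f z)) :=
  stereoFun_eq_stereoInv (h.isPoleAt_or_ne hc hz)

lemma LocallyTame.exists_lipschitz {f : ℕ → ℂ → ℂ} {D : Set ℂ} (hf : LocallyTame f D) :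
    ∀ z₀ ∈ D, ∃ ρ > 0, ∃ L : ℝ, ∀ᶠ j in atTop, ∀ z ∈ Metric.ball z₀ ρ,
      ∀ w ∈ Metric.ball z₀ ρ, dist (stereoFun (f j) z) (stereoFun (f j) w) ≤ L * dist z w := by
  intro z₀ hz₀
  obtain ⟨ρ, hρ, C, hC, -, h⟩ := hf z₀ hz₀
  refine ⟨ρ / 2, by positivity, C / (ρ / 4), h.mono ?_⟩
  rintro j ⟨hn, hj⟩ z hz w hw
  have hsub : Metric.ball z₀ (ρ / 2) ⊆ Metric.ball z₀ ρ :=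
    Metric.ball_subset_ball (by linarith)
  rw [dist_eq_norm z w]
  rcases hj with hj | hj
  · rw [hj.stereoFun_eq (hsub hz), hj.stereoFun_eq (hsub hw)]
    exact (dist_stereo_le _ _).trans
      (norm_sub_le_of_norm_le hρ (hj.differentiableOn hn) (fun z hz => (hj z hz).2) hz hw)
  · have hC' := inv_pos.2 hC
    rw [hj.stereoFun_eq hC' (hsub hz), hj.stereoFun_eq hC' (hsub hw), dist_stereoInv]
    exact (dist_stereo_le _ _).trans
      (norm_sub_le_of_norm_le hρ (hj.differentiableOn hC' hn)
        (fun z hz => hj.norm_sphInv_le hC hz) hz hw)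

lemma exists_local_limit {f : ℕ → ℂ → ℂ} {D : Set ℂ} (hf : LocallyTame f D)
    {v : ℂ → ℝ × ℂ} {σ : ℕ → ℕ} (hσ : StrictMono σ)
    (hv : TendstoLocallyUniformlyOn (fun j => stereoFun (f (σ j))) v atTop D)
    {z₀ : ℂ} (hz₀ : z₀ ∈ D) : ∃ h : ℂ → ℂ, AnalyticAt ℂ h z₀ ∧
      ((∀ᶠ z in 𝓝 z₀, v z = stereo (h z)) ∨ ∀ᶠ z in 𝓝 z₀, v z = stereoInv (stereo (h z))) := by
  obtain ⟨ρ, hρ, C, hC, hD, h⟩ := hf z₀ hz₀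
  have hC' := inv_pos.2 hC
  have hbn : Metric.ball z₀ ρ ∈ 𝓝 z₀ := Metric.ball_mem_nhds _ hρ
  have h2 := hσ.tendsto_atTop.eventually h
  have hor : (∃ᶠ j in atTop, MeromorphicNiceOn (f (σ j)) (Metric.ball z₀ ρ) ∧
      BddOnSet (f (σ j)) (Metric.ball z₀ ρ) C) ∨ (∃ᶠ j in atTop,
      MeromorphicNiceOn (f (σ j)) (Metric.ball z₀ ρ) ∧
        BddBelowOnSet (f (σ j)) (Metric.ball z₀ ρ) C⁻¹) := by
    rw [← frequently_or_distrib]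
    exact (h2.mono fun j hj => by tauto).frequently
  rcases hor with hfr | hfr
  · obtain ⟨τ, hτ, hall⟩ := extraction_of_frequently_atTop hfr
    have hv' : TendstoLocallyUniformlyOn (fun j z => stereo (f (σ (τ j)) z)) v atTop
        (Metric.ball z₀ ρ) := by
      rw [Metric.tendstoLocallyUniformlyOn_iff] at hv ⊢
      intro ε hε z hz
      obtain ⟨t, ht, hev⟩ := hv ε hε z (hD hz)
      refine ⟨t ∩ Metric.ball z₀ ρ, inter_mem (nhdsWithin_mono _ hD ht) self_mem_nhdsWithin, ?_⟩
      filter_upwards [hτ.tendsto_atTop.eventually hev] with j hj y hy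
      have := hj y hy.1
      rwa [(hall j).2.stereoFun_eq hy.2] at this
    obtain ⟨g, hg, hgv⟩ := exists_differentiableOn_of_stereo_tendsto Metric.isOpen_ball
      (fun j => (hall j).2.differentiableOn (hall j).1) (fun j z hz => ((hall j).2 z hz).2) hv'
    exact ⟨g, hg.analyticAt hbn, Or.inl (by filter_upwards [hbn] with z hz using hgv z hz)⟩
  · obtain ⟨τ, hτ, hall⟩ := extraction_of_frequently_atTop hfr
    have hv' : TendstoLocallyUniformlyOn (fun j z => stereo (sphInv (f (σ (τ j))) z))
        (fun z => stereoInv (v z)) atTop (Metric.ball z₀ ρ) := by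
      rw [Metric.tendstoLocallyUniformlyOn_iff] at hv ⊢
      intro ε hε z hz
      obtain ⟨t, ht, hev⟩ := hv ε hε z (hD hz)
      refine ⟨t ∩ Metric.ball z₀ ρ, inter_mem (nhdsWithin_mono _ hD ht) self_mem_nhdsWithin, ?_⟩
      filter_upwards [hτ.tendsto_atTop.eventually hev] with j hj y hy
      have := hj y hy.1
      rw [(hall j).2.stereoFun_eq hC' hy.2] at this
      rwa [← dist_stereoInv, stereoInv_stereoInv]
    obtain ⟨g, hg, hgv⟩ := exists_differentiableOn_of_stereo_tendsto Metric.isOpen_ball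
      (fun j => (hall j).2.differentiableOn hC' (hall j).1)
      (fun j z hz => (hall j).2.norm_sphInv_le hC hz) hv'
    refine ⟨g, hg.analyticAt hbn, Or.inr ?_⟩
    filter_upwards [hbn] with z hz
    rw [← hgv z hz, stereoInv_stereoInv]

lemma stereo_ne_zero (w : ℂ) : stereo w ≠ 0 := fun h =>
  (stereo_fst_pos w).ne' (by rw [h]; rfl)

lemma stereoInv_stereo_eq_zero {w : ℂ} : stereoInv (stereo w) = 0 ↔ w = 0 := by
  constructor
  · intro h
    by_contra hw
    rw [stereoInv_stereo hw] at h
    exact stereo_ne_zero _ h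
  · rintro rfl
    exact stereoInv_stereo_zero

/-- A sphere-valued map which is locally of the form `h` or `1 / h` is constantly `∞` or comes
from a meromorphic function. -/
theorem exists_meromorphicNiceOn {D : Set ℂ} (hDc : IsPreconnected D) {v : ℂ → ℝ × ℂ}
    (hv : ∀ z₀ ∈ D, ∃ h : ℂ → ℂ, AnalyticAt ℂ h z₀ ∧
      ((∀ᶠ z in 𝓝 z₀, v z = stereo (h z)) ∨ ∀ᶠ z in 𝓝 z₀, v z = stereoInv (stereo (h z)))) :
    (∀ z ∈ D, v z = 0) ∨ ∃ g : ℂ → ℂ, MeromorphicNiceOn g D ∧ ∀ z ∈ D, stereoFun g z = v z := by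
  set g : ℂ → ℂ := fun z => (v z).2 / ((v z).1 : ℂ) with hg
  have htri : ∀ z₀ ∈ D, (∀ᶠ z in 𝓝 z₀, v z = 0) ∨ ((∀ᶠ z in 𝓝[≠] z₀, v z ≠ 0) ∧
      MeromorphicAt g z₀ ∧ (ContinuousAt g z₀ ∨ IsPoleAt g z₀) ∧ stereoFun g z₀ = v z₀) := by
    have hA : ∀ z₀ (h : ℂ → ℂ), AnalyticAt ℂ h z₀ → (∀ᶠ z in 𝓝 z₀, v z = stereo (h z)) →
        ((∀ᶠ z in 𝓝[≠] z₀, v z ≠ 0) ∧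
      MeromorphicAt g z₀ ∧ (ContinuousAt g z₀ ∨ IsPoleAt g z₀) ∧ stereoFun g z₀ = v z₀) := by
      intro z₀ h hh hvh
      have hgh : h =ᶠ[𝓝 z₀] g := hvh.mono fun z hz => by
        simp only [hg]; rw [hz, stereo_snd_div_fst]
      have hga : AnalyticAt ℂ g z₀ := hh.congr hgh
      refine ⟨eventually_nhdsWithin_of_eventually_nhds (hvh.mono fun z hz => ?_),
        hga.meromorphicAt, Or.inl hga.continuousAt, ?_⟩
      · rw [hz]; exact stereo_ne_zero _
      · rw [stereoFun_of_not_isPoleAt (not_isPoleAt_of_continuousAt hga.continuousAt),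
          hvh.self_of_nhds, hgh.self_of_nhds]
    intro z₀ hz₀
    obtain ⟨h, hh, hvh | hvh⟩ := hv z₀ hz₀
    · exact Or.inr (hA z₀ h hh hvh)
    by_cases h0 : h z₀ = 0
    · rcases hh.eventually_eq_zero_or_eventually_ne_zero with he | hne
      · left
        filter_upwards [he, hvh] with z h1 h2
        rw [h2, h1, stereoInv_stereo_zero]
      · right
        have hgh : h⁻¹ =ᶠ[𝓝[≠] z₀] g := by
          filter_upwards [hne, eventually_nhdsWithin_of_eventually_nhds hvh] with z h1 h2
          simp only [hg]; rw [h2, stereoInv_stereo h1, stereo_snd_div_fst, Pi.inv_apply]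
        have hpole : IsPoleAt g z₀ := by
          refine IsPoleAt.congr (f := h⁻¹) ?_ hgh
          simp only [IsPoleAt, Pi.inv_apply, norm_inv]
          refine Tendsto.inv_tendsto_nhdsGT_zero ?_
          refine tendsto_nhdsWithin_iff.2 ⟨?_, hne.mono fun z hz => norm_pos_iff.2 hz⟩
          have := hh.continuousAt.norm.tendsto
          rw [h0, norm_zero] at this
          exact this.mono_left nhdsWithin_le_nhds
        refine ⟨?_, hh.meromorphicAt.inv.congr hgh, Or.inr hpole, ?_⟩
        · filter_upwards [hne, eventually_nhdsWithin_of_eventually_nhds hvh] with z h1 h2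
          rwa [h2, Ne, stereoInv_stereo_eq_zero]
        · rw [stereoFun_of_isPoleAt hpole, hvh.self_of_nhds, h0, stereoInv_stereo_zero]
    · right
      refine hA z₀ h⁻¹ (hh.inv h0) ?_
      filter_upwards [hvh, hh.continuousAt.eventually_ne h0] with z h1 h2
      rw [h1, stereoInv_stereo h2, Pi.inv_apply]
  have hE : IsOpen {z | ∀ᶠ w in 𝓝 z, v w = 0} := isOpen_setOfPred_eventually_nhds
  have hF : IsOpen {z | ∀ᶠ w in 𝓝[≠] z, v w ≠ 0} := by
    rw [isOpen_iff_mem_nhds]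
    intro z hz
    have hz' : ∀ᶠ y in 𝓝[≠] z, ∀ᶠ w in 𝓝[≠] z, v w ≠ 0 := Eventually.of_forall fun _ => hz
    have h1 := eventually_eventually_nhdsWithin.2 (show ∀ᶠ w in 𝓝[≠] z, v w ≠ 0 from hz)
    have h2 : ∀ᶠ y in 𝓝[≠] z, ∀ᶠ w in 𝓝[≠] y, v w ≠ 0 := by
      filter_upwards [h1, self_mem_nhdsWithin] with y hy hyz
      rw [isOpen_compl_singleton.nhdsWithin_eq hyz] at hy
      exact eventually_nhdsWithin_of_eventually_nhds hy
    rw [eventually_nhdsWithin_iff] at h2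
    filter_upwards [h2] with y hy
    by_cases hyz : y = z
    · rw [hyz]; exact hz
    · exact hy hyz
  have hdis : Disjoint {z | ∀ᶠ w in 𝓝 z, v w = 0} {z | ∀ᶠ w in 𝓝[≠] z, v w ≠ 0} := by
    rw [Set.disjoint_left]
    intro z h1 h2
    have h2' : ∀ᶠ w in 𝓝[≠] z, v w ≠ 0 := h2
    obtain ⟨w, hw1, hw2⟩ := (h2'.and (eventually_nhdsWithin_of_eventually_nhds h1)).exists
    exact hw1 hw2
  rcases IsPreconnected.subset_or_subset hE hF hdis
    (fun z hz => (htri z hz).imp id fun h => h.1) hDc with hsub | hsub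
  · left
    intro z hz
    have : ∀ᶠ w in 𝓝 z, v w = 0 := hsub hz
    exact this.self_of_nhds
  · right
    have hD : ∀ z ∈ D, MeromorphicAt g z ∧ (ContinuousAt g z ∨ IsPoleAt g z) ∧
        stereoFun g z = v z := fun z hz =>
      ((htri z hz).resolve_left fun h => Set.disjoint_left.1 hdis h (hsub hz)).2
    exact ⟨g, ⟨fun z hz => (hD z hz).1, fun z hz => (hD z hz).2.1⟩, fun z hz => (hD z hz).2.2⟩

/-- Locally tame sequences have convergent subsequences. -/
theorem LocallyTame.exists_subseq {f : ℕ → ℂ → ℂ} {D : Set ℂ} (hD : IsOpen D)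
    (hDc : IsPreconnected D) (hf : LocallyTame f D) : ∃ σ : ℕ → ℕ, StrictMono σ ∧
      ((∃ g : ℂ → ℂ, MeromorphicNiceOn g D ∧ ConvSphLocUnif (fun j => f (σ j)) g D) ∨
        ConvInftyLocUnif (fun j => f (σ j)) D) := by
  obtain ⟨σ, hσ, v, hv⟩ := exists_subseq_tendstoLocallyUniformlyOn
    (u := fun j => stereoFun (f j)) (fun j z => norm_stereoFun_le _ _) hf.exists_lipschitz
  refine ⟨σ, hσ, ?_⟩
  have hv' := (tendstoLocallyUniformlyOn_iff_forall_isCompact hD).1 hv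
  rcases exists_meromorphicNiceOn hDc (fun z hz => exists_local_limit hf hσ hv hz) with h0 | h1
  · right
    intro K hKD hK ε hε
    filter_upwards [Metric.tendstoUniformlyOn_iff.1 (hv' K hKD hK) (ε / 2) (by positivity)]
      with j hj z hz
    refine (sphDist_le_dist_stereo _ _).trans_lt ?_
    have := hj z hz
    rw [h0 z (hKD hz), dist_comm, stereoFun] at this
    rw [stereoSphere_infty]
    linarith
  · left
    obtain ⟨g, hg, hgv⟩ := h1
    refine ⟨g, hg, ?_⟩
    intro K hKD hK ε hε
    filter_upwards [Metric.tendstoUniformlyOn_iff.1 (hv' K hKD hK) (ε / 2) (by positivity)]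
      with j hj z hz
    refine (sphDist_le_dist_stereo _ _).trans_lt ?_
    have := hj z hz
    rw [← hgv z (hKD hz), dist_comm, stereoFun, stereoFun] at this
    linarith

/-- The rescaled function `ζ ↦ a f (x + r ζ)`. -/
def rescale (a x r : ℂ) (f : ℂ → ℂ) (ζ : ℂ) : ℂ := a * f (x + r * ζ)

lemma IsPoleAt.rescale {f : ℂ → ℂ} {a x r ζ : ℂ} (ha : a ≠ 0) (hr : r ≠ 0)
    (h : IsPoleAt f (x + r * ζ)) : IsPoleAt (rescale a x r f) ζ := by
  have h1 : Tendsto (fun w => x + r * w) (𝓝[≠] ζ) (𝓝[≠] (x + r * ζ)) := by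
    refine tendsto_nhdsWithin_iff.2 ⟨?_, ?_⟩
    · exact (Continuous.tendsto (by fun_prop) ζ).mono_left nhdsWithin_le_nhds
    · filter_upwards [self_mem_nhdsWithin] with w hw
      simpa [hr] using hw
  simp only [IsPoleAt, _root_.rescale, norm_mul]
  exact (h.comp h1).const_mul_atTop (norm_pos_iff.2 ha)

lemma isPoleAt_rescale {f : ℂ → ℂ} {a x r ζ : ℂ} (ha : a ≠ 0) (hr : r ≠ 0) :
    IsPoleAt (rescale a x r f) ζ ↔ IsPoleAt f (x + r * ζ) := by
  refine ⟨fun h => ?_, IsPoleAt.rescale ha hr⟩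
  have hf : rescale a⁻¹ (-x / r) r⁻¹ (rescale a x r f) = f := by
    funext w
    simp only [rescale]
    rw [inv_mul_cancel_left₀ ha]
    congr 1
    field_simp
    ring
  rw [← hf]
  refine IsPoleAt.rescale (inv_ne_zero ha) (inv_ne_zero hr) ?_
  convert h using 1
  field_simp
  ring

lemma MeromorphicNiceOn.rescale {f : ℂ → ℂ} {a x r : ℂ} {D B : Set ℂ} (ha : a ≠ 0) (hr : r ≠ 0)
    (hf : MeromorphicNiceOn f D) (hB : ∀ ζ ∈ B, x + r * ζ ∈ D) :
    MeromorphicNiceOn (rescale a x r f) B := by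
  refine ⟨fun ζ hζ => ?_, fun ζ hζ => ?_⟩
  · exact (MeromorphicAt.const a ζ).mul
      ((hf.1 _ (hB ζ hζ)).comp_analyticAt (g := fun ζ => x + r * ζ) (by fun_prop))
  · rcases hf.2 _ (hB ζ hζ) with h | h
    · left
      exact continuousAt_const.mul
        (ContinuousAt.comp (f := fun ζ => x + r * ζ) h (by fun_prop))
    · exact Or.inr (IsPoleAt.rescale ha hr h)

/-- `f` is tame at scale `t` near `z`. -/
def TameAt (k n : ℕ) (f : ℂ → ℂ) (z : ℂ) (t : ℝ) : Prop :=
  BddOnSet f (Metric.ball z (t ^ n)) (2 * t ^ k) ∨ BddBelowOnSet f (Metric.ball z (t ^ n)) (t ^ k)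

lemma not_tameAt {k n : ℕ} {f : ℂ → ℂ} {z : ℂ} {t : ℝ} (h : ¬ TameAt k n f z t) :
    (∃ w ∈ Metric.ball z (t ^ n), IsPoleAt f w ∨ 2 * t ^ k < ‖f w‖) ∧
      ∃ w ∈ Metric.ball z (t ^ n), ¬ IsPoleAt f w ∧ ‖f w‖ < t ^ k := by
  simp only [TameAt, BddOnSet, BddBelowOnSet, not_or] at h
  push Not at h
  obtain ⟨⟨w, hw, h1⟩, w', hw', h2⟩ := h
  exact ⟨⟨w, hw, by tauto⟩, w', hw', h2⟩

/-- At a point which is not a zero, `f` is locally bounded away from zero. -/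
lemma eventually_isPoleAt_or_le {f : ℂ → ℂ} {D : Set ℂ} {z : ℂ} (hf : MeromorphicNiceOn f D)
    (hz : z ∈ D) (h0 : IsPoleAt f z ∨ f z ≠ 0) :
    ∃ c > 0, ∀ᶠ w in 𝓝 z, IsPoleAt f w ∨ c ≤ ‖f w‖ := by
  by_cases hp : IsPoleAt f z
  · refine ⟨1, one_pos, ?_⟩
    have h1 : ∀ᶠ w in 𝓝[≠] z, 1 ≤ ‖f w‖ := hp.eventually_ge_atTop 1
    rw [eventually_nhdsWithin_iff] at h1
    filter_upwards [h1] with w hw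
    by_cases hwz : w = z
    · rw [hwz]; exact Or.inl hp
    · exact Or.inr (hw hwz)
  · have hne := norm_pos_iff.2 (h0.resolve_left hp)
    refine ⟨‖f z‖ / 2, by positivity, ?_⟩
    have hc := (hf.analyticAt hz hp).continuousAt.norm
    filter_upwards [hc.eventually_const_le (half_lt_self hne)] with w hw
    exact Or.inr hw

/-- A point-picking lemma. -/
theorem exists_maximal_nontame {k n : ℕ} (hk : 1 ≤ k) (hkn : k < n) {f : ℂ → ℂ} {z₀ : ℂ}
    {t₀ N R : ℝ} (ht₀ : 0 < t₀) (hN : 0 < N) (hR : 2 * N * t₀ ^ n ≤ R)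
    (hf : MeromorphicNiceOn f (Metric.closedBall z₀ R)) (hnt : ¬ TameAt k n f z₀ t₀) :
    ∃ x t, 0 < t ∧ t ≤ t₀ ∧ dist x z₀ ≤ 2 * N * t₀ ^ n ∧ ¬ TameAt k n f x t ∧
      ∀ y ∈ Metric.ball x (N * t ^ n), TameAt k n f y (t / 2) := by
  by_contra! hcon
  have hhalf : ((1:ℝ) / 2) ^ n ≤ 1 / 2 := pow_le_of_le_one (by norm_num) (by norm_num) (by omega)
  set q : ℝ := (1 / 2) ^ n with hq
  have hq0 : 0 < q := by positivity
  set T : ℕ → ℝ := fun i => t₀ * (1 / 2) ^ i with hT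
  have hTpos : ∀ i, 0 < T i := fun i => by positivity
  have hTle : ∀ i, T i ≤ t₀ := fun i =>
    mul_le_of_le_one_right ht₀.le (pow_le_one₀ (by norm_num) (by norm_num))
  have hTs : ∀ i, T (i + 1) = T i / 2 := fun i => by simp only [hT, pow_succ]; ring
  have hTn : ∀ i, T i ^ n = t₀ ^ n * q ^ i := fun i => by
    simp only [hT, hq]; rw [mul_pow, ← pow_mul, ← pow_mul, mul_comm i]
  let S : ℕ → Type := fun i =>
    {x : ℂ // dist x z₀ ≤ 2 * N * (t₀ ^ n - T i ^ n) ∧ ¬ TameAt k n f x (T i)}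
  have step : ∀ i (s : S i), ∃ s' : S (i + 1), dist s.1 s'.1 ≤ N * T i ^ n := by
    rintro i ⟨x, hx, hxt⟩
    have hTn0 : 0 < T i ^ n := pow_pos (hTpos i) n
    obtain ⟨y, hy, hyt⟩ := hcon x (T i) (hTpos i) (hTle i) (hx.trans (by nlinarith)) hxt
    rw [Metric.mem_ball] at hy
    refine ⟨⟨y, ?_, by rwa [hTs]⟩, by rw [dist_comm]; exact hy.le⟩
    have e : T (i + 1) ^ n = T i ^ n * q := by rw [hTn, hTn]; ring
    rw [e]
    have := dist_triangle y x z₀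
    have e2 : N * (T i ^ n * q) ≤ N * (T i ^ n * (1 / 2)) := by gcongr
    linarith
  choose nxt hnxt using step
  let s : ∀ i, S i := fun i => Nat.rec (motive := S)
    ⟨z₀, by simp [hT], by simpa [hT] using hnt⟩ (fun i s => nxt i s) i
  have hs : ∀ i, dist (s i).1 (s (i + 1)).1 ≤ N * t₀ ^ n * q ^ i := fun i => by
    refine (hnxt i (s i)).trans_eq ?_
    rw [hTn, mul_assoc]
  have hq1 : q < 1 := by linarith
  obtain ⟨X, hX⟩ := cauchySeq_tendsto_of_complete (cauchySeq_of_le_geometric q _ hq1 hs)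
  have hdX : ∀ i, dist (s i).1 X ≤ 2 * N * T i ^ n := fun i => by
    refine (dist_le_of_le_geometric_of_tendsto q _ hq1 hs hX i).trans ?_
    rw [mul_assoc N, ← hTn, div_le_iff₀ (by linarith)]
    have : 0 < N * T i ^ n := mul_pos hN (pow_pos (hTpos i) n)
    nlinarith
  have hXR : X ∈ Metric.closedBall z₀ R := by
    refine Metric.isClosed_closedBall.mem_of_tendsto hX (Eventually.of_forall fun i => ?_)
    refine (s i).2.1.trans (le_trans ?_ hR)
    have := pow_pos (hTpos i) n
    nlinarith
  have hT0 : Tendsto T atTop (𝓝 0) := by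
    have := (tendsto_pow_atTop_nhds_zero_of_lt_one (r := (1:ℝ) / 2) (by norm_num)
      (by norm_num)).const_mul t₀
    simpa [hT] using this
  have hTn0 : Tendsto (fun i => T i ^ n) atTop (𝓝 0) := by
    simpa [show n ≠ 0 by omega] using hT0.pow n
  choose w hw using fun i => (not_tameAt (s i).2.2).1
  choose w' hw' using fun i => (not_tameAt (s i).2.2).2
  have hclose : ∀ y : ℕ → ℂ, (∀ i, y i ∈ Metric.ball (s i).1 (T i ^ n)) →
      ∀ i, dist (y i) X ≤ (2 * N + 1) * T i ^ n := by
    intro y hy i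
    have := dist_triangle (y i) (s i).1 X
    have h2 := hy i
    rw [Metric.mem_ball] at h2
    linarith [hdX i]
  have hclose0 : Tendsto (fun i => (2 * N + 1) * T i ^ n) atTop (𝓝 0) := by
    simpa using hTn0.const_mul (2 * N + 1)
  have hwX : Tendsto w atTop (𝓝 X) := tendsto_iff_dist_tendsto_zero.2
    (squeeze_zero (fun _ => dist_nonneg) (hclose w fun i => (hw i).1) hclose0)
  have hwX' : Tendsto w' atTop (𝓝 X) := tendsto_iff_dist_tendsto_zero.2
    (squeeze_zero (fun _ => dist_nonneg) (hclose w' fun i => (hw' i).1) hclose0)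
  by_cases h0 : IsPoleAt f X ∨ f X ≠ 0
  · obtain ⟨c, hc, hev⟩ := eventually_isPoleAt_or_le hf hXR h0
    have hTk0 : Tendsto (fun i => T i ^ k) atTop (𝓝 0) := by
      simpa [show k ≠ 0 by omega] using hT0.pow k
    obtain ⟨i, hi1, hi2⟩ := ((hwX'.eventually hev).and (hTk0.eventually_lt_const hc)).exists
    have := hi1.resolve_left (hw' i).2.1
    linarith [(hw' i).2.2]
  · push Not at h0
    have hfa := hf.analyticAt hXR h0.1
    have hO := hfa.differentiableAt.isBigO_sub
    obtain ⟨M, hM0, hM⟩ := hO.exists_pos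
    rw [Asymptotics.IsBigOWith] at hM
    have hTnk : Tendsto (fun i => M * (2 * N + 1) * T i ^ (n - k)) atTop (𝓝 0) := by
      simpa [show n - k ≠ 0 by omega] using (hT0.pow (n - k)).const_mul (M * (2 * N + 1))
    have hnp : ∀ᶠ y in 𝓝 X, ¬ IsPoleAt f y := hfa.eventually_analyticAt.mono
      fun y hy => not_isPoleAt_of_continuousAt hy.continuousAt
    obtain ⟨i, ⟨hi1, hi2⟩, hi3⟩ := (((hwX.eventually hM).and (hwX.eventually hnp)).and
      (hTnk.eventually_lt_const one_pos)).exists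
    rw [h0.2, sub_zero, ← dist_eq_norm] at hi1
    have e1 := (hw i).2.resolve_left hi2
    have e2 := hclose w (fun i => (hw i).1) i
    have e3 : T i ^ n = T i ^ (n - k) * T i ^ k := by rw [← pow_add]; congr 1; omega
    have e4 : 0 < T i ^ k := pow_pos (hTpos i) k
    have e5 : M * dist (w i) X ≤ M * ((2 * N + 1) * T i ^ n) := by gcongr
    rw [e3] at e5
    nlinarith

lemma BddOnSet.mono {f : ℂ → ℂ} {B B' : Set ℂ} {C C' : ℝ} (h : BddOnSet f B C) (hB : B' ⊆ B)
    (hC : C ≤ C') : BddOnSet f B' C' := fun w hw => ⟨(h w (hB hw)).1, (h w (hB hw)).2.trans hC⟩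

lemma BddBelowOnSet.mono {f : ℂ → ℂ} {B B' : Set ℂ} {c c' : ℝ} (h : BddBelowOnSet f B c)
    (hB : B' ⊆ B) (hc : c' ≤ c) : BddBelowOnSet f B' c' := fun w hw =>
  (h w (hB hw)).imp_right hc.trans

lemma locallyTame_of_tameAt {k n : ℕ} {f : ℕ → ℂ → ℂ} {D : Set ℂ} (hD : IsOpen D)
    (hf : ∀ j, MeromorphicNiceOn (f j) D)
    (h : ∀ z₀ ∈ D, ∃ t > 0, ∀ᶠ j in atTop, TameAt k n (f j) z₀ t) : LocallyTame f D := by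
  intro z₀ hz₀
  obtain ⟨t, ht, hev⟩ := h z₀ hz₀
  obtain ⟨R, hR, hRD⟩ := Metric.isOpen_iff.1 hD z₀ hz₀
  have htk : 0 < t ^ k := pow_pos ht k
  have htn : 0 < t ^ n := pow_pos ht n
  have hsub1 : Metric.ball z₀ (min R (t ^ n)) ⊆ Metric.ball z₀ R :=
    Metric.ball_subset_ball (min_le_left _ _)
  have hsub2 : Metric.ball z₀ (min R (t ^ n)) ⊆ Metric.ball z₀ (t ^ n) :=
    Metric.ball_subset_ball (min_le_right _ _)
  refine ⟨min R (t ^ n), lt_min hR htn, max (2 * t ^ k) (t ^ k)⁻¹, by positivity,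
    hsub1.trans hRD, ?_⟩
  filter_upwards [hev] with j hj
  refine ⟨(hf j).mono (hsub1.trans hRD), hj.imp (fun h => ?_) fun h => ?_⟩
  · exact h.mono hsub2 (le_max_left _ _)
  · exact h.mono hsub2 (inv_le_of_inv_le₀ htk (le_max_right _ _))

lemma TameAt.rescale {k n : ℕ} {f : ℂ → ℂ} {x ζ₀ : ℂ} {t : ℝ} (ht : 0 < t)
    (h : TameAt k n f (x + ((t ^ n : ℝ) : ℂ) * ζ₀) (t / 2)) :
    BddOnSet (rescale ((t ^ k : ℝ) : ℂ)⁻¹ x ((t ^ n : ℝ) : ℂ) f) (Metric.ball ζ₀ ((1 / 2) ^ n))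
      (2 * 2 ^ k) ∨ BddBelowOnSet (rescale ((t ^ k : ℝ) : ℂ)⁻¹ x ((t ^ n : ℝ) : ℂ) f)
        (Metric.ball ζ₀ ((1 / 2) ^ n)) (2 * 2 ^ k)⁻¹ := by
  have htk : 0 < t ^ k := pow_pos ht k
  have htn : 0 < t ^ n := pow_pos ht n
  have ha : ((t ^ k : ℝ) : ℂ)⁻¹ ≠ 0 := inv_ne_zero (Complex.ofReal_ne_zero.2 htk.ne')
  have hr : ((t ^ n : ℝ) : ℂ) ≠ 0 := Complex.ofReal_ne_zero.2 htn.ne'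
  have hmem : ∀ ζ ∈ Metric.ball ζ₀ ((1 / 2) ^ n),
      x + ((t ^ n : ℝ) : ℂ) * ζ ∈ Metric.ball (x + ((t ^ n : ℝ) : ℂ) * ζ₀) ((t / 2) ^ n) := by
    intro ζ hζ
    rw [Metric.mem_ball, dist_eq_norm] at *
    rw [add_sub_add_left_eq_sub, ← mul_sub, norm_mul, Complex.norm_real, Real.norm_eq_abs,
      abs_of_pos htn, div_eq_mul_one_div t 2, mul_pow]
    gcongr
  have hnorm : ∀ ζ, ‖_root_.rescale ((t ^ k : ℝ) : ℂ)⁻¹ x ((t ^ n : ℝ) : ℂ) f ζ‖ =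
      (t ^ k)⁻¹ * ‖f (x + ((t ^ n : ℝ) : ℂ) * ζ)‖ := fun ζ => by
    rw [_root_.rescale, norm_mul, norm_inv, Complex.norm_real, Real.norm_eq_abs, abs_of_pos htk]
  have h2k : (1 : ℝ) ≤ 2 ^ k := one_le_pow₀ (by norm_num)
  have hdiv : (t ^ k)⁻¹ * (t / 2) ^ k = (2 ^ k)⁻¹ := by
    rw [div_pow]; field_simp
  have h2k' : ((2:ℝ) ^ k)⁻¹ ≤ 1 := inv_le_one_of_one_le₀ h2k
  refine h.imp (fun h ζ hζ => ?_) fun h ζ hζ => ?_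
  · obtain ⟨h1, h2⟩ := h _ (hmem ζ hζ)
    refine ⟨by rwa [isPoleAt_rescale ha hr], ?_⟩
    rw [hnorm]
    calc (t ^ k)⁻¹ * ‖f (x + ((t ^ n : ℝ) : ℂ) * ζ)‖ ≤ (t ^ k)⁻¹ * (2 * (t / 2) ^ k) := by gcongr
      _ = 2 * (2 ^ k)⁻¹ := by rw [← hdiv]; ring
      _ ≤ 2 * 2 ^ k := by linarith
  · refine (h _ (hmem ζ hζ)).imp (fun h => ?_) fun h => ?_
    · rwa [isPoleAt_rescale ha hr]
    · rw [hnorm]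
      calc (2 * 2 ^ k : ℝ)⁻¹ ≤ (2 ^ k)⁻¹ := by gcongr; linarith
        _ = (t ^ k)⁻¹ * (t / 2) ^ k := hdiv.symm
        _ ≤ _ := by gcongr

/-- A rescaling lemma of Zalcman–Pang type. -/
theorem exists_rescaled_limit {k n : ℕ} (hk : 1 ≤ k) (hkn : k < n) {f : ℕ → ℂ → ℂ} {D : Set ℂ}
    (hD : IsOpen D) (hf : ∀ j, MeromorphicNiceOn (f j) D) {z₀ : ℂ} (hz₀ : z₀ ∈ D)
    (hnt : ∀ t > 0, ∃ᶠ j in atTop, ¬ TameAt k n (f j) z₀ t) :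
    ∃ σ : ℕ → ℕ, StrictMono σ ∧ ∃ x : ℕ → ℂ, ∃ t : ℕ → ℝ, (∀ j, 0 < t j) ∧
      Tendsto x atTop (𝓝 z₀) ∧ Tendsto t atTop (𝓝 0) ∧ ∃ g : ℂ → ℂ, MeromorphicNiceOn g univ ∧
      ConvSphLocUnif (fun j => rescale ((t j ^ k : ℝ) : ℂ)⁻¹ (x j) ((t j ^ n : ℝ) : ℂ) (f (σ j)))
        g univ ∧ ¬ ∃ p, ∀ z, stereoFun g z = p := by
  have hn0 : n ≠ 0 := by omega
  obtain ⟨R, hR, hRD⟩ := Metric.nhds_basis_closedBall.mem_iff.1 (hD.mem_nhds hz₀)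
  set M : ℕ → ℝ := fun N => (N : ℝ) + 1 with hM
  have hM1 : ∀ N, 1 ≤ M N := fun N => by simp [hM]
  set s : ℕ → ℝ := fun N => min R 1 / (2 * M N ^ 2) with hs
  have hs0 : ∀ N, 0 < s N := fun N => by have := hM1 N; positivity
  have hsM : ∀ N, 2 * M N * s N = min R 1 / M N := fun N => by
    have := hM1 N; simp only [hs]; field_simp
  have hsle : ∀ N, s N ≤ 1 / M N := fun N => by
    have h1 := hM1 N
    have h2 : min R 1 / M N ≤ 1 / M N := by gcongr; exact min_le_right _ _
    have h3 := hsM N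
    nlinarith [hs0 N]
  have hs1 : ∀ N, s N ≤ 1 := fun N => (hsle N).trans (by
    rw [div_le_one (by linarith [hM1 N])]; exact hM1 N)
  have hsn : ∀ N, 2 * M N * s N ^ n ≤ min R 1 / M N := fun N => by
    rw [← hsM]
    have := hM1 N
    gcongr
    exact pow_le_of_le_one (hs0 N).le (hs1 N) hn0
  have hsR : ∀ N, 2 * M N * s N ^ n ≤ R := fun N =>
    ((hsn N).trans (div_le_self (by positivity) (hM1 N))).trans (min_le_left _ _)
  obtain ⟨σ, hσ, hσnt⟩ := extraction_forall_of_frequently fun N => hnt (s N) (hs0 N)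
  choose x t ht0 hts hxd hxt hmax using fun N => exists_maximal_nontame hk hkn (hs0 N)
    (zero_lt_one.trans_le (hM1 N)) (hsR N) ((hf (σ N)).mono hRD) (hσnt N)
  have hMinv : Tendsto (fun N => 1 / M N) atTop (𝓝 0) := tendsto_one_div_add_atTop_nhds_zero_nat
  have hx : Tendsto x atTop (𝓝 z₀) := by
    rw [tendsto_iff_dist_tendsto_zero]
    refine squeeze_zero (fun _ => dist_nonneg) (fun N => (hxd N).trans ((hsn N).trans ?_)) hMinv
    have := hM1 N
    gcongr
    exact min_le_right _ _
  have ht : Tendsto t atTop (𝓝 0) :=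
    squeeze_zero (fun N => (ht0 N).le) (fun N => (hts N).trans (hsle N)) hMinv
  set G : ℕ → ℂ → ℂ := fun j =>
    rescale ((t j ^ k : ℝ) : ℂ)⁻¹ (x j) ((t j ^ n : ℝ) : ℂ) (f (σ j)) with hG
  have hane : ∀ j, ((t j ^ k : ℝ) : ℂ)⁻¹ ≠ 0 := fun j =>
    inv_ne_zero (Complex.ofReal_ne_zero.2 (pow_pos (ht0 j) k).ne')
  have hrne : ∀ j, ((t j ^ n : ℝ) : ℂ) ≠ 0 := fun j =>
    Complex.ofReal_ne_zero.2 (pow_pos (ht0 j) n).ne'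
  have htame : LocallyTame G univ := by
    intro ζ₀ _
    refine ⟨(1 / 2) ^ n, by positivity, 2 * 2 ^ k, by positivity, subset_univ _, ?_⟩
    have hNlim : Tendsto M atTop atTop :=
      tendsto_atTop_add_const_right _ _ tendsto_natCast_atTop_atTop
    have hxr : Tendsto (fun j => dist (x j) z₀ + t j ^ n * (‖ζ₀‖ + 1)) atTop (𝓝 0) := by
      have := (tendsto_iff_dist_tendsto_zero.1 hx).add ((ht.pow n).mul_const (‖ζ₀‖ + 1))
      simpa [hn0] using this
    filter_upwards [hNlim.eventually_gt_atTop ‖ζ₀‖, hxr.eventually_lt_const hR] with j hj hjR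
    have htn := pow_pos (ht0 j) n
    refine ⟨(hf (σ j)).rescale (hane j) (hrne j) fun ζ hζ => hRD ?_,
      (hmax j _ ?_).rescale (ht0 j)⟩
    · have h1 : ‖ζ‖ ≤ ‖ζ₀‖ + 1 := by
        rw [Metric.mem_ball, dist_eq_norm] at hζ
        have h2 : ((1:ℝ) / 2) ^ n ≤ 1 := pow_le_one₀ (by norm_num) (by norm_num)
        have := norm_sub_norm_le ζ ζ₀
        linarith
      rw [Metric.mem_closedBall, dist_eq_norm]
      calc ‖x j + ((t j ^ n : ℝ) : ℂ) * ζ - z₀‖ = ‖(x j - z₀) + ((t j ^ n : ℝ) : ℂ) * ζ‖ := by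
            congr 1; ring
        _ ≤ ‖x j - z₀‖ + ‖((t j ^ n : ℝ) : ℂ) * ζ‖ := norm_add_le _ _
        _ = dist (x j) z₀ + t j ^ n * ‖ζ‖ := by
            rw [norm_mul, Complex.norm_real, Real.norm_eq_abs, abs_of_pos htn, dist_eq_norm]
        _ ≤ dist (x j) z₀ + t j ^ n * (‖ζ₀‖ + 1) := by gcongr
        _ ≤ R := hjR.le
    · rw [Metric.mem_ball, dist_eq_norm, add_sub_cancel_left, norm_mul, Complex.norm_real,
        Real.norm_eq_abs, abs_of_pos htn, mul_comm]
      gcongr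
  have hclose : ∀ (τ : ℕ → ℕ) (F : ℂ → ℝ × ℂ) (p : ℝ × ℂ), (∀ ε > 0, ∀ᶠ j in atTop,
      ∀ ζ ∈ Metric.closedBall (0 : ℂ) 1, dist (stereoFun (G (τ j)) ζ) (F ζ) < ε) →
      ¬ ∀ ζ, F ζ = p := by
    intro τ F p hF hp
    obtain ⟨j, hj⟩ := (hF (1 / 10) (by norm_num)).exists
    have hpt : ∀ w ∈ Metric.ball (x (τ j)) (t (τ j) ^ n), ∃ ζ ∈ Metric.closedBall (0:ℂ) 1,
        w = x (τ j) + ((t (τ j) ^ n : ℝ) : ℂ) * ζ := by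
      intro w hw
      have htn := pow_pos (ht0 (τ j)) n
      refine ⟨(w - x (τ j)) / ((t (τ j) ^ n : ℝ) : ℂ), ?_, ?_⟩
      · rw [mem_closedBall_zero_iff, norm_div, Complex.norm_real, Real.norm_eq_abs,
          abs_of_pos htn, div_le_one htn, ← dist_eq_norm]
        exact (Metric.mem_ball.1 hw).le
      · rw [mul_div_cancel₀ _ (hrne _)]; ring
    have hnorm : ∀ ζ, ‖G (τ j) ζ‖ =
        ‖f (σ (τ j)) (x (τ j) + ((t (τ j) ^ n : ℝ) : ℂ) * ζ)‖ / t (τ j) ^ k := fun ζ => by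
      simp only [hG]
      rw [rescale, norm_mul, norm_inv, Complex.norm_real, Real.norm_eq_abs,
        abs_of_pos (pow_pos (ht0 (τ j)) k), inv_mul_eq_div]
    have hfst : ∀ a b : ℝ × ℂ, dist a b < 1 / 10 → |a.1 - b.1| < 1 / 10 := fun a b h => by
      rw [← Real.dist_eq]; exact (le_max_left _ _).trans_lt h
    obtain ⟨⟨w, hw, hwb⟩, w', hw', hwp, hwb'⟩ := not_tameAt (hxt (τ j))
    obtain ⟨ζ, hζ, rfl⟩ := hpt w hw
    obtain ⟨ζ', hζ', rfl⟩ := hpt w' hw'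
    have htk := pow_pos (ht0 (τ j)) k
    have e1 := abs_lt.1 (hfst _ _ (hj ζ hζ))
    have e2 := abs_lt.1 (hfst _ _ (hj ζ' hζ'))
    rw [hp] at e1 e2
    have b1 : (stereoFun (G (τ j)) ζ).1 ≤ 1 / 5 := by
      by_cases hpo : IsPoleAt (G (τ j)) ζ
      · rw [stereoFun_of_isPoleAt hpo]; norm_num
      · have h1 := hwb.resolve_left (by rwa [← isPoleAt_rescale (hane _) (hrne _)])
        have h2 : 2 < ‖G (τ j) ζ‖ := by rw [hnorm, lt_div_iff₀ htk]; exact h1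
        rw [stereoFun_of_not_isPoleAt hpo, stereo]
        simp only
        gcongr
        nlinarith
    have b2 : 1 / 2 ≤ (stereoFun (G (τ j)) ζ').1 := by
      have hpo : ¬ IsPoleAt (G (τ j)) ζ' := by rwa [isPoleAt_rescale (hane _) (hrne _)]
      have h2 : ‖G (τ j) ζ'‖ < 1 := by rw [hnorm, div_lt_one htk]; exact hwb'
      rw [stereoFun_of_not_isPoleAt hpo, stereo]
      simp only
      gcongr
      nlinarith [norm_nonneg (G (τ j) ζ')]
    linarith [e1.1, e1.2, e2.1, e2.2]
  obtain ⟨τ, hτ, ⟨g, hg, hconv⟩ | hconv⟩ := htame.exists_subseq isOpen_univ isPreconnected_univ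
  · refine ⟨σ ∘ τ, hσ.comp hτ, x ∘ τ, t ∘ τ, fun j => ht0 _, hx.comp hτ.tendsto_atTop,
      ht.comp hτ.tendsto_atTop, g, hg, hconv, ?_⟩
    rintro ⟨p, hp⟩
    refine hclose τ (stereoFun g) p (fun ε hε => ?_) hp
    filter_upwards [hconv _ (subset_univ _) (isCompact_closedBall 0 1) ε hε] with j hj ζ hζ
    exact (dist_stereo_le_sphDist _ _).trans_lt (hj ζ hζ)
  · refine absurd (fun _ => rfl) (hclose τ (fun _ => 0) 0 fun ε hε => ?_)
    filter_upwards [hconv _ (subset_univ _) (isCompact_closedBall 0 1) ε hε] with j hj ζ hζ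
    refine lt_of_le_of_lt ?_ (hj ζ hζ)
    have := dist_stereo_le_sphDist (toSphere (G (τ j)) ζ) OnePoint.infty
    rwa [stereoSphere_infty] at this

/-- Spherical convergence is ordinary uniform convergence near points which are not poles. -/
lemma ConvSphLocUnif.exists_tendstoUniformlyOn {G : ℕ → ℂ → ℂ} {g : ℂ → ℂ} {D : Set ℂ}
    (hD : IsOpen D) (h : ConvSphLocUnif G g D) (hg : MeromorphicNiceOn g D) {ζ₀ : ℂ}
    (hζ₀ : ζ₀ ∈ D) (hp : ¬ IsPoleAt g ζ₀) :
    ∃ ρ > 0, (∀ᶠ j in atTop, ∀ ζ ∈ Metric.ball ζ₀ ρ, ¬ IsPoleAt (G j) ζ) ∧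
      TendstoUniformlyOn G g atTop (Metric.ball ζ₀ ρ) ∧
      DifferentiableOn ℂ g (Metric.ball ζ₀ ρ) := by
  have hga := hg.analyticAt hζ₀ hp
  have hev : ∀ᶠ ζ in 𝓝 ζ₀, ζ ∈ D ∧ AnalyticAt ℂ g ζ ∧ ‖g ζ‖ < ‖g ζ₀‖ + 1 :=
    (hD.eventually_mem hζ₀).and (hga.eventually_analyticAt.and
      (hga.continuousAt.norm.eventually_lt_const (lt_add_one _)))
  obtain ⟨ρ, hρ, hball⟩ := Metric.nhds_basis_closedBall.eventually_iff.1 hev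
  have hsub : Metric.ball ζ₀ ρ ⊆ Metric.closedBall ζ₀ ρ := Metric.ball_subset_closedBall
  set M := ‖g ζ₀‖ + 1 with hM
  have hM0 : 0 ≤ M := by positivity
  set C : ℝ := 2 * (1 + M ^ 2) with hC
  have hMC : M ≤ C := by nlinarith [sq_nonneg (M - 1)]
  have hC1 : 1 ≤ C := by nlinarith
  have hdist : ∀ ε > 0, ∀ᶠ j in atTop, ∀ ζ ∈ Metric.ball ζ₀ ρ,
      dist (stereoFun (G j) ζ) (stereo (g ζ)) < ε := by
    intro ε hε
    filter_upwards [h _ (fun ζ hζ => (hball hζ).1) (isCompact_closedBall ζ₀ ρ) ε hε] with j hj ζ hζ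
    rw [← stereoFun_of_not_isPoleAt
      (not_isPoleAt_of_continuousAt (hball (hsub hζ)).2.1.continuousAt)]
    exact (dist_stereo_le_sphDist _ _).trans_lt (hj ζ (hsub hζ))
  have hbd : ∀ᶠ j in atTop, ∀ ζ ∈ Metric.ball ζ₀ ρ, ¬ IsPoleAt (G j) ζ ∧ ‖G j ζ‖ ≤ C := by
    filter_upwards [hdist C⁻¹ (by positivity)] with j hj ζ hζ
    have h1 : |(stereoFun (G j) ζ).1 - (stereo (g ζ)).1| < C⁻¹ := by
      rw [← Real.dist_eq]; exact (le_max_left _ _).trans_lt (hj ζ hζ)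
    have h2 : 2 * C⁻¹ ≤ (stereo (g ζ)).1 := by
      have e : 2 * C⁻¹ = 1 / (1 + M ^ 2) := by rw [hC]; field_simp
      rw [e, stereo]
      have := (hball (hsub hζ)).2.2.le
      simp only
      gcongr
    have h3 : C⁻¹ < (stereoFun (G j) ζ).1 := by linarith [(abs_lt.1 h1).1]
    have hnp : ¬ IsPoleAt (G j) ζ := by
      intro hpo
      rw [stereoFun_of_isPoleAt hpo] at h3
      have : 0 < C⁻¹ := by positivity
      exact absurd h3 (not_lt.2 this.le)
    refine ⟨hnp, ?_⟩
    rw [stereoFun_of_not_isPoleAt hnp, stereo] at h3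
    simp only at h3
    rw [inv_eq_one_div, one_div_lt_one_div (by positivity) (by positivity)] at h3
    nlinarith [norm_nonneg (G j ζ)]
  refine ⟨ρ, hρ, hbd.mono fun j hj ζ hζ => (hj ζ hζ).1, ?_, fun ζ hζ =>
    (hball (hsub hζ)).2.1.differentiableAt.differentiableWithinAt⟩
  rw [Metric.tendstoUniformlyOn_iff]
  intro ε hε
  filter_upwards [hdist (ε / (2 * (1 + C ^ 2))) (by positivity), hbd] with j h1 h2 ζ hζ
  have e1 := h1 ζ hζ
  obtain ⟨e2, e3⟩ := h2 ζ hζ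
  rw [stereoFun_of_not_isPoleAt e2, lt_div_iff₀ (by positivity)] at e1
  have e4 := norm_sub_le_dist_stereo e3 ((hball (hsub hζ)).2.2.le.trans hMC)
  rw [dist_comm, dist_eq_norm]
  linarith

lemma tendstoLocallyUniformlyOn_iterate_deriv {F : ℕ → ℂ → ℂ} {Q : ℂ → ℂ} {B : Set ℂ}
    (hB : IsOpen B) (hF : TendstoLocallyUniformlyOn F Q atTop B)
    (hd : ∀ᶠ j in atTop, DifferentiableOn ℂ (F j) B) (i : ℕ) :
    TendstoLocallyUniformlyOn (fun j => deriv^[i] (F j)) (deriv^[i] Q) atTop B ∧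
      ∀ᶠ j in atTop, DifferentiableOn ℂ (deriv^[i] (F j)) B := by
  induction i with
  | zero => exact ⟨hF, hd⟩
  | succ i ih =>
    simp only [Function.iterate_succ_apply']
    exact ⟨ih.1.deriv ih.2 hB, ih.2.mono fun j hj => hj.deriv hB⟩

/-- Hurwitz's theorem: zeros of the limit are limits of zeros. -/
theorem eventually_exists_zero {F : ℕ → ℂ → ℂ} {Q : ℂ → ℂ} {B : Set ℂ}
    (hB : IsOpen B) (hF : TendstoLocallyUniformlyOn F Q atTop B)
    (hd : ∀ᶠ j in atTop, DifferentiableOn ℂ (F j) B) {ζ₀ : ℂ} (hζ₀ : ζ₀ ∈ B) (h0 : Q ζ₀ = 0)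
    (hne : ∀ᶠ ζ in 𝓝[≠] ζ₀, Q ζ ≠ 0) {t : Set ℂ} (ht : t ∈ 𝓝 ζ₀) :
    ∀ᶠ j in atTop, ∃ ζ ∈ t, F j ζ = 0 := by
  have hQ : ContinuousOn Q B := (hF.differentiableOn hd hB).continuousOn
  rw [eventually_nhdsWithin_iff] at hne
  obtain ⟨r, hr, hball⟩ := Metric.nhds_basis_closedBall.eventually_iff.1
    ((hB.eventually_mem hζ₀).and (hne.and ((show ∀ᶠ ζ in 𝓝 ζ₀, ζ ∈ t from ht))))
  have hsB : Metric.sphere ζ₀ r ⊆ B := fun z hz => (hball (Metric.sphere_subset_closedBall hz)).1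
  obtain ⟨δ, hδ, hδQ⟩ : ∃ δ > 0, ∀ z ∈ Metric.sphere ζ₀ r, δ ≤ ‖Q z‖ := by
    obtain ⟨z₁, hz₁, hmin⟩ := (isCompact_sphere ζ₀ r).exists_isMinOn
      (NormedSpace.sphere_nonempty.2 hr.le) (hQ.mono hsB).norm
    refine ⟨‖Q z₁‖, norm_pos_iff.2 ?_, fun z hz => hmin hz⟩
    refine (hball (Metric.sphere_subset_closedBall hz₁)).2.1 ?_
    rintro rfl
    rw [Metric.mem_sphere, dist_self] at hz₁
    exact hr.ne hz₁
  have hu := (tendstoLocallyUniformlyOn_iff_forall_isCompact hB).1 hF (Metric.closedBall ζ₀ r)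
    (fun z hz => (hball hz).1) (isCompact_closedBall _ _)
  filter_upwards [Metric.tendstoUniformlyOn_iff.1 hu (δ / 3) (by positivity), hd] with j hj hdj
  by_contra! hcon
  have hnz : ∀ z ∈ Metric.closedBall ζ₀ r, F j z ≠ 0 := fun z hz => hcon z (hball hz).2.2
  have hdc : DiffContOnCl ℂ (fun z => (F j z)⁻¹) (Metric.ball ζ₀ r) := by
    refine DifferentiableOn.diffContOnCl ?_
    rw [closure_ball _ hr.ne']
    exact (hdj.mono fun z hz => (hball hz).1).inv hnz
  have hbound := Complex.norm_le_of_forall_mem_frontier_norm_le Metric.isBounded_ball hdc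
    (C := (2 * δ / 3)⁻¹) (fun z hz => by
      rw [frontier_ball _ hr.ne'] at hz
      have h1 := hδQ z hz
      have h2 := hj z (Metric.sphere_subset_closedBall hz)
      rw [dist_eq_norm] at h2
      have h3 := norm_sub_norm_le (Q z) (F j z)
      rw [norm_inv]
      gcongr
      linarith) (subset_closure (Metric.mem_ball_self hr))
  have hc := Metric.mem_closedBall_self (x := ζ₀) hr.le
  have h4 := hj ζ₀ hc
  rw [h0, dist_zero_left] at h4
  rw [norm_inv, inv_le_inv₀ (norm_pos_iff.2 (hnz ζ₀ hc)) (by positivity)] at hbound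
  linarith

/-- Multiplicities of zeros are preserved in the limit. -/
theorem iterate_deriv_eq_zero_of_tendsto {F : ℕ → ℂ → ℂ} {Q : ℂ → ℂ} {B : Set ℂ}
    (hB : IsOpen B) (hF : TendstoLocallyUniformlyOn F Q atTop B)
    (hd : ∀ᶠ j in atTop, DifferentiableOn ℂ (F j) B) {ζ₀ : ℂ} (hζ₀ : ζ₀ ∈ B) (h0 : Q ζ₀ = 0)
    (hne : ∀ᶠ ζ in 𝓝[≠] ζ₀, Q ζ ≠ 0) {i : ℕ}
    (hi : ∀ᶠ j in atTop, ∀ ζ ∈ B, F j ζ = 0 → deriv^[i] (F j) ζ = 0) : deriv^[i] Q ζ₀ = 0 := by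
  by_contra hcon
  obtain ⟨hlim, hdi⟩ := tendstoLocallyUniformlyOn_iterate_deriv hB hF hd i
  have hcont : ContinuousAt (deriv^[i] Q) ζ₀ :=
    (hlim.differentiableOn hdi hB).continuousOn.continuousAt (hB.mem_nhds hζ₀)
  set δ := ‖deriv^[i] Q ζ₀‖ / 2 with hδ
  have hδ0 : 0 < δ := half_pos (norm_pos_iff.2 hcon)
  have h1 : ∀ᶠ ζ in 𝓝 ζ₀, δ < ‖deriv^[i] Q ζ‖ :=
    hcont.norm.eventually_const_lt (half_lt_self (norm_pos_iff.2 hcon))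
  obtain ⟨t, ht, hev⟩ := Metric.tendstoLocallyUniformlyOn_iff.1 hlim δ hδ0 ζ₀ hζ₀
  rw [hB.nhdsWithin_eq hζ₀] at ht
  have hz := eventually_exists_zero hB hF hd hζ₀ h0 hne
    (inter_mem (inter_mem ht h1) (hB.mem_nhds hζ₀))
  obtain ⟨j, ⟨ζ, hζ, hFζ⟩, hj2, hj3⟩ := (hz.and (hev.and hi)).exists
  have e1 := hj2 ζ hζ.1.1
  rw [hj3 ζ hζ.2 hFζ, dist_zero_right] at e1
  exact lt_asymm e1 hζ.1.2

lemma merOrder_eq_meromorphicOrderAt {f : ℂ → ℂ} {z : ℂ} (hf : MeromorphicAt f z) :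
    merOrder f z = meromorphicOrderAt f z := by
  by_cases htop : ∀ᶠ w in 𝓝[≠] z, f w = 0
  · rw [merOrder, if_pos htop, meromorphicOrderAt_eq_top_iff.2 htop]
  · have hex : ∃ n : ℤ, ∃ g : ℂ → ℂ, AnalyticAt ℂ g z ∧ g z ≠ 0 ∧
        ∀ᶠ w in 𝓝[≠] z, f w = (w - z) ^ n * g w := by
      obtain ⟨d, hd⟩ := WithTop.ne_top_iff_exists.1 (mt meromorphicOrderAt_eq_top_iff.1 htop)
      exact ⟨d, by simpa using (meromorphicOrderAt_eq_int_iff hf).1 hd.symm⟩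
    rw [merOrder, if_neg htop, dif_pos hex]
    exact ((meromorphicOrderAt_eq_int_iff hf).2 (by simpa using hex.choose_spec)).symm

lemma le_meromorphicOrderAt_iff {f : ℂ → ℂ} {z : ℂ} (hf : AnalyticAt ℂ f z) (m : ℕ) :
    ((m : ℤ) : WithTop ℤ) ≤ meromorphicOrderAt f z ↔ ∀ i < m, deriv^[i] f z = 0 := by
  simp only [← iteratedDeriv_eq_iterate]
  rw [← natCast_le_analyticOrderAt_iff_iteratedDeriv_eq_zero hf, hf.meromorphicOrderAt_eq]
  cases h : analyticOrderAt f z with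
  | top => simp
  | coe d =>
    rw [ENat.map_natCast]
    norm_cast

lemma iterate_deriv_comp_affine (F : ℂ → ℂ) (a x r : ℂ) (i : ℕ) :
    deriv^[i] (fun ζ => a * F (x + r * ζ)) = fun ζ => a * r ^ i * deriv^[i] F (x + r * ζ) := by
  induction i with
  | zero => simp
  | succ i ih =>
    rw [Function.iterate_succ_apply', ih, Function.iterate_succ_apply']
    funext ζ
    rw [deriv_const_mul_field, deriv_comp_mul_left (f := fun y => deriv^[i] F (x + y)),
      deriv_comp_const_add, smul_eq_mul, pow_succ]
    ring

lemma not_isPoleAt_of_order_pos {g : ℂ → ℂ} {ζ₀ c : ℂ} {k n : ℕ} (hn : n ≠ 0)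
    (hg : MeromorphicAt g ζ₀)
    (h : 0 < meromorphicOrderAt (fun z => deriv^[k] (g ^ n) z - c) ζ₀) : ¬ IsPoleAt g ζ₀ := by
  intro hp
  have h1 : meromorphicOrderAt g ζ₀ < 0 := (tendsto_cobounded_iff_meromorphicOrderAt_neg hg).1
    (tendsto_norm_atTop_iff_cobounded.1 hp)
  obtain ⟨d, hd⟩ := WithTop.ne_top_iff_exists.1 h1.ne_top
  have hd0 : d < 0 := by rw [← hd] at h1; exact_mod_cast h1
  have h2 : meromorphicOrderAt (g ^ n) ζ₀ = ((n * d : ℤ) : WithTop ℤ) := by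
    rw [meromorphicOrderAt_pow hg, ← hd]; push_cast; rfl
  have hnd : (n : ℤ) * d < 0 := mul_neg_of_pos_of_neg (by positivity) hd0
  have h3 := meromorphicOrderAt_iterate_deriv h2 k (Or.inl hnd)
  have h4 : meromorphicOrderAt (deriv^[k] (g ^ n)) ζ₀ < 0 := by
    rw [h3]; exact_mod_cast (by omega : (n : ℤ) * d - k < 0)
  have h5 := tendsto_norm_atTop_iff_cobounded.2 (tendsto_cobounded_of_meromorphicOrderAt_neg h4)
  have h6 := ((tendsto_zero_of_meromorphicOrderAt_pos h).add_const c).norm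
  simp only [sub_add_cancel] at h6
  exact not_tendsto_nhds_of_tendsto_atTop h5 _ h6

lemma eventually_forall_ball_add_mul_mem {x r : ℕ → ℂ} {z₀ : ℂ} (hx : Tendsto x atTop (𝓝 z₀))
    (hr : Tendsto r atTop (𝓝 0)) (ζ₀ : ℂ) (ρ : ℝ) {U : Set ℂ} (hU : U ∈ 𝓝 z₀) :
    ∀ᶠ j in atTop, ∀ ζ ∈ Metric.ball ζ₀ ρ, x j + r j * ζ ∈ U := by
  obtain ⟨ε, hε, hball⟩ := Metric.mem_nhds_iff.1 hU
  have hlim : Tendsto (fun j => dist (x j) z₀ + ‖r j‖ * (‖ζ₀‖ + |ρ|)) atTop (𝓝 0) := by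
    simpa using (tendsto_iff_dist_tendsto_zero.1 hx).add (hr.norm.mul_const (‖ζ₀‖ + |ρ|))
  filter_upwards [hlim.eventually_lt_const hε] with j hj ζ hζ
  refine hball ?_
  rw [Metric.mem_ball, dist_eq_norm] at hζ ⊢
  rw [dist_eq_norm] at hj
  have h1 : ‖ζ‖ ≤ ‖ζ₀‖ + |ρ| := by
    have := norm_sub_norm_le ζ ζ₀
    linarith [le_abs_self ρ]
  calc ‖x j + r j * ζ - z₀‖ = ‖(x j - z₀) + r j * ζ‖ := by ring_nf
    _ ≤ ‖x j - z₀‖ + ‖r j‖ * ‖ζ‖ := (norm_add_le _ _).trans (by rw [norm_mul])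
    _ ≤ ‖x j - z₀‖ + ‖r j‖ * (‖ζ₀‖ + |ρ|) := by gcongr
    _ < ε := hj

lemma TendstoLocallyUniformlyOn.tendsto_comp_affine {p : ℕ → ℂ → ℂ} {φ : ℂ → ℂ} {D : Set ℂ}
    (hD : IsOpen D) (h : TendstoLocallyUniformlyOn p φ atTop D) {z₀ : ℂ} (hz₀ : z₀ ∈ D)
    (hφ : ContinuousAt φ z₀) {x r : ℕ → ℂ} (hx : Tendsto x atTop (𝓝 z₀))
    (hr : Tendsto r atTop (𝓝 0)) (ζ₀ : ℂ) (ρ : ℝ) :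
    TendstoUniformlyOn (fun j ζ => p j (x j + r j * ζ)) (fun _ => φ z₀) atTop
      (Metric.ball ζ₀ ρ) := by
  rw [Metric.tendstoUniformlyOn_iff]
  intro ε hε
  obtain ⟨t, ht, hev⟩ := Metric.tendstoLocallyUniformlyOn_iff.1 h (ε / 2) (half_pos hε) z₀ hz₀
  rw [hD.nhdsWithin_eq hz₀] at ht
  filter_upwards [hev, eventually_forall_ball_add_mul_mem hx hr ζ₀ ρ
    (inter_mem ht (hφ (Metric.ball_mem_nhds _ (half_pos hε))))] with j h1 h2 ζ hζ
  obtain ⟨h3, h4⟩ := h2 ζ hζ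
  have h5 := h1 _ h3
  have h6 : dist (φ (x j + r j * ζ)) (φ z₀) < ε / 2 := h4
  rw [dist_comm] at h6
  linarith [dist_triangle (φ z₀) (φ (x j + r j * ζ)) (p j (x j + r j * ζ))]

lemma TendstoLocallyUniformlyOn.pow_of_continuousOn {G : ℕ → ℂ → ℂ} {g : ℂ → ℂ} {B : Set ℂ}
    (h : TendstoLocallyUniformlyOn G g atTop B) (hg : ContinuousOn g B) (n : ℕ) :
    TendstoLocallyUniformlyOn (fun j => G j ^ n) (g ^ n) atTop B := by
  induction n with
  | zero =>
    simp only [pow_zero]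
    exact fun u hu z _ => ⟨B, self_mem_nhdsWithin, Eventually.of_forall fun _ _ _ =>
      refl_mem_uniformity hu⟩
  | succ n ih =>
    simp only [pow_succ]
    exact ih.mul₀ h (hg.pow n) hg

lemma iterate_deriv_rescale_pow (f : ℂ → ℂ) {t : ℝ} (ht : 0 < t) (x : ℂ) (k n : ℕ) :
    deriv^[k] (rescale ((t ^ k : ℝ) : ℂ)⁻¹ x ((t ^ n : ℝ) : ℂ) f ^ n) =
      fun ζ => deriv^[k] (f ^ n) (x + ((t ^ n : ℝ) : ℂ) * ζ) := by
  have e : rescale ((t ^ k : ℝ) : ℂ)⁻¹ x ((t ^ n : ℝ) : ℂ) f ^ n =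
      fun ζ => (((t ^ k : ℝ) : ℂ)⁻¹) ^ n * (f ^ n) (x + ((t ^ n : ℝ) : ℂ) * ζ) := by
    funext ζ
    simp only [Pi.pow_apply, rescale, mul_pow]
  have ht' : (t : ℂ) ≠ 0 := by exact_mod_cast ht.ne'
  rw [e, iterate_deriv_comp_affine]
  funext ζ
  have : (((t ^ k : ℝ) : ℂ)⁻¹) ^ n * ((t ^ n : ℝ) : ℂ) ^ k = 1 := by
    push_cast
    rw [inv_pow, ← pow_mul, ← pow_mul, mul_comm n k, inv_mul_cancel₀ (pow_ne_zero _ ht')]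
  rw [this, one_mul]

/-- Zeros of `(gⁿ)⁽ᵏ⁾ - φ z₀` for a rescaled limit `g` inherit the lower bound on their
multiplicities. -/
theorem multiplicity_of_rescaled_limit {D : Set ℂ} (hD : IsOpen D) {f : ℕ → ℂ → ℂ}
    (hf : ∀ j, MeromorphicNiceOn (f j) D) {p : ℕ → ℂ → ℂ}
    (hp : ∀ j, DifferentiableOn ℂ (p j) D) {φ : ℂ → ℂ}
    (hconv : TendstoLocallyUniformlyOn p φ atTop D) {k m n : ℕ} (hn : n ≠ 0)
    (hmult : ∀ j, ∀ z ∈ D, deriv^[k] (f j ^ n) z - p j z = 0 →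
      ((m : ℤ) : WithTop ℤ) ≤ merOrder (fun w => deriv^[k] (f j ^ n) w - p j w) z)
    {z₀ : ℂ} (hz₀ : z₀ ∈ D) {x : ℕ → ℂ} {t : ℕ → ℝ} (ht : ∀ j, 0 < t j)
    (hx : Tendsto x atTop (𝓝 z₀)) (ht0 : Tendsto t atTop (𝓝 0)) {g : ℂ → ℂ}
    (hg : MeromorphicNiceOn g univ)
    (hG : ConvSphLocUnif (fun j => rescale ((t j ^ k : ℝ) : ℂ)⁻¹ (x j) ((t j ^ n : ℝ) : ℂ) (f j))
      g univ) {ζ₀ : ℂ}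
    (hpos : 0 < meromorphicOrderAt (fun z => deriv^[k] (g ^ n) z - φ z₀) ζ₀) :
    ((m : ℤ) : WithTop ℤ) ≤ meromorphicOrderAt (fun z => deriv^[k] (g ^ n) z - φ z₀) ζ₀ := by
  set Q : ℂ → ℂ := fun z => deriv^[k] (g ^ n) z - φ z₀ with hQ
  have hnp := not_isPoleAt_of_order_pos hn (hg.1 ζ₀ (mem_univ _)) hpos
  have hQa : AnalyticAt ℂ Q ζ₀ :=
    (((hg.analyticAt (mem_univ _) hnp).pow n).iterated_deriv k).sub analyticAt_const
  have hQ0 : Q ζ₀ = 0 := tendsto_nhds_unique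
    (hQa.continuousAt.tendsto.mono_left nhdsWithin_le_nhds)
    (tendsto_zero_of_meromorphicOrderAt_pos hpos)
  rcases hQa.eventually_eq_zero_or_eventually_ne_zero with htop | hne
  · rw [meromorphicOrderAt_eq_top_iff.2 (htop.filter_mono nhdsWithin_le_nhds)]
    exact le_top
  have hφc : ContinuousAt φ z₀ := ((hconv.differentiableOn (Eventually.of_forall hp)
    hD).continuousOn).continuousAt (hD.mem_nhds hz₀)
  set r : ℕ → ℂ := fun j => ((t j ^ n : ℝ) : ℂ) with hr
  have hr0 : Tendsto r atTop (𝓝 0) := by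
    have := (continuous_ofReal.tendsto 0).comp (by simpa [hn] using ht0.pow n)
    simpa [Function.comp_def, hr] using this
  have hrne : ∀ j, r j ≠ 0 := fun j => by
    simp only [hr]; exact_mod_cast (pow_pos (ht j) n).ne'
  have hane : ∀ j, ((t j ^ k : ℝ) : ℂ)⁻¹ ≠ 0 := fun j =>
    inv_ne_zero (by exact_mod_cast (pow_pos (ht j) k).ne')
  obtain ⟨ρ, hρ, hGp, hGu, hgd⟩ :=
    hG.exists_tendstoUniformlyOn isOpen_univ hg (mem_univ ζ₀) hnp
  set B := Metric.ball ζ₀ ρ with hBdef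
  have hB : IsOpen B := Metric.isOpen_ball
  have hmem := eventually_forall_ball_add_mul_mem hx hr0 ζ₀ ρ (hD.mem_nhds hz₀)
  have hfa : ∀ᶠ j in atTop, ∀ ζ ∈ B, x j + r j * ζ ∈ D ∧ AnalyticAt ℂ (f j) (x j + r j * ζ) := by
    filter_upwards [hGp, hmem] with j h1 h2 ζ hζ
    exact ⟨h2 ζ hζ, (hf j).analyticAt (h2 ζ hζ) fun h =>
      h1 ζ hζ ((isPoleAt_rescale (hane j) (hrne j)).2 h)⟩
  have haff : ∀ j ζ, AnalyticAt ℂ (fun ζ => x j + r j * ζ) ζ := fun j ζ => by fun_prop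
  have hGd : ∀ᶠ j in atTop, DifferentiableOn ℂ
      (rescale ((t j ^ k : ℝ) : ℂ)⁻¹ (x j) (r j) (f j) ^ n) B := by
    filter_upwards [hfa] with j hj ζ hζ
    have h1 : AnalyticAt ℂ (fun ζ => f j (x j + r j * ζ)) ζ :=
      AnalyticAt.fun_comp (f := fun ζ => x j + r j * ζ) (hj ζ hζ).2 (haff j ζ)
    exact ((analyticAt_const.mul h1).pow n).differentiableAt.differentiableWithinAt
  obtain ⟨hlim, hlimd⟩ := tendstoLocallyUniformlyOn_iterate_deriv hB
    (hGu.tendstoLocallyUniformlyOn.pow_of_continuousOn hgd.continuousOn n) hGd k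
  set F : ℕ → ℂ → ℂ := fun j w => deriv^[k] (f j ^ n) w - p j w with hF
  have hpd : ∀ᶠ j in atTop, DifferentiableOn ℂ (fun ζ => p j (x j + r j * ζ)) B := by
    filter_upwards [hmem] with j hj
    exact (hp j).comp (fun ζ _ => (haff j ζ).differentiableAt.differentiableWithinAt) hj
  have hFlim : TendstoLocallyUniformlyOn (fun j ζ => F j (x j + r j * ζ)) Q atTop B := by
    have := hlim.sub
      (hconv.tendsto_comp_affine hD hz₀ hφc hx hr0 ζ₀ ρ).tendstoLocallyUniformlyOn
    refine (this.congr ?_)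
    intro j ζ _
    simp only [Pi.sub_apply, hF, iterate_deriv_rescale_pow (f j) (ht j)]
    rfl
  have hFd : ∀ᶠ j in atTop, DifferentiableOn ℂ (fun ζ => F j (x j + r j * ζ)) B := by
    filter_upwards [hlimd, hpd] with j h1 h2
    rw [iterate_deriv_rescale_pow (f j) (ht j)] at h1
    exact h1.sub h2
  rw [le_meromorphicOrderAt_iff hQa]
  intro i hi
  refine iterate_deriv_eq_zero_of_tendsto hB hFlim hFd (Metric.mem_ball_self hρ) hQ0 hne ?_
  filter_upwards [hfa] with j hj ζ hζ hzero
  obtain ⟨hw, hfw⟩ := hj ζ hζ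
  have hFa : AnalyticAt ℂ (F j) (x j + r j * ζ) :=
    ((hfw.pow n).iterated_deriv k).sub ((hp j).analyticAt (hD.mem_nhds hw))
  have h1 := hmult j _ hw hzero
  rw [merOrder_eq_meromorphicOrderAt hFa.meromorphicAt, le_meromorphicOrderAt_iff hFa] at h1
  have h2 := iterate_deriv_comp_affine (F j) 1 (x j) (r j) i
  simp only [one_mul] at h2
  rw [h2]
  simp only
  rw [h1 i hi, mul_zero]

lemma MeromorphicNiceOn.eq_const {g : ℂ → ℂ} (hg : MeromorphicNiceOn g univ) {a : ℂ}
    (h : ∀ z, ∀ᶠ w in 𝓝[≠] z, g w = a) (z : ℂ) : stereoFun g z = stereo a := by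
  have hlim : Tendsto g (𝓝[≠] z) (𝓝 a) :=
    tendsto_const_nhds.congr' ((h z).mono fun w hw => hw.symm)
  have hnp : ¬ IsPoleAt g z := fun hp => not_tendsto_nhds_of_tendsto_atTop hp _ hlim.norm
  have hc := (hg.analyticAt (mem_univ z) hnp).continuousAt
  rw [stereoFun_of_not_isPoleAt hnp,
    tendsto_nhds_unique (hc.tendsto.mono_left nhdsWithin_le_nhds) hlim]

lemma natCast_cond {k m n : ℕ} (hm : 1 ≤ m) (hn : 1 ≤ n)
    (hcond : ((k : ℝ) + 2) / n + 1 / (m : ℝ) + (k : ℝ) / ((m : ℝ) * n) < 1) :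
    k + 3 ≤ n ∧ (k + 2) * m + n + k < n * m := by
  have hm0 : (0 : ℝ) < m := by exact_mod_cast hm
  have hn0 : (0 : ℝ) < n := by exact_mod_cast hn
  have e : ((k : ℝ) + 2) / n + 1 / (m : ℝ) + (k : ℝ) / ((m : ℝ) * n) =
      ((k + 2) * m + n + k) / (n * m) := by
    field_simp
  rw [e, div_lt_one (by positivity)] at hcond
  have h : (k + 2) * m + n + k < n * m := by exact_mod_cast hcond
  refine ⟨?_, h⟩
  by_contra! hlt
  have : n * m ≤ (k + 2) * m := Nat.mul_le_mul_right m (by omega)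
  omega

/-- **Auxiliary normality lemma.** Let `{f j}` be a family of meromorphic functions on a
domain `D`, `φ j` holomorphic functions converging locally uniformly to a nowhere vanishing
holomorphic `φ`, and `k, m, n` positive integers with `(k+2)/n + 1/m + k/(mn) < 1`. If every
zero of `(f jⁿ)⁽ᵏ⁾ − φ j` has multiplicity at least `m`, then `{f j}` is normal in `D`. -/
theorem normality_lemma (D : Set ℂ) (hD : IsOpen D) (hDconn : IsConnected D)
    (f : ℕ → ℂ → ℂ) (hmero : ∀ j, MeromorphicNiceOn (f j) D)
    (φseq : ℕ → ℂ → ℂ) (hφseq : ∀ j, DifferentiableOn ℂ (φseq j) D)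
    (φ : ℂ → ℂ) (hφ : DifferentiableOn ℂ φ D) (hφ0 : ∀ z ∈ D, φ z ≠ 0)
    (hconv : TendstoLocallyUniformlyOn φseq φ atTop D)
    (k m n : ℕ) (hk : 1 ≤ k) (hm : 1 ≤ m) (hn : 1 ≤ n)
    (hcond : ((k : ℝ) + 2) / n + 1 / (m : ℝ) + (k : ℝ) / ((m : ℝ) * n) < 1)
    (hmult : ∀ j, ∀ z ∈ D, iteratedDeriv k (f j ^ n) z - φseq j z = 0 →
      ((m : ℤ) : WithTop ℤ) ≤ merOrder (fun w => iteratedDeriv k (f j ^ n) w - φseq j w) z) :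
    NormalSeqOn f D := by
  intro τ hτ
  obtain ⟨hkn, hcond'⟩ := natCast_cond hm hn hcond
  simp only [iteratedDeriv_eq_iterate] at hmult
  refine LocallyTame.exists_subseq hD hDconn.isPreconnected (f := fun j => f (τ j))
    (locallyTame_of_tameAt (k := k) (n := n) hD (fun j => hmero (τ j)) ?_)
  by_contra! hcon
  obtain ⟨z₀, hz₀, hnt⟩ := hcon
  obtain ⟨σ, hσ, x, t, ht, hx, ht0, g, hg, hG, hgne⟩ :=
    exists_rescaled_limit (k := k) (n := n) hk (by omega) hD (fun j => hmero (τ j)) hz₀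
      (fun t ht => by simpa using hnt t ht)
  have hsub : Tendsto (fun j => τ (σ j)) atTop atTop :=
    hτ.tendsto_atTop.comp hσ.tendsto_atTop
  have hconv' : TendstoLocallyUniformlyOn (fun j => φseq (τ (σ j))) φ atTop D := by
    intro u hu z hz
    obtain ⟨s, hs, hev⟩ := hconv u hu z hz
    exact ⟨s, hs, hsub.eventually hev⟩
  obtain ⟨a, ha⟩ := eq_const_of_zeros_multiplicity
    (fun z => hg.1 z (mem_univ z)) (hφ0 z₀ hz₀) hkn hcond'
    (fun z hz => multiplicity_of_rescaled_limit hD (fun j => hmero (τ (σ j)))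
      (fun j => hφseq (τ (σ j))) hconv' (by omega) (fun j => hmult (τ (σ j))) hz₀ ht hx ht0 hg
      hG hz)
  exact hgne ⟨_, hg.eq_const ha⟩

end
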